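/- If the Riemann Hypothesis is true, then for all real x ≥ 24.2, |(e^{-C}/log x) · ∏_{p ≤ x} (1 - 1/p)^{-1} - 1| ≤ 3 log x / (8π√x), where C is the Euler–Mascheroni constant. -/

import Mathlib

section
open Complex Set Filter MeasureTheory HurwitzZeta
open scoped Real Topology

namespace MRH

/-- the modified theta kernel -/
noncomputable def thK (x : ℝ) : ℝ :=
  (Ioi (1:ℝ)).indicator (fun x => evenKernel 0 x - 1) x +
  (Ioo (0:ℝ) 1).indicator (fun x => evenKernel 0 x - x ^ (-(1/2) : ℝ)) x

lemma f_modif_eq (x : ℝ) : (hurwitzEvenFEPair 0).f_modif x = (thK x : ℂ) := by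
  simp only [WeakFEPair.f_modif, thK, hurwitzEvenFEPair, Pi.add_apply, indicator]
  split_ifs <;> simp

lemma evenKernel_ge_one {x : ℝ} (hx : 0 < x) : 1 ≤ evenKernel 0 x := by
  have h := hasSum_int_evenKernel 0 hx
  have := h.summable.le_tsum 0 (fun _ _ => (Real.exp_pos _).le)
  simp only [QuotientAddGroup.mk_zero] at h
  rw [h.tsum_eq] at this
  simpa using this

lemma thK_nonneg (x : ℝ) : 0 ≤ thK x := by
  unfold thK
  refine add_nonneg (indicator_nonneg (fun x hx => ?_) x) (indicator_nonneg (fun x hx => ?_) x)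
  · have := evenKernel_ge_one (lt_trans one_pos hx)
    simp only [mem_Ioi] at hx
    linarith
  · have h0 : 0 < x := hx.1
    rw [evenKernel_functional_equation, ← evenKernel_eq_cosKernel_of_zero,
      Real.rpow_neg h0.le, one_div]
    have := evenKernel_ge_one (x := 1/x) (by positivity)
    have h2 : 0 < (x ^ (1/2:ℝ))⁻¹ := by positivity
    nlinarith

lemma L0_eq (s : ℂ) : completedRiemannZeta₀ s = (mellin (fun x => (thK x : ℂ)) (s/2)) / 2 := by
  have : (fun x => (thK x : ℂ)) = (hurwitzEvenFEPair 0).f_modif := by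
    ext x; rw [f_modif_eq]
  rw [this]; rfl

lemma thK_conv (s : ℂ) : MellinConvergent (fun x => (thK x : ℂ)) s := by
  have : (fun x => (thK x : ℂ)) = (hurwitzEvenFEPair 0).f_modif := by
    ext x; rw [f_modif_eq]
  rw [this]
  exact ((hurwitzEvenFEPair 0).isStrongFEPair_toStrongFEPair.hasMellin s).1

lemma thK_int (σ : ℝ) : IntegrableOn (fun x : ℝ => x ^ (σ - 1) * thK x) (Ioi 0) := by
  have h := (thK_conv σ).norm
  refine h.congr ?_
  filter_upwards [ae_restrict_mem measurableSet_Ioi] with x hx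
  simp only [smul_eq_mul, norm_mul, norm_real, Real.norm_eq_abs, abs_of_nonneg (thK_nonneg x)]
  rw [norm_cpow_eq_rpow_re_of_pos hx]; simp

lemma L0_real (σ : ℝ) : completedRiemannZeta₀ σ = (((∫ x in Ioi (0:ℝ), x ^ (σ/2 - 1) * thK x) / 2 : ℝ) : ℂ) := by
  rw [L0_eq, mellin]; push_cast; congr 1
  refine Eq.trans ?_ integral_complex_ofReal
  refine setIntegral_congr_fun measurableSet_Ioi (fun x hx => ?_)
  simp only [smul_eq_mul]; push_cast
  rw [ofReal_cpow (le_of_lt hx)]; push_cast; rfl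

lemma norm_L0_le {s : ℂ} {N : ℝ} (h1 : 1 - N ≤ s.re) (h2 : s.re ≤ N) :
    ‖completedRiemannZeta₀ s‖ ≤ 2 * ‖completedRiemannZeta₀ N‖ := by
  have e1 : completedRiemannZeta₀ ((1 - N : ℝ):ℂ) = completedRiemannZeta₀ N := by
    rw [← completedRiemannZeta₀_one_sub]; push_cast; congr 1; ring
  have r1 := L0_real N
  have r2 := L0_real (1-N)
  rw [e1] at r2
  set a := ∫ x in Ioi (0:ℝ), x ^ (N/2 - 1) * thK x with ha
  set b := ∫ x in Ioi (0:ℝ), x ^ ((1-N)/2 - 1) * thK x with hb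
  have ab : a = b := by
    have := r1.symm.trans r2
    have := ofReal_injective this
    linarith
  have a0 : 0 ≤ a := setIntegral_nonneg measurableSet_Ioi (fun x hx =>
    mul_nonneg (Real.rpow_nonneg (le_of_lt hx) _) (thK_nonneg x))
  have key : ‖mellin (fun x => (thK x : ℂ)) (s/2)‖ ≤ a + b := by
    rw [mellin, ha, hb, ← integral_add (thK_int _) (thK_int _)]
    refine norm_integral_le_of_norm_le ((thK_int _).add (thK_int _)) ?_
    filter_upwards [ae_restrict_mem measurableSet_Ioi] with x hx
    simp only [smul_eq_mul, norm_mul, norm_real, Real.norm_eq_abs, abs_of_nonneg (thK_nonneg x)]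
    rw [norm_cpow_eq_rpow_re_of_pos hx, ← add_mul]
    refine mul_le_mul_of_nonneg_right ?_ (thK_nonneg x)
    have hx0 : 0 < x := hx
    have e : (s/2 - 1).re = s.re/2 - 1 := by simp
    rw [e]
    rcases le_total 1 x with h | h
    · refine (Real.rpow_le_rpow_of_exponent_le h (by linarith : s.re/2 - 1 ≤ N/2-1)).trans ?_
      have : 0 ≤ x ^ ((1-N)/2 - 1) := by positivity
      linarith
    · refine (Real.rpow_le_rpow_of_exponent_ge hx0 h (by linarith : (1-N)/2-1 ≤ s.re/2 - 1)).trans ?_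
      have : 0 ≤ x ^ (N/2 - 1) := by positivity
      linarith
  rw [L0_eq s, r1, norm_div, norm_real, Real.norm_of_nonneg (by positivity)]
  simp only [Complex.norm_ofNat]
  linarith

lemma L0_even_le (m : ℕ) (hm : 1 ≤ m) : ‖completedRiemannZeta₀ ((2 * m : ℝ):ℂ)‖ ≤ 4 * (m:ℝ) ^ m := by
  have hm' : (1:ℝ) ≤ m := by exact_mod_cast hm
  have hmc : (m:ℂ) ≠ 0 := by exact_mod_cast (by lia : m ≠ 0)
  have h1 := completedRiemannZeta_eq ((2 * m : ℝ):ℂ)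
  have hne : ((2 * m : ℝ):ℂ) ≠ 0 := by push_cast; exact mul_ne_zero two_ne_zero hmc
  have h2 := riemannZeta_def_of_ne_zero hne
  have hG : Gammaℝ ((2 * m : ℝ):ℂ) ≠ 0 := Gammaℝ_ne_zero_of_re_pos (by simp; lia)
  have h3 : completedRiemannZeta ((2 * m : ℝ):ℂ) = riemannZeta ((2 * m : ℝ):ℂ) * Gammaℝ ((2 * m : ℝ):ℂ) := by
    rw [h2]; field_simp
  have h4 : completedRiemannZeta₀ ((2 * m : ℝ):ℂ) = riemannZeta ((2 * m : ℝ):ℂ) * Gammaℝ ((2 * m : ℝ):ℂ)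
      + 1 / ((2 * m : ℝ):ℂ) + 1 / (1 - ((2 * m : ℝ):ℂ)) := by
    rw [← h3, h1]; ring
  have hz : ‖riemannZeta ((2 * m : ℝ):ℂ)‖ ≤ 2 := by
    have hz2 : (1:ℝ) < 2 * m := by linarith
    rw [zeta_eq_tsum_one_div_nat_cpow (by simpa using hz2)]
    have hs := (Real.summable_one_div_nat_pow.mpr one_lt_two)
    have hb : ∀ n : ℕ, ‖1 / (n:ℂ) ^ ((2 * m : ℝ):ℂ)‖ ≤ 1 / (n:ℝ) ^ 2 := by
      intro n
      rcases Nat.eq_zero_or_pos n with rfl | hn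
      · simp; lia
      · have hn' : (1:ℝ) ≤ n := by exact_mod_cast hn
        rw [norm_div, norm_one, norm_natCast_cpow_of_pos hn, ofReal_re]
        refine one_div_le_one_div_of_le (by positivity) ?_
        rw [← Real.rpow_natCast]
        exact Real.rpow_le_rpow_of_exponent_le hn' (by push_cast; linarith)
    refine (tsum_of_norm_bounded hs.hasSum hb).trans ?_
    rw [hasSum_zeta_two.tsum_eq]
    nlinarith [Real.pi_lt_d2, Real.pi_pos]
  have hGa : ‖Gammaℝ ((2 * m : ℝ):ℂ)‖ ≤ (m:ℝ)^m := by
    rw [Gammaℝ_def]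
    have : ((2 * m : ℝ):ℂ)/2 = ((m - 1 : ℕ):ℂ) + 1 := by
      push_cast [Nat.cast_sub hm]; ring
    rw [this, Gamma_nat_eq_factorial, norm_mul, Complex.norm_natCast,
      norm_cpow_eq_rpow_re_of_pos Real.pi_pos]
    have e1 : π ^ (-((2 * m : ℝ):ℂ)/2).re ≤ 1 := by
      apply Real.rpow_le_one_of_one_le_of_nonpos (by linarith [Real.pi_gt_three])
      simp
      linarith
    have e2 : (((m-1).factorial : ℕ):ℝ) ≤ (m:ℝ)^m := by
      have : (m-1).factorial ≤ m^m := (Nat.factorial_le (by lia)).trans (Nat.factorial_le_pow m)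
      exact_mod_cast this
    have : (0:ℝ) ≤ (((m-1).factorial : ℕ):ℝ) := by positivity
    nlinarith
  have i1 : ‖1 / ((2 * m : ℝ):ℂ)‖ ≤ 1/2 := by
    rw [norm_div, norm_one, norm_real, Real.norm_of_nonneg (by positivity)]
    exact one_div_le_one_div_of_le (by norm_num) (by linarith)
  have i2 : ‖1 / (1 - ((2 * m : ℝ):ℂ))‖ ≤ 1 := by
    rw [← ofReal_one, ← ofReal_sub, norm_div, norm_real, norm_real, Real.norm_eq_abs, Real.norm_eq_abs, abs_one,
      div_le_one (by rw [abs_pos]; linarith), abs_of_neg (by linarith)]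
    linarith
  have hmm : (1:ℝ) ≤ (m:ℝ)^m := one_le_pow₀ hm'
  rw [h4]
  calc _ ≤ ‖riemannZeta ((2 * m : ℝ):ℂ)‖ * ‖Gammaℝ ((2 * m : ℝ):ℂ)‖ + 1/2 + 1 := by
        refine (norm_add₃_le).trans ?_
        rw [norm_mul]; linarith
    _ ≤ 2 * (m:ℝ)^m + 1/2 + 1 := by
        have := mul_le_mul hz hGa (norm_nonneg _) (by norm_num)
        linarith
    _ ≤ _ := by linarith
end MRH
end

section
open Complex Set Filter MeasureTheory HurwitzZeta
open scoped Real Topology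

namespace MRH

lemma cpow_half_sq (w : ℂ) : (w ^ (1/2:ℂ)) ^ 2 = w := by
  rw [← cpow_nat_mul]; simp

lemma even_sqrt_diff {P : ℂ → ℂ} (hP : Differentiable ℂ P) (hev : ∀ z, P (-z) = P z) :
    Differentiable ℂ (fun w => P (w ^ (1/2:ℂ))) := by
  have hsq : ∀ a b : ℂ, a ^ 2 = b ^ 2 → P a = P b := by
    intro a b h
    rcases sq_eq_sq_iff_eq_or_eq_neg.mp h with h | h
    · rw [h]
    · rw [h, hev]
  have h1 : ∀ w0 : ℂ, w0 ≠ 0 → DifferentiableAt ℂ (fun w => P (w ^ (1/2:ℂ))) w0 := by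
    intro w0 hw0
    have hd : DifferentiableAt ℂ (fun w => P (w0 ^ (1/2:ℂ) * (w / w0) ^ (1/2:ℂ))) w0 := by
      refine (hP _).comp w0 ?_
      refine DifferentiableAt.const_mul ?_ _
      refine DifferentiableAt.cpow_const (by fun_prop) ?_
      rw [div_self hw0]; exact one_mem_slitPlane
    refine hd.congr_of_eventuallyEq (Eventually.of_forall fun w => ?_)
    apply hsq
    rw [mul_pow, cpow_half_sq, cpow_half_sq, cpow_half_sq]; field_simp
  have hc : ContinuousAt (fun w : ℂ => P (w ^ (1/2:ℂ))) 0 := by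
    refine ContinuousAt.comp (g := P) (hP.continuous.continuousAt) ?_
    rw [ContinuousAt, zero_cpow (by norm_num), tendsto_zero_iff_norm_tendsto_zero]
    have : (fun w : ℂ => ‖w ^ (1/2:ℂ)‖) = fun w => √‖w‖ := by
      ext w
      rw [eq_comm, Real.sqrt_eq_iff_mul_self_eq (norm_nonneg _) (norm_nonneg _), ← norm_mul, ← sq, cpow_half_sq]
    rw [this]
    have h2 : Continuous (fun w : ℂ => √‖w‖) := by fun_prop
    have := h2.tendsto 0
    simpa using this
  have := (differentiableOn_compl_singleton_and_continuousAt_iff (s := univ) (c := (0:ℂ))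
    (f := fun w => P (w ^ (1/2:ℂ))) univ_mem).mp ⟨fun w hw => (h1 w hw.2).differentiableWithinAt, hc⟩
  exact differentiableOn_univ.mp this

/-- the xi function in the variable `v = s(s-1)` -/
noncomputable def F (v : ℂ) : ℂ := 1 + v * completedRiemannZeta₀ (1/2 + (v + 1/4) ^ (1/2:ℂ))

lemma F_diff : Differentiable ℂ F := by
  have h := even_sqrt_diff (P := fun z => completedRiemannZeta₀ (1/2 + z))
    (by exact differentiable_completedZeta₀.comp (by fun_prop)) (fun z => by
      rw [← completedRiemannZeta₀_one_sub]; congr 1; ring)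
  have h2 : Differentiable ℂ (fun v : ℂ => completedRiemannZeta₀ (1/2 + (v + 1/4) ^ (1/2:ℂ))) :=
    h.comp (f := fun v : ℂ => v + 1/4) (by fun_prop)
  unfold F
  exact (differentiable_const _).add (differentiable_id.mul h2)

lemma F_eq (s : ℂ) : F (s * (s - 1)) = 1 + s * (s - 1) * completedRiemannZeta₀ s := by
  unfold F
  have h : ((s * (s - 1) + 1/4) ^ (1/2:ℂ)) ^ 2 = (s - 1/2)^2 := by rw [cpow_half_sq]; ring
  rcases sq_eq_sq_iff_eq_or_eq_neg.mp h with h | h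
  · rw [h]; congr 3; ring
  · rw [h, ← completedRiemannZeta₀_one_sub s]; congr 3; ring

lemma F_zero : F 0 = 1 := by simp [F]

lemma F_eq' {s : ℂ} (h0 : s ≠ 0) (h1 : s ≠ 1) : F (s * (s - 1)) = s * (s - 1) * completedRiemannZeta s := by
  rw [F_eq, completedRiemannZeta_eq]
  have : 1 - s ≠ 0 := sub_ne_zero.mpr h1.symm
  field_simp; ring

lemma F_zeros (hRH : RiemannHypothesis) {v : ℂ} (hv : F v = 0) : ∃ q : ℝ, 1/4 ≤ q ∧ v = -(q:ℂ) := by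
  set z := (v + 1/4) ^ (1/2:ℂ) with hz
  have hz2 : z ^ 2 = v + 1/4 := by rw [hz, cpow_half_sq]
  have hvs : v = (1/2 + z) * (1/2 + z - 1) := by
    have : v = z^2 - 1/4 := by rw [hz2]; ring
    rw [this]; ring
  have hv0 : v ≠ 0 := by rintro rfl; rw [F_zero] at hv; exact one_ne_zero hv
  have hs0 : 1/2 + z ≠ 0 := by intro h; rw [h] at hvs; simp at hvs; exact hv0 hvs
  have hs1 : 1/2 + z ≠ 1 := by intro h; rw [h] at hvs; simp at hvs; exact hv0 hvs
  have hre : 0 ≤ z.re := by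
    rw [hz]
    by_cases h : v + 1/4 = 0
    · rw [h]; simp
    · rw [cpow_def_of_ne_zero h, exp_re]
      refine mul_nonneg (Real.exp_pos _).le (Real.cos_nonneg_of_mem_Icc ?_)
      have e : (log (v+1/4) * (1/2)).im = (log (v+1/4)).im / 2 := by
        simp [mul_im]; ring
      rw [e, log_im]
      constructor <;> linarith [neg_pi_lt_arg (v+1/4), arg_le_pi (v+1/4)]
  rw [hvs, F_eq' hs0 hs1, ← hvs] at hv
  have hL : completedRiemannZeta (1/2+z) = 0 := by
    rcases mul_eq_zero.mp hv with h | h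
    · exact absurd h hv0
    · exact h
  have hzeta : riemannZeta (1/2+z) = 0 := by rw [riemannZeta_def_of_ne_zero hs0, hL, zero_div]
  have := hRH (1/2+z) hzeta (by
    rintro ⟨n, hn⟩
    have := congrArg re hn
    simp at this
    have : (0:ℝ) ≤ n := by positivity
    linarith) hs1
  have hzre : z.re = 0 := by simpa using this
  refine ⟨1/4 + z.im^2, by nlinarith [sq_nonneg z.im], ?_⟩
  have hzi : z = z.im * I := by apply Complex.ext <;> simp [hzre]
  have : v = z^2 - 1/4 := by rw [hz2]; ring
  rw [this, hzi, mul_pow, I_sq]; push_cast; simp; ring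

lemma F_growth {q : ℝ} (hq : 1 ≤ q) {v : ℂ} (hv : ‖v‖ ≤ q^4) : ‖F v‖ ≤ Real.exp (30 * q^3) := by
  set z := (v + 1/4) ^ (1/2:ℂ) with hz
  have hz2 : z ^ 2 = v + 1/4 := by rw [hz, cpow_half_sq]
  have hq4 : 1 ≤ q^4 := one_le_pow₀ hq
  have hzn : ‖z‖ ≤ 2 * q^2 - 1/2 := by
    have : ‖z‖^2 ≤ q^4 + 1/4 := by
      rw [← norm_pow, hz2]
      refine (norm_add_le _ _).trans ?_
      have : ‖(1/4:ℂ)‖ = 1/4 := by norm_num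
      rw [this]; linarith
    refine abs_le_of_sq_le_sq' ?_ (by nlinarith) |>.2
    nlinarith
  set m := ⌈q^2⌉₊ with hm
  have hm1 : q^2 ≤ m := Nat.le_ceil _
  have hm2 : (m:ℝ) < q^2 + 1 := Nat.ceil_lt_add_one (by positivity)
  have hm0 : 1 ≤ m := by
    have : (1:ℝ) ≤ m := by nlinarith
    exact_mod_cast this
  have hzre := abs_le.mp (abs_re_le_norm z)
  have b1 := norm_L0_le (s := 1/2 + z) (N := 2 * m) (by simp; linarith) (by simp; linarith)
  have b2 := L0_even_le m hm0
  have b3 : (m:ℝ)^m ≤ Real.exp (16 * q^3) := by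
    have hmp : (0:ℝ) < m := by linarith [sq_nonneg q, show (1:ℝ) ≤ m by exact_mod_cast hm0]
    rw [← Real.exp_log (pow_pos hmp m), Real.log_pow, Real.exp_le_exp]
    have l1 : Real.log m ≤ 4 * q := by
      have : Real.log m ≤ Real.log ((2*q)^2) := Real.log_le_log hmp (by nlinarith)
      rw [Real.log_pow] at this
      have := Real.log_le_sub_one_of_pos (x := 2 * q) (by linarith)
      push_cast at *
      linarith
    have : (m:ℝ) ≤ 4 * q^2 := by nlinarith
    calc (m:ℝ) * Real.log m ≤ (4 * q^2) * (4 * q) := by gcongr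
      _ = _ := by ring
  have b4 : q^4 ≤ Real.exp (4 * q) := by
    have : q ≤ Real.exp q := by linarith [Real.add_one_le_exp q]
    calc q^4 ≤ (Real.exp q)^4 := by gcongr
      _ = _ := by rw [← Real.exp_nat_mul]; norm_num
  have b5 : (9:ℝ) ≤ Real.exp (4*q) := by
    have : (2:ℝ) ≤ Real.exp q := by linarith [Real.add_one_le_exp q]
    calc (9:ℝ) ≤ 2^4 := by norm_num
      _ ≤ (Real.exp q)^4 := by gcongr
      _ = _ := by rw [← Real.exp_nat_mul]; norm_num
  have c0 : ‖F v‖ ≤ 1 + q^4 * (8 * Real.exp (16*q^3)) := by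
    unfold F
    refine (norm_add_le _ _).trans ?_
    rw [norm_one, norm_mul]
    have : ‖completedRiemannZeta₀ (1 / 2 + z)‖ ≤ 8 * Real.exp (16*q^3) := by linarith
    gcongr
  have e1 : 1 ≤ Real.exp (16*q^3) := Real.one_le_exp (by positivity)
  calc ‖F v‖ ≤ 1 + q^4 * (8 * Real.exp (16*q^3)) := c0
    _ ≤ q^4 * (9 * Real.exp (16*q^3)) := by nlinarith
    _ ≤ Real.exp (4*q) * (Real.exp (4*q) * Real.exp (16*q^3)) := by gcongr
    _ = Real.exp (4*q+4*q+16*q^3) := by rw [← Real.exp_add, ← Real.exp_add]; ring_nf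
    _ ≤ _ := by
      rw [Real.exp_le_exp]
      have : q ≤ q^3 := le_self_pow₀ hq (by norm_num)
      linarith
end MRH
end

section
open Complex Set Filter MeasureTheory Metric
open scoped Real Topology

namespace MRH

lemma factor1 {f : ℂ → ℂ} (hf : Differentiable ℂ f) (h0 : f 0 ≠ 0) {a : ℂ} (ha : a ≠ 0) :
    ∃ g : ℂ → ℂ, Differentiable ℂ g ∧ g a ≠ 0 ∧ ∀ z, f z = (1 - z / a) ^ (analyticOrderNatAt f a) * g z := by
  have han : AnalyticAt ℂ f a := hf.analyticAt a
  have hne : analyticOrderAt f a ≠ ⊤ := by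
    intro h
    rw [analyticOrderAt_eq_top] at h
    have hA : AnalyticOnNhd ℂ f univ := fun z _ => hf.analyticAt z
    have := hA.eqOn_zero_of_preconnected_of_eventuallyEq_zero isPreconnected_univ (mem_univ a) h
    exact h0 (this (mem_univ 0))
  obtain ⟨p, hp⟩ := han
  obtain ⟨g0, hg0, hg0a, hfg⟩ := (hf.analyticAt a).analyticOrderAt_ne_top.1 hne
  set n := analyticOrderNatAt f a with hn
  let g1 : ℂ → ℂ := Function.update (fun z => f z / (1 - z/a)^n) a (g0 a * (-a)^n)
  have hz : ∀ z, z ≠ a → 1 - z / a ≠ 0 := by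
    intro z hz h
    apply hz
    field_simp at h
    linear_combination -h
  have hloc : g1 =ᶠ[𝓝 a] fun z => g0 z * (-a)^n := by
    filter_upwards [hfg] with z hz1
    by_cases h : z = a
    · subst h; simp [g1]
    · simp only [g1, Function.update_of_ne h]
      rw [hz1, div_eq_iff (pow_ne_zero _ (hz z h)), smul_eq_mul, mul_assoc, ← mul_pow, mul_comm]
      congr 2
      field_simp; ring
  refine ⟨g1, ?_, by simp [g1, hg0a, ha], ?_⟩
  · intro z
    by_cases h : z = a
    · subst h
      exact ((hg0.differentiableAt).mul_const _).congr_of_eventuallyEq hloc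
    · have : DifferentiableAt ℂ (fun z => f z / (1 - z/a)^n) z :=
        (hf z).div (by fun_prop) (pow_ne_zero _ (hz z h))
      refine this.congr_of_eventuallyEq ?_
      filter_upwards [isOpen_ne.mem_nhds h] with w hw
      simp only [g1, Function.update_of_ne hw]
  · intro z
    by_cases h : z = a
    · subst h
      have hfz : f z = (z - z)^n * g0 z := hfg.self_of_nhds
      rw [hfz, div_self ha, sub_self, sub_self]
      by_cases hn0 : n = 0
      · rw [hn0]; simp [g1, hn0]
      · simp [zero_pow hn0]
    · simp only [g1, Function.update_of_ne h]
      rw [mul_div_cancel₀]; exact pow_ne_zero _ (hz z h)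

lemma factorS {f : ℂ → ℂ} (hf : Differentiable ℂ f) (h0 : f 0 ≠ 0) (S : Finset ℂ) (hS : ∀ a ∈ S, a ≠ 0) :
    ∃ g : ℂ → ℂ, Differentiable ℂ g ∧ (∀ a ∈ S, g a ≠ 0) ∧
      ∀ z, f z = (∏ a ∈ S, (1 - z / a) ^ (analyticOrderNatAt f a)) * g z := by
  induction S using Finset.cons_induction with
  | empty => exact ⟨f, hf, by simp, by simp⟩
  | cons a S ha ih =>
    obtain ⟨g, hg, hgS, hfg⟩ := ih (fun b hb => hS b (Finset.mem_cons_of_mem hb))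
    have ha0 : a ≠ 0 := hS a (Finset.mem_cons_self _ _)
    have hg0 : g 0 ≠ 0 := by
      intro h; apply h0; rw [hfg, h, mul_zero]
    obtain ⟨k, hk, hka, hgk⟩ := factor1 hg hg0 ha0
    have hord : analyticOrderNatAt f a = analyticOrderNatAt g a := by
      let P : ℂ → ℂ := fun z => ∏ a ∈ S, (1 - z / a) ^ (analyticOrderNatAt f a)
      have e : f = P * g := by ext z; exact hfg z
      have hP : AnalyticAt ℂ P a := by
        have : Differentiable ℂ P := by
          intro z
          exact DifferentiableAt.fun_finsetProd (fun i _ => by fun_prop)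
        exact this.analyticAt a
      have hPa : P a ≠ 0 := by
        refine Finset.prod_ne_zero_iff.mpr (fun b hb => pow_ne_zero _ ?_)
        intro h
        have hb0 := hS b (Finset.mem_cons_of_mem hb)
        field_simp at h
        have : a = b := by linear_combination -h
        exact ha (this ▸ hb)
      unfold analyticOrderNatAt
      conv_lhs => rw [e]
      rw [analyticOrderAt_mul hP (hg.analyticAt a), hP.analyticOrderAt_eq_zero.mpr hPa, zero_add]
    refine ⟨k, hk, ?_, ?_⟩
    · intro b hb
      rcases Finset.mem_cons.mp hb with rfl | hb
      · exact hka
      · intro h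
        apply hgS b hb
        rw [hgk, h, mul_zero]
    · intro z
      rw [hfg, hgk, Finset.prod_cons, hord]; ring

lemma logDeriv_nonvanish_bound {g : ℂ → ℂ} (hg : Differentiable ℂ g) (g0 : g 0 = 1) {r B : ℝ} (hr : 0 < r)
    (hB : 0 < B) (hbd : ∀ z, ‖z‖ < r → ‖g z‖ ≤ Real.exp B) (hne : ∀ z, ‖z‖ < r → g z ≠ 0) {v : ℂ}
    (hv : ‖v‖ ≤ r/4) : ‖logDeriv g v‖ ≤ 8 * B / r := by
  have hlog : DifferentiableOn ℂ (logDeriv g) (ball 0 r) := by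
    intro z hz
    have hz' : ‖z‖ < r := by simpa using hz
    have : DifferentiableAt ℂ (logDeriv g) z :=
      (hg.deriv z).div (hg z) (hne z hz')
    exact this.differentiableWithinAt
  obtain ⟨l, hl0, hl⟩ := hlog.isExactOn_ball.with_val_at 0 0
  have hld : DifferentiableOn ℂ l (ball 0 r) := fun z hz => (hl z hz).differentiableAt.differentiableWithinAt
  have hexp : ∀ z ∈ ball (0:ℂ) r, g z = exp (l z) := by
    have hc : ∀ z ∈ ball (0:ℂ) r, HasDerivAt (fun z => g z * exp (- l z)) 0 z := by
      intro z hz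
      have h1 := (hg z).hasDerivAt.mul ((hl z hz).neg.cexp)
      have hgz := hne z (by simpa using hz)
      refine h1.congr_deriv ?_
      rw [logDeriv_apply]
      field_simp; ring
    intro z hz
    have := (convex_ball (0:ℂ) r).is_const_of_fderivWithin_eq_zero (𝕜 := ℂ) (f := fun z => g z * exp (- l z))
      (fun z hz => (hc z hz).differentiableAt.differentiableWithinAt) (fun z hz => by
        rw [fderivWithin_of_isOpen isOpen_ball hz]
        ext; simp [(hc z hz).deriv]) hz (mem_ball_self hr)
    simp only [g0, hl0, neg_zero, exp_zero, one_mul] at this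
    rw [exp_neg] at this
    have h3 := exp_ne_zero (l z)
    field_simp at this
    exact this
  have hre : MapsTo l (ball 0 r) {z | z.re ≤ B} := by
    intro z hz
    have := hbd z (by simpa using hz)
    rw [hexp z hz, norm_exp, Real.exp_le_exp] at this
    exact this
  have hbc : ∀ z, ‖z‖ ≤ r/2 → ‖l z‖ ≤ 2 * B := by
    intro z hz
    have hzb : z ∈ ball (0:ℂ) r := by simp; linarith
    refine (borelCaratheodory_zero hB hld hre hr hzb hl0).trans ?_
    rw [div_le_iff₀ (by linarith)]
    nlinarith
  have hsub : closedBall v (r/4) ⊆ ball 0 r := by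
    intro z hz
    have : ‖z - v‖ ≤ r/4 := by simpa [dist_eq] using hz
    have := norm_le_norm_add_norm_sub' z v
    simp; linarith
  have hder := norm_deriv_le_of_forall_mem_sphere_norm_le (c := v) (R := r/4) (C := 2*B) (f := l) (by linarith)
    ((hld.mono hsub).diffContOnCl_ball subset_rfl) (by
      intro z hz
      apply hbc
      have : ‖z - v‖ = r/4 := by simpa [dist_eq] using hz
      have := norm_le_norm_add_norm_sub' z v
      linarith)
  rw [(hl v (by simp; linarith)).deriv] at hder
  refine hder.trans (le_of_eq ?_)
  field_simp; ring

lemma logDeriv_bound {f : ℂ → ℂ} (hf : Differentiable ℂ f) (f0 : f 0 = 1) {r B : ℝ} (hr : 0 < r)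
    (hB : 0 < B) (hbd : ∀ z, ‖z‖ ≤ 2 * r → ‖f z‖ ≤ Real.exp B) (S : Finset ℂ)
    (hS : ∀ u, u ∈ S ↔ f u = 0 ∧ ‖u‖ ≤ r) {v : ℂ} (hv : ‖v‖ ≤ r/4) (hfv : f v ≠ 0) :
    ‖logDeriv f v - ∑ u ∈ S, (analyticOrderNatAt f u : ℂ) / (v - u)‖ ≤ 8 * B / r := by
  have hS0 : ∀ a ∈ S, a ≠ 0 := by
    rintro a ha rfl
    have := ((hS 0).mp ha).1
    rw [f0] at this; exact one_ne_zero this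
  obtain ⟨g, hg, hgS, hfg⟩ := factorS hf (by rw [f0]; exact one_ne_zero) S hS0
  have g0 : g 0 = 1 := by
    have := hfg 0
    simpa [f0] using this.symm
  have hbg : ∀ z, ‖z‖ ≤ 2 * r → ‖g z‖ ≤ Real.exp B := by
    intro z hz
    refine norm_le_of_forall_mem_frontier_norm_le (U := ball (0:ℂ) (2*r)) isBounded_ball hg.diffContOnCl ?_
      (by rw [closure_ball _ (by positivity)]; simpa using hz)
    intro w hw
    rw [frontier_ball _ (by positivity)] at hw
    have hw' : ‖w‖ = 2 * r := by simpa using hw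
    refine le_trans ?_ (hbd w hw'.le)
    rw [hfg w, norm_mul]
    refine le_mul_of_one_le_left (norm_nonneg _) ?_
    rw [norm_prod]
    refine Finset.prod_induction _ (fun x => 1 ≤ x) (fun a b => one_le_mul_of_one_le_of_one_le) le_rfl (fun a ha => ?_)
    rw [norm_pow]
    refine one_le_pow₀ ?_
    have h1 := ((hS a).mp ha).2
    have h2 : 0 < ‖a‖ := norm_pos_iff.mpr (hS0 a ha)
    have h3 : 2 ≤ ‖w / a‖ := by
      rw [norm_div, hw', le_div_iff₀ h2]; linarith
    have h4 := norm_sub_norm_le (w/a) 1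
    rw [norm_one, norm_sub_rev] at h4
    linarith
  have hgne : ∀ z, ‖z‖ < r → g z ≠ 0 := by
    intro z hz h
    have : z ∈ S := (hS z).mpr ⟨by rw [hfg, h, mul_zero], hz.le⟩
    exact hgS z this h
  have hmain := logDeriv_nonvanish_bound hg g0 hr hB (fun z hz => hbg z (by linarith)) hgne hv
  have hfac : ∀ a ∈ S, 1 - v / a ≠ 0 := by
    intro a ha h
    have ha0 := hS0 a ha
    field_simp at h
    have : a = v := by linear_combination h
    rw [this] at ha
    exact hfv ((hS v).mp ha).1
  have hld : logDeriv f v = ∑ u ∈ S, (analyticOrderNatAt f u : ℂ) / (v - u) + logDeriv g v := by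
    have e : f = fun z => (∏ a ∈ S, (1 - z / a) ^ (analyticOrderNatAt f a)) * g z := funext hfg
    conv_lhs => rw [e]
    rw [logDeriv_mul (f := fun z => ∏ a ∈ S, (1 - z / a) ^ (analyticOrderNatAt f a)) _ (Finset.prod_ne_zero_iff.mpr fun a ha => pow_ne_zero _ (hfac a ha))
      (hgne v (by linarith)) (DifferentiableAt.fun_finsetProd (fun i _ => by fun_prop)) (hg v),
      logDeriv_prod (f := fun a z => (1 - z / a) ^ (analyticOrderNatAt f a)) (fun a ha => pow_ne_zero _ (hfac a ha)) (fun a _ => by fun_prop)]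
    congr 1
    refine Finset.sum_congr rfl (fun a ha => ?_)
    have ha0 := hS0 a ha
    have hd : HasDerivAt (fun z : ℂ => 1 - z / a) (-(1/a)) v := by
      simpa using ((hasDerivAt_id v).div_const a).const_sub 1
    rw [logDeriv_fun_pow hd.differentiableAt, logDeriv_apply, hd.deriv]
    have := hfac a ha
    have h2 : v - a ≠ 0 := by
      intro h; apply this; field_simp; linear_combination -h
    have h3 : a - v ≠ 0 := by
      intro h; apply h2; linear_combination -h
    rw [show 1 - v / a = (a - v)/a by field_simp]
    field_simp
    ring
  rw [hld, add_sub_cancel_left]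
  exact hmain
end MRH
end

section
open Complex Set Filter MeasureTheory Metric
open scoped Real Topology

namespace MRH

/-- index set of zeros of F -/
abbrev Zr : Type := {u : ℂ // F u = 0}
noncomputable def mm (u : Zr) : ℝ := (analyticOrderNatAt F u : ℝ)
noncomputable def qq (u : Zr) : ℝ := - (u : ℂ).re

lemma mm_nonneg (u : Zr) : 0 ≤ mm u := by unfold mm; positivity
lemma qq_ge (hRH : RiemannHypothesis) (u : Zr) : 1/4 ≤ qq u := by
  obtain ⟨q, hq, hu⟩ := F_zeros hRH u.2
  unfold qq; rw [hu]; simpa using hq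
lemma u_eq (hRH : RiemannHypothesis) (u : Zr) : (u:ℂ) = -(qq u : ℂ) := by
  obtain ⟨q, hq, hu⟩ := F_zeros hRH u.2
  unfold qq; rw [hu]; simp

lemma zeros_finite (r : ℝ) : {u : ℂ | F u = 0 ∧ ‖u‖ ≤ r}.Finite := by
  by_cases hr : 0 ≤ r
  · have hA : AnalyticOnNhd ℂ F (closedBall 0 r) := fun z _ => F_diff.analyticAt z
    have h := hA.preimage_zero_mem_codiscreteWithin (x := 0) (by rw [F_zero]; exact one_ne_zero)
      (by simpa using hr) ((convex_closedBall (0:ℂ) r).isConnected ⟨0, by simpa using hr⟩)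
    have h2 := (isCompact_closedBall (0:ℂ) r).finite_sdiff_of_mem_codiscreteWithin h
    refine h2.subset ?_
    rintro u ⟨h1, h3⟩
    refine ⟨by simpa using h3, ?_⟩
    simp [h1]
  · convert Set.finite_empty
    ext u
    simp only [mem_ofPred_eq, mem_empty_iff_false, iff_false, not_and, not_le]
    intro _
    have := norm_nonneg u
    linarith

noncomputable def SS (n : ℕ) : Finset ℂ := (zeros_finite (((n:ℝ)+1)^4/2)).toFinset
lemma mem_SS (n : ℕ) (u : ℂ) : u ∈ SS n ↔ F u = 0 ∧ ‖u‖ ≤ ((n:ℝ)+1)^4/2 := by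
  unfold SS; simp
open Classical in
noncomputable def ZZ (n : ℕ) : Finset Zr := (SS n).subtype (fun u => F u = 0)
lemma mem_ZZ (n : ℕ) (u : Zr) : u ∈ ZZ n ↔ ‖(u:ℂ)‖ ≤ ((n:ℝ)+1)^4/2 := by
  unfold ZZ; rw [Finset.mem_subtype, mem_SS]; simp [u.2]

lemma ZZ_tendsto : Tendsto ZZ atTop atTop := by
  refine tendsto_atTop_finset_of_monotone ?_ ?_
  · intro a b hab u hu
    rw [mem_ZZ] at hu ⊢
    refine hu.trans ?_
    have : (a:ℝ) ≤ b := by exact_mod_cast hab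
    gcongr
  · intro u
    obtain ⟨n, hn⟩ := exists_nat_ge (2 * ‖(u:ℂ)‖)
    refine ⟨n, ?_⟩
    rw [mem_ZZ]
    have : (1:ℝ) ≤ n + 1 := by linarith [(Nat.cast_nonneg n : (0:ℝ) ≤ n)]
    have := le_self_pow₀ this (by norm_num : 4 ≠ 0)
    linarith

lemma partial_tendsto (hRH : RiemannHypothesis) {v : ℂ} (hv : F v ≠ 0) :
    Tendsto (fun n => ∑ u ∈ ZZ n, (mm u : ℂ) / (v + qq u)) atTop (𝓝 (logDeriv F v)) := by
  rw [tendsto_iff_norm_sub_tendsto_zero]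
  have hlim : Tendsto (fun n : ℕ => 480 / ((n:ℝ) + 1)) atTop (𝓝 0) := by
    have := tendsto_one_div_add_atTop_nhds_zero_nat (𝕜 := ℝ)
    have := this.const_mul 480
    simpa [div_eq_mul_inv] using this
  refine squeeze_zero' (Eventually.of_forall fun n => norm_nonneg _) ?_ hlim
  obtain ⟨N, hN⟩ := exists_nat_ge (8 * ‖v‖)
  filter_upwards [eventually_ge_atTop N] with n hn
  have hnN : (N:ℝ) ≤ n := by exact_mod_cast hn
  have hn1 : (1:ℝ) ≤ n + 1 := by linarith [(Nat.cast_nonneg n : (0:ℝ) ≤ n)]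
  have hn4 := le_self_pow₀ hn1 (by norm_num : 4 ≠ 0)
  have hb := logDeriv_bound F_diff F_zero (r := ((n:ℝ)+1)^4/2) (B := 30 * ((n:ℝ)+1)^3) (by positivity) (by positivity)
    (fun z hz => F_growth hn1 (by linarith)) (SS n) (mem_SS n) (v := v) (by linarith) hv
  rw [norm_sub_rev]
  have e : ∑ u ∈ ZZ n, (mm u : ℂ) / (v + qq u) = ∑ u ∈ SS n, (analyticOrderNatAt F u : ℂ) / (v - u) := by
    classical
    rw [← Finset.sum_subtype_of_mem (p := fun u => F u = 0) _ (fun u hu => ((mem_SS n u).mp hu).1)]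
    unfold ZZ
    refine Finset.sum_congr (by congr) (fun u _ => ?_)
    rw [u_eq hRH u, mm, sub_neg_eq_add, ← u_eq hRH u]; simp
  rw [e]
  refine hb.trans (le_of_eq ?_)
  field_simp; ring

lemma summable_mq (hRH : RiemannHypothesis) : Summable (fun u => mm u / qq u) := by
  have hpos : ∀ u, 0 ≤ mm u / qq u := fun u => div_nonneg (mm_nonneg u) (by linarith [qq_ge hRH u])
  have h0 := partial_tendsto hRH (v := 0) (by rw [F_zero]; exact one_ne_zero)
  have h1 : Tendsto (fun n => ∑ u ∈ ZZ n, mm u / qq u) atTop (𝓝 (logDeriv F 0).re) := by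
    have := (continuous_re.tendsto _).comp h0
    refine this.congr (fun n => ?_)
    simp only [Function.comp, re_sum]
    refine Finset.sum_congr rfl (fun u _ => ?_)
    rw [zero_add, ← ofReal_div, ofReal_re]
  obtain ⟨C, hC⟩ := h1.bddAbove_range
  refine summable_of_sum_le hpos (c := C) (fun T => ?_)
  obtain ⟨n, hn⟩ := (ZZ_tendsto.eventually (eventually_ge_atTop T)).exists
  exact (Finset.sum_le_sum_of_subset_of_nonneg hn (fun u _ _ => hpos u)).trans (hC ⟨n, rfl⟩)

theorem hadamard (hRH : RiemannHypothesis) {v : ℂ} (hv : F v ≠ 0) :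
    HasSum (fun u => (mm u : ℂ) / (v + qq u)) (logDeriv F v) := by
  have hs : Summable (fun u => (mm u : ℂ) / (v + qq u)) := by
    refine Summable.of_norm_bounded_eventually ((summable_mq hRH).mul_left 2) ?_
    have hfin : {u : Zr | ‖(u:ℂ)‖ ≤ 2 * ‖v‖}.Finite := by
      have := (zeros_finite (2*‖v‖)).preimage (f := ((↑) : Zr → ℂ)) Subtype.val_injective.injOn
      refine this.subset ?_
      intro u hu
      exact ⟨u.2, hu⟩
    refine hfin.subset ?_
    intro u hu
    by_contra h
    simp only [mem_ofPred_eq, not_le] at h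
    apply hu
    have hq := qq_ge hRH u
    have hun : ‖(u:ℂ)‖ = qq u := by
      rw [u_eq hRH u, norm_neg, norm_real, Real.norm_of_nonneg (by linarith)]
    have h3 : qq u / 2 ≤ ‖v + qq u‖ := by
      have := norm_sub_norm_le (qq u : ℂ) (-v)
      rw [norm_neg, norm_real, Real.norm_of_nonneg (by linarith), sub_neg_eq_add, add_comm (qq u : ℂ)] at this
      rw [hun] at h
      linarith
    show ‖(mm u : ℂ) / (v + qq u)‖ ≤ 2 * (mm u / qq u)
    rw [norm_div, norm_real, Real.norm_of_nonneg (mm_nonneg u)]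
    calc mm u / ‖v + qq u‖ ≤ mm u / (qq u / 2) := div_le_div_of_nonneg_left (mm_nonneg u) (by linarith) h3
      _ = _ := by field_simp
  have := (hs.hasSum.comp ZZ_tendsto)
  have e := tendsto_nhds_unique this (partial_tendsto hRH hv)
  rw [← e]; exact hs.hasSum
end MRH
end

section
open Complex Set Filter MeasureTheory Metric
open scoped Real Topology

namespace MRH

/-- real digamma -/
noncomputable def psi (x : ℝ) : ℝ := deriv (Real.log ∘ Real.Gamma) x

lemma realGamma_diff {x : ℝ} (hx : 0 < x) : DifferentiableAt ℝ Real.Gamma x :=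
  Real.differentiableAt_Gamma (fun m => by have : (0:ℝ) ≤ m := by positivity
                                           linarith)

lemma complexGamma_diff {z : ℂ} (hz : 0 < z.re) : DifferentiableAt ℂ Complex.Gamma z :=
  differentiableAt_Gamma z (fun m h => by
    have := congrArg re h
    simp at this
    have : (0:ℝ) ≤ m := by positivity
    linarith)

lemma psi_eq {x : ℝ} (hx : 0 < x) : psi x = deriv Real.Gamma x / Real.Gamma x := by
  unfold psi
  rw [Function.comp_def, deriv.log (realGamma_diff hx) (Real.Gamma_pos_of_pos hx).ne']

lemma digamma_ofReal {x : ℝ} (hx : 0 < x) : digamma x = (psi x : ℂ) := by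
  have h1 := (complexGamma_diff (z := x) (by simpa using hx)).hasDerivAt.comp_ofReal
  have h2 := (realGamma_diff hx).hasDerivAt.ofReal_comp
  have h3 : (fun y : ℝ => Complex.Gamma y) = fun y : ℝ => ((Real.Gamma y : ℝ):ℂ) := by
    ext y; rw [Gamma_ofReal]
  rw [h3] at h1
  have := h1.unique h2
  rw [digamma_def, logDeriv_apply, this, psi_eq hx, Gamma_ofReal]; push_cast; rfl

lemma logGamma_diff {x : ℝ} (hx : 0 < x) : DifferentiableAt ℝ (Real.log ∘ Real.Gamma) x :=
  (Real.differentiableAt_log (Real.Gamma_pos_of_pos hx).ne').comp x (realGamma_diff hx)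

lemma psi_mono : MonotoneOn psi (Ioi 0) :=
  Real.convexOn_log_Gamma.monotoneOn_deriv (fun _ hx => logGamma_diff hx)

lemma psi_add_one {x : ℝ} (hx : 0 < x) : psi (x + 1) = psi x + 1 / x := by
  have := digamma_apply_add_one x (fun m h => by
    have := congrArg re h
    simp at this
    have : (0:ℝ) ≤ m := by positivity
    linarith)
  rw [digamma_ofReal hx] at this
  have h2 := digamma_ofReal (x := x + 1) (by linarith)
  push_cast at h2
  rw [h2] at this
  have h3 : ((psi (x+1) : ℝ):ℂ) = ((psi x + x⁻¹ : ℝ) : ℂ) := by rw [this]; push_cast; rfl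
  rw [ofReal_injective h3, one_div]

lemma psi_le_log {x : ℝ} (hx : 0 < x) : psi x ≤ Real.log x := by
  have h := Real.convexOn_log_Gamma.deriv_le_slope (x := x) (y := x+1) hx (by simp; linarith) (by linarith)
    (logGamma_diff hx)
  rw [slope_def_field] at h
  simp only [Function.comp, add_sub_cancel_left, div_one] at h
  rw [Real.Gamma_add_one hx.ne', Real.log_mul hx.ne' (Real.Gamma_pos_of_pos hx).ne'] at h
  unfold psi; linarith

lemma psi_add_nat {x : ℝ} (hx : 0 < x) (n : ℕ) : psi (x + n) = psi x + ∑ k ∈ Finset.range n, 1 / (x + k) := by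
  induction n with
  | zero => simp
  | succ n ih =>
    rw [Finset.sum_range_succ, ← add_assoc, ← ih, ← psi_add_one (by positivity)]
    push_cast; ring_nf

lemma psi_diff_hasSum {x y : ℝ} (hy : 0 < y) (hyx : y ≤ x) :
    HasSum (fun n : ℕ => 1 / (y + n) - 1 / (x + n)) (psi x - psi y) := by
  have hx : 0 < x := by linarith
  rw [hasSum_iff_tendsto_nat_of_nonneg]
  · obtain ⟨k, hk⟩ := exists_nat_ge (x - y)
    have e : ∀ n : ℕ, ∑ i ∈ Finset.range n, (1 / (y + i) - 1 / (x + i)) =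
        (psi x - psi y) - (psi (x + n) - psi (y + n)) := by
      intro n
      rw [psi_add_nat hx, psi_add_nat hy, Finset.sum_sub_distrib]; ring
    simp_rw [e]
    have hlim : Tendsto (fun n : ℕ => psi (x + n) - psi (y + n)) atTop (𝓝 0) := by
      have h2 : Tendsto (fun n : ℕ => (k:ℝ) * (1 / (y + n))) atTop (𝓝 0) := by
        have : Tendsto (fun n : ℕ => y + (n:ℝ)) atTop atTop :=
          tendsto_atTop_add_const_left _ _ tendsto_natCast_atTop_atTop
        have := (tendsto_inv_atTop_zero.comp this).const_mul (k:ℝ)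
        simpa using this
      refine squeeze_zero (fun n => ?_) (fun n => ?_) h2
      · have := psi_mono (a := y + n) (b := x + n) (by simp; positivity) (by simp; positivity) (by linarith)
        linarith
      · have h3 := psi_mono (a := x + n) (b := y + n + k) (by simp; positivity) (by simp; positivity) (by linarith)
        rw [psi_add_nat (x := y + n) (by positivity)] at h3
        have h4 : ∑ j ∈ Finset.range k, 1 / (y + n + j) ≤ ∑ j ∈ Finset.range k, 1 / (y + n) := by
          refine Finset.sum_le_sum (fun j _ => ?_)
          refine one_div_le_one_div_of_le (by positivity) ?_
          linarith [(Nat.cast_nonneg j : (0:ℝ) ≤ j)]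
        rw [Finset.sum_const, Finset.card_range, nsmul_eq_mul] at h4
        linarith
    have := hlim.const_sub (psi x - psi y)
    simpa using this
  · intro n
    have := one_div_le_one_div_of_le (a := y + n) (b := x + n) (by positivity) (by linarith)
    linarith

lemma summable_odd : Summable (fun n : ℕ => 1 / (2 * (n:ℝ) + 3)^2) := by
  have h := (summable_nat_add_iff 1).mpr (Real.summable_one_div_nat_pow.mpr one_lt_two)
  refine Summable.of_nonneg_of_le (fun n => by positivity) (fun n => ?_) h
  have : (0:ℝ) ≤ n := by positivity
  push_cast
  refine one_div_le_one_div_of_le (by positivity) ?_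
  gcongr
  · linarith
  · norm_num

lemma digamma_series {s : ℂ} (hs : 0 < s.re) :
    digamma ((3 + s)/2) / 2 - digamma (3/2) / 2 = ∑' n : ℕ, s / ((2 * n + 3) * (2 * n + 3 + s)) := by
  set R := ‖s‖ + 2 with hR
  set U : Set ℂ := {z | 0 < z.re} ∩ ball 0 R with hU
  have hUo : IsOpen U := (isOpen_lt continuous_const continuous_re).inter isOpen_ball
  have hUc : IsPreconnected U := ((convex_halfSpace_re_gt 0).inter (convex_ball 0 R)).isPreconnected
  have hsU : s ∈ U := ⟨hs, by simp [hR]⟩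
  have h1U : (1:ℂ) ∈ U := ⟨by simp, by simp [hR]; linarith [norm_nonneg s]⟩
  have hden : ∀ (n : ℕ) (z : ℂ), 0 < z.re → (2 * (n:ℝ) + 3) ≤ ‖(2 * n + 3 + z : ℂ)‖ := by
    intro n z hz
    have := re_le_norm (2 * n + 3 + z : ℂ)
    simp at this
    linarith
  have hr : DifferentiableOn ℂ (fun s : ℂ => ∑' n : ℕ, s / ((2 * n + 3) * (2 * n + 3 + s))) U := by
    refine differentiableOn_tsum_of_summable_norm (summable_odd.mul_left R) ?_ hUo ?_
    · intro n z hz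
      have h1 := hden n z hz.1
      have h0 : (0:ℝ) ≤ n := by positivity
      have h2 : (2 * n + 3 + z : ℂ) ≠ 0 := norm_pos_iff.mp (by linarith)
      have h3 : (2 * n + 3 : ℂ) ≠ 0 := by exact_mod_cast (by positivity : (2 * (n:ℝ) + 3) ≠ 0)
      have : DifferentiableAt ℂ (fun s : ℂ => s / ((2 * n + 3) * (2 * n + 3 + s))) z := by
        refine DifferentiableAt.div (by fun_prop) (by fun_prop) (mul_ne_zero h3 h2)
      exact this.differentiableWithinAt
    · intro n z hz
      have h1 := hden n z hz.1
      have h0 : (0:ℝ) ≤ n := by positivity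
      have h3 : ‖(2 * n + 3 : ℂ)‖ = 2 * (n:ℝ) + 3 := by
        have : (2 * n + 3 : ℂ) = ((2 * (n:ℝ) + 3 : ℝ):ℂ) := by push_cast; rfl
        rw [this, norm_real, Real.norm_of_nonneg (by positivity)]
      have h4 : ‖z‖ < R := by simpa using hz.2
      rw [norm_div, norm_mul, h3, mul_one_div]
      refine div_le_div₀ (by positivity) h4.le (by positivity) ?_
      rw [sq]; gcongr
  have hl : DifferentiableOn ℂ (fun s : ℂ => digamma ((3 + s)/2) / 2 - digamma (3/2) / 2) U := by
    intro z hz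
    have hz1 : 0 < z.re := hz.1
    have hre : 0 < ((3 + z)/2).re := by simp; linarith
    have : DifferentiableAt ℂ digamma ((3+z)/2) := by
      rw [digamma_def]
      have hO : IsOpen {z : ℂ | 0 < z.re} := isOpen_lt continuous_const continuous_re
      have hd : DifferentiableOn ℂ Complex.Gamma {z : ℂ | 0 < z.re} := fun w hw =>
        (complexGamma_diff hw).differentiableWithinAt
      exact ((hd.deriv hO).differentiableAt (hO.mem_nhds hre)).div (complexGamma_diff hre)
        (Gamma_ne_zero_of_re_pos hre)
    have h2 : DifferentiableAt ℂ (fun s : ℂ => digamma ((3 + s)/2)) z :=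
      DifferentiableAt.comp z (f := fun s : ℂ => (3+s)/2) this (by fun_prop)
    exact ((h2.div_const 2).sub_const _).differentiableWithinAt
  refine (hl.analyticOnNhd hUo).eqOn_of_preconnected_of_frequently_eq (hr.analyticOnNhd hUo) hUc h1U ?_ hsU
  have hT : Tendsto (fun t : ℝ => (t:ℂ)) (𝓝[≠] 1) (𝓝[≠] 1) := by
    refine tendsto_nhdsWithin_iff.mpr ⟨?_, ?_⟩
    · exact (continuous_ofReal.tendsto' 1 1 (by simp)).mono_left nhdsWithin_le_nhds
    · filter_upwards [self_mem_nhdsWithin] with t ht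
      intro h; apply ht; simpa using h
  refine hT.frequently (Eventually.frequently ?_)
  filter_upwards [nhdsWithin_le_nhds (Ioi_mem_nhds (one_pos : (0:ℝ) < 1))] with t ht
  have ht0 : 0 < t := ht
  have h1 := psi_diff_hasSum (y := 3/2) (x := (3+t)/2) (by norm_num) (by linarith)
  have h2 := (hasSum_ofReal.mpr (h1.div_const 2)).tsum_eq
  have e1 : (3 + (t:ℂ))/2 = (((3+t)/2 : ℝ):ℂ) := by push_cast; rfl
  have e2 : (3/2 : ℂ) = ((3/2:ℝ):ℂ) := by push_cast; rfl
  show digamma ((3 + (t:ℂ))/2) / 2 - digamma (3/2) / 2 = ∑' n : ℕ, (t:ℂ) / ((2 * n + 3) * (2 * n + 3 + t))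
  rw [e1, e2, digamma_ofReal (by positivity), digamma_ofReal (by norm_num), ← sub_div, ← ofReal_sub,
    ← ofReal_ofNat, ← ofReal_div, ← h2]
  refine tsum_congr (fun n => ?_)
  have h0 : (0:ℝ) ≤ n := by positivity
  norm_cast
  have h3 : 2 * (n:ℝ) + 3 + t ≠ 0 := by positivity
  have h4 : 2 * (n:ℝ) + 3 ≠ 0 := by positivity
  have h5 : 3/2 + (n:ℝ) = (2*n+3)/2 := by ring
  have h6 : (3+t)/2 + (n:ℝ) = (2*n+3+t)/2 := by ring
  push_cast
  rw [h5, h6]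
  field_simp
  ring
end MRH
end

section
open Complex Set Filter MeasureTheory Metric
open scoped Real Topology

namespace MRH
local notation "γ" => Real.eulerMascheroniConstant

lemma quarter_cpow : (1/4 : ℂ) ^ (1/2 : ℂ) = 1/2 := by
  have h : (1/4 : ℂ) = ((1/4:ℝ):ℂ) := by push_cast; rfl
  have h2 : (1/2 : ℂ) = ((1/2:ℝ):ℂ) := by push_cast; rfl
  rw [h, h2, ← ofReal_cpow (by norm_num), ← Real.sqrt_eq_rpow, Complex.ofReal_inj,
    Real.sqrt_eq_iff_mul_self_eq (by norm_num) (by norm_num)]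
  norm_num

lemma logDeriv_F_zero : logDeriv F 0 = (((γ - Real.log (4*π))/2 + 1 : ℝ):ℂ) := by
  have h := even_sqrt_diff (P := fun z => completedRiemannZeta₀ (1/2 + z))
    (by exact differentiable_completedZeta₀.comp (by fun_prop)) (fun z => by
      rw [← completedRiemannZeta₀_one_sub]; congr 1; ring)
  have h2 : Differentiable ℂ (fun v : ℂ => completedRiemannZeta₀ (1/2 + (v + 1/4) ^ (1/2:ℂ))) :=
    h.comp (f := fun v : ℂ => v + 1/4) (by fun_prop)
  have h3 : HasDerivAt F (completedRiemannZeta₀ 1) 0 := by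
    have := ((hasDerivAt_id (0:ℂ)).mul (h2 0).hasDerivAt).const_add 1
    refine this.congr_deriv ?_
    simp only [id, zero_mul, add_zero, one_mul, zero_add]
    rw [quarter_cpow]; norm_num
  rw [logDeriv_apply, h3.deriv, F_zero, div_one, completedRiemannZeta₀_one]
  push_cast [ofReal_log (by positivity : (0:ℝ) ≤ 4*π)]
  rfl

/-- `Φ(0)` -/
noncomputable def Phi0 : ℝ := (γ - Real.log (4*π))/2 + 1

lemma Phi0_hasSum (hRH : RiemannHypothesis) : HasSum (fun u => mm u / qq u) Phi0 := by
  have := hadamard hRH (v := 0) (by rw [F_zero]; exact one_ne_zero)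
  rw [logDeriv_F_zero] at this
  rw [← hasSum_ofReal]
  simpa [Phi0] using this

lemma F_zeta {s : ℂ} (hs : 0 < s.re) :
    F (s * (s + 1)) = s * (1 + s) * (Gammaℝ (1 + s) * riemannZeta (1 + s)) := by
  have h0 : s ≠ 0 := by rintro rfl; simp at hs
  have h1 : 1 + s ≠ 0 := by
    intro h; have := congrArg re h; simp at this; linarith
  have h2 : 1 + s ≠ 1 := by simpa using h0
  have h := F_eq' h1 h2
  rw [show s * (s+1) = (1+s)*(1+s-1) by ring, h, riemannZeta_def_of_ne_zero h1]
  have : Gammaℝ (1+s) ≠ 0 := Gammaℝ_ne_zero_of_re_pos (by simp; linarith)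
  field_simp; ring

lemma zeta_ne {s : ℂ} (hs : 0 < s.re) : riemannZeta (1 + s) ≠ 0 :=
  riemannZeta_ne_zero_of_one_le_re (by simp; linarith)

lemma F_ne {s : ℂ} (hs : 0 < s.re) : F (s * (s + 1)) ≠ 0 := by
  have h0 : s ≠ 0 := by rintro rfl; simp at hs
  have h1 : 1 + s ≠ 0 := by
    intro h; have := congrArg re h; simp at this; linarith
  rw [F_zeta hs]
  exact mul_ne_zero (mul_ne_zero h0 h1) (mul_ne_zero (Gammaℝ_ne_zero_of_re_pos (by simp; linarith)) (zeta_ne hs))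

lemma logDeriv_Gammaℝ {w : ℂ} (hw : 0 < w.re) :
    logDeriv Gammaℝ w = - Real.log π / 2 + digamma (w/2) / 2 := by
  have e : Gammaℝ = fun w => (π:ℂ) ^ (-w/2) * Complex.Gamma (w/2) := by ext w; rw [Gammaℝ_def]
  have hpi : (π:ℂ) ≠ 0 := by exact_mod_cast Real.pi_ne_zero
  have h1 : HasDerivAt (fun w : ℂ => (π:ℂ) ^ (-w/2)) ((π:ℂ) ^ (-w/2) * log π * (-1/2)) w := by
    have := HasDerivAt.const_cpow (c := (π:ℂ)) (f := fun w : ℂ => -w/2) (f' := -1/2) (x := w)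
      (by simpa using (hasDerivAt_id w).neg.div_const 2) (Or.inl hpi)
    exact this
  have hG := complexGamma_diff (z := w/2) (by simpa using hw)
  have h2 : HasDerivAt (fun w : ℂ => Complex.Gamma (w/2)) (deriv Complex.Gamma (w/2) * (1/2)) w :=
    HasDerivAt.comp w (h₂ := Complex.Gamma) (h := fun w : ℂ => w/2) hG.hasDerivAt ((hasDerivAt_id w).div_const 2)
  have hGne : Complex.Gamma (w/2) ≠ 0 := Gamma_ne_zero_of_re_pos (by simpa using hw)
  have hpp : (π:ℂ) ^ (-w/2) ≠ 0 := by simp [cpow_eq_zero_iff, hpi]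
  rw [e, logDeriv_mul (f := fun w : ℂ => (π:ℂ) ^ (-w/2)) (g := fun w : ℂ => Complex.Gamma (w/2)) w hpp hGne h1.differentiableAt h2.differentiableAt, logDeriv_apply, logDeriv_apply,
    h1.deriv, h2.deriv, digamma_def, logDeriv_apply, ofReal_log Real.pi_pos.le]
  field_simp

lemma zeta_identity0 {s : ℂ} (hs : 0 < s.re) :
    (2 * s + 1) * logDeriv F (s * (s+1)) =
      1 / s + (- Real.log π / 2 + digamma ((3 + s)/2)/2) + logDeriv riemannZeta (1 + s) := by
  have h0 : s ≠ 0 := by rintro rfl; simp at hs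
  have h1 : 1 + s ≠ 0 := by
    intro h; have := congrArg re h; simp at this; linarith
  have hre : 0 < (1+s).re := by simp; linarith
  have hA : HasDerivAt (fun s : ℂ => s * (s+1)) (2*s+1) s := by
    have := (hasDerivAt_id s).mul ((hasDerivAt_id s).add_const 1)
    refine this.congr_deriv ?_
    simp; ring
  have hB : HasDerivAt (fun s : ℂ => 1 + s) 1 s := (hasDerivAt_id s).const_add 1
  have hl : logDeriv (fun s => F (s * (s+1))) s = (2 * s + 1) * logDeriv F (s * (s+1)) := by
    have := logDeriv_comp (f := F) (g := fun s : ℂ => s * (s+1)) (x := s) (F_diff _) hA.differentiableAt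
    rw [hA.deriv] at this
    rw [mul_comm, ← this]; rfl
  rw [← hl]
  have hev : (fun s => F (s * (s+1))) =ᶠ[𝓝 s] fun s => s * (1 + s) * (Gammaℝ (1 + s) * riemannZeta (1 + s)) := by
    filter_upwards [(isOpen_lt continuous_const continuous_re).mem_nhds hs] with z hz
    exact F_zeta hz
  have hGd : DifferentiableAt ℂ Gammaℝ (1+s) := by
    have e : Gammaℝ = fun w => (π:ℂ) ^ (-w/2) * Complex.Gamma (w/2) := by ext w; rw [Gammaℝ_def]
    rw [e]
    have hpi : (π:ℂ) ≠ 0 := by exact_mod_cast Real.pi_ne_zero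
    refine DifferentiableAt.mul ?_ ?_
    · exact DifferentiableAt.const_cpow (by fun_prop) (Or.inl hpi)
    · exact DifferentiableAt.comp _ (g := Complex.Gamma) (f := fun w : ℂ => w/2)
        (complexGamma_diff (by simpa using hre)) (by fun_prop)
  have hZd : DifferentiableAt ℂ riemannZeta (1+s) := differentiableAt_riemannZeta (by simpa using h0)
  have hGd' : DifferentiableAt ℂ (fun s => Gammaℝ (1+s)) s := DifferentiableAt.comp s (g := Gammaℝ) hGd hB.differentiableAt
  have hZd' : DifferentiableAt ℂ (fun s => riemannZeta (1+s)) s :=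
    DifferentiableAt.comp s (g := riemannZeta) hZd hB.differentiableAt
  have lG : logDeriv (fun s => Gammaℝ (1+s)) s = logDeriv Gammaℝ (1+s) := by
    have := logDeriv_comp (f := Gammaℝ) (g := fun s : ℂ => 1 + s) (x := s) hGd hB.differentiableAt
    rw [hB.deriv, mul_one] at this; exact this
  have lZ : logDeriv (fun s => riemannZeta (1+s)) s = logDeriv riemannZeta (1+s) := by
    have := logDeriv_comp (f := riemannZeta) (g := fun s : ℂ => 1 + s) (x := s) hZd hB.differentiableAt
    rw [hB.deriv, mul_one] at this; exact this
  have hGne : Gammaℝ (1+s) ≠ 0 := Gammaℝ_ne_zero_of_re_pos hre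
  have e1 : logDeriv (fun s => F (s * (s+1))) s =
      logDeriv (fun s => s * (1 + s) * (Gammaℝ (1 + s) * riemannZeta (1 + s))) s := by
    rw [logDeriv_apply, logDeriv_apply, hev.deriv_eq, F_zeta hs]
  rw [e1, logDeriv_mul (f := fun s : ℂ => s * (1+s)) (g := fun s => Gammaℝ (1 + s) * riemannZeta (1 + s)) s
      (mul_ne_zero h0 h1) (mul_ne_zero hGne (zeta_ne hs)) (by fun_prop) (hGd'.mul hZd'),
    logDeriv_mul (f := fun s : ℂ => s) (g := fun s => 1 + s) s h0 h1 (by fun_prop) (by fun_prop),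
    logDeriv_mul (f := fun s => Gammaℝ (1 + s)) (g := fun s => riemannZeta (1 + s)) s hGne (zeta_ne hs) hGd' hZd',
    lG, lZ, logDeriv_Gammaℝ hre, logDeriv_apply, logDeriv_apply, hB.deriv]
  have hfe := digamma_apply_add_one ((1+s)/2) (fun m h => by
    have := congrArg re h
    simp at this
    have : (0:ℝ) ≤ m := by positivity
    linarith)
  rw [show (1+s)/2 + 1 = (3+s)/2 by ring] at hfe
  rw [hfe]
  simp only [deriv_id'']
  field_simp
  ring

lemma digamma_three_half : - Real.log π / 2 + digamma (3/2)/2 = ((1 - (γ + Real.log (4*π))/2 : ℝ):ℂ) := by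
  have hfe := digamma_apply_add_one (1/2) (fun m h => by
    have := congrArg re h
    simp at this
    have : (0:ℝ) ≤ m := by positivity
    linarith)
  rw [show (1/2:ℂ) + 1 = 3/2 by norm_num, digamma_one_half] at hfe
  have h4 : Real.log (4 * π) = 2 * Real.log 2 + Real.log π := by
    rw [Real.log_mul (by norm_num) Real.pi_ne_zero, show (4:ℝ) = 2^2 by norm_num, Real.log_pow]; push_cast; ring
  rw [hfe, h4]
  have : log (2:ℂ) = (Real.log 2 : ℂ) := by rw [ofReal_log (by norm_num)]; push_cast; rfl
  rw [this]
  push_cast; norm_num; ring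

lemma zeta_identity (hRH : RiemannHypothesis) {s : ℂ} (hs : 0 < s.re) :
    HasSum (fun u => (mm u : ℂ) * ((2 * s + 1) / (s * (s+1) + qq u) - 1 / qq u))
      (1 / s - γ + ∑' n : ℕ, s / ((2 * n + 3) * (2 * n + 3 + s)) + logDeriv riemannZeta (1 + s)) := by
  have h1 := (hadamard hRH (F_ne hs)).mul_left (2 * s + 1)
  rw [zeta_identity0 hs] at h1
  have h2 := hasSum_ofReal.mpr (Phi0_hasSum hRH)
  have h3 := h1.sub h2
  have e : 1 / s + (-↑(Real.log π) / 2 + digamma ((3 + s) / 2) / 2) + logDeriv riemannZeta (1 + s) - (Phi0:ℂ) =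
    1 / s - γ + ∑' n : ℕ, s / ((2 * n + 3) * (2 * n + 3 + s)) + logDeriv riemannZeta (1 + s) := by
    rw [← digamma_series hs]
    have h5 : digamma (3/2)/2 = ((1 - (γ + Real.log (4*π))/2 : ℝ):ℂ) + Real.log π / 2 := by
      rw [← digamma_three_half]; ring
    rw [h5, Phi0]; push_cast; ring
  rw [e] at h3
  refine h3.congr_fun ?_
  intro u
  push_cast
  ring
end MRH
end

section
open Complex Set Filter MeasureTheory Metric
open scoped Real Topology FourierTransform

namespace MRH

structure Lap (g : ℝ → ℂ) (L : ℂ → ℂ) : Prop where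
  cont : ContinuousOn g (Ici 0)
  bdd : ∃ C : ℝ, ∀ u : ℝ, 0 ≤ u → ‖g u‖ ≤ C * Real.exp (u/2)
  int : ∀ s : ℂ, s.re = 1 → ∫ u in Ioi (0:ℝ), Complex.exp (-s * u) * g u = L s

lemma lap_integrable {g : ℝ → ℂ} (hc : ContinuousOn g (Ici 0)) {C : ℝ}
    (hb : ∀ u : ℝ, 0 ≤ u → ‖g u‖ ≤ C * Real.exp (u/2)) {s : ℂ} (hs : s.re = 1) :
    IntegrableOn (fun u : ℝ => Complex.exp (-s * u) * g u) (Ioi 0) := by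
  have h1 : IntegrableOn (fun u : ℝ => C * Real.exp (-(1/2) * u)) (Ioi 0) :=
    (integrableOn_exp_mul_Ioi (by norm_num) 0).const_mul C
  refine Integrable.mono' h1 ?_ ?_
  · refine ContinuousOn.aestronglyMeasurable ?_ measurableSet_Ioi
    exact (by fun_prop : Continuous (fun u : ℝ => Complex.exp (-s * u))).continuousOn.mul
      (hc.mono Ioi_subset_Ici_self)
  · refine (ae_restrict_mem measurableSet_Ioi).mono fun u hu => ?_
    have hu' : (0:ℝ) < u := hu
    rw [norm_mul, Complex.norm_exp]
    have : (-s * (u:ℂ)).re = -u := by simp [hs]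
    rw [this]
    calc Real.exp (-u) * ‖g u‖ ≤ Real.exp (-u) * (C * Real.exp (u/2)) := by
          gcongr; exact hb u hu'.le
      _ = C * Real.exp (-(1/2) * u) := by
          rw [mul_left_comm, ← Real.exp_add]; ring_nf

lemma Lap.integrable {g : ℝ → ℂ} {L : ℂ → ℂ} (h : Lap g L) {s : ℂ} (hs : s.re = 1) :
    IntegrableOn (fun u : ℝ => Complex.exp (-s * u) * g u) (Ioi 0) := by
  obtain ⟨C, hC⟩ := h.bdd
  exact lap_integrable h.cont hC hs

lemma Lap.add {f g : ℝ → ℂ} {L M : ℂ → ℂ} (hf : Lap f L) (hg : Lap g M) :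
    Lap (fun u => f u + g u) (fun s => L s + M s) where
  cont := hf.cont.add hg.cont
  bdd := by
    obtain ⟨C, hC⟩ := hf.bdd
    obtain ⟨D, hD⟩ := hg.bdd
    exact ⟨C + D, fun u hu => (norm_add_le _ _).trans (by rw [add_mul]; exact add_le_add (hC u hu) (hD u hu))⟩
  int := fun s hs => by
    simp only [mul_add]
    rw [integral_add (hf.integrable hs) (hg.integrable hs), hf.int s hs, hg.int s hs]

lemma Lap.const_mul {f : ℝ → ℂ} {L : ℂ → ℂ} (c : ℂ) (hf : Lap f L) :
    Lap (fun u => c * f u) (fun s => c * L s) where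
  cont := continuousOn_const.mul hf.cont
  bdd := by
    obtain ⟨C, hC⟩ := hf.bdd
    refine ⟨‖c‖ * C, fun u hu => ?_⟩
    rw [norm_mul, mul_assoc]; gcongr; exact hC u hu
  int := fun s hs => by
    simp only [mul_left_comm _ c]
    rw [integral_const_mul, hf.int s hs]

lemma Lap.sub {f g : ℝ → ℂ} {L M : ℂ → ℂ} (hf : Lap f L) (hg : Lap g M) :
    Lap (fun u => f u - g u) (fun s => L s - M s) := by
  have := hf.add (hg.const_mul (-1))
  simpa [sub_eq_add_neg] using this

lemma Lap.congr {f : ℝ → ℂ} {L M : ℂ → ℂ} (hf : Lap f L) (h : ∀ s : ℂ, s.re = 1 → L s = M s) :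
    Lap f M := ⟨hf.cont, hf.bdd, fun s hs => (hf.int s hs).trans (h s hs)⟩

lemma Lap.tsum {ι : Type*} [Countable ι] {f : ι → ℝ → ℂ} {L : ι → ℂ → ℂ} {c : ι → ℝ}
    (hf : ∀ i, Lap (f i) (L i)) (hc : Summable c)
    (hb : ∀ i, ∀ u : ℝ, 0 ≤ u → ‖f i u‖ ≤ c i * Real.exp (u/2)) :
    Lap (fun u => ∑' i, f i u) (fun s => ∑' i, L i s) where
  cont := by
    have h1 : ContinuousOn (fun u : ℝ => ∑' i, (Real.exp (-(u/2)) : ℂ) * f i u) (Ici 0) := by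
      refine continuousOn_tsum (u := c) (fun i => ?_) hc ?_
      · exact (by fun_prop : Continuous (fun u : ℝ => (Real.exp (-(u/2)) : ℂ))).continuousOn.mul (hf i).cont
      · intro i u hu
        rw [norm_mul, Complex.norm_real, Real.norm_eq_abs, abs_of_pos (Real.exp_pos _)]
        calc _ ≤ Real.exp (-(u/2)) * (c i * Real.exp (u/2)) := by gcongr; exact hb i u hu
          _ = c i := by rw [mul_left_comm, ← Real.exp_add]; simp
    have h2 := (by fun_prop : Continuous (fun u : ℝ => (Real.exp (u/2) : ℂ))).continuousOn.mul h1
    refine h2.congr fun u hu => ?_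
    simp only [tsum_mul_left, Pi.mul_apply]
    rw [← mul_assoc, ← ofReal_mul, ← Real.exp_add]; simp
  bdd := by
    refine ⟨∑' i, c i, fun u hu => ?_⟩
    rw [← tsum_mul_right]
    exact tsum_of_norm_bounded (hc.mul_right _).hasSum fun i => hb i u hu
  int := fun s hs => by
    have hint : ∀ i, IntegrableOn (fun u : ℝ => Complex.exp (-s * u) * f i u) (Ioi 0) :=
      fun i => (hf i).integrable hs
    have h := hasSum_integral_of_summable_integral_norm (μ := volume.restrict (Ioi (0:ℝ)))
      (F := fun i (u:ℝ) => Complex.exp (-s * u) * f i u) hint ?_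
    · have h2 := h.tsum_eq
      simp only [tsum_mul_left] at h2
      rw [← h2]
      exact tsum_congr fun i => (hf i).int s hs
    · have hI : IntegrableOn (fun u : ℝ => Real.exp (-(1/2) * u)) (Ioi 0) :=
        integrableOn_exp_mul_Ioi (by norm_num) 0
      refine Summable.of_nonneg_of_le (fun i => integral_nonneg fun u => norm_nonneg _) (fun i => ?_)
        (hc.mul_right (∫ u in Ioi (0:ℝ), Real.exp (-(1/2) * u)))
      rw [← integral_const_mul]
      refine setIntegral_mono_on (hint i).norm (hI.const_mul _) measurableSet_Ioi fun u hu => ?_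
      have hu' : (0:ℝ) < u := hu
      rw [norm_mul, Complex.norm_exp]
      have : (-s * (u:ℂ)).re = -u := by simp [hs]
      rw [this]
      calc Real.exp (-u) * ‖f i u‖ ≤ Real.exp (-u) * (c i * Real.exp (u/2)) := by
            gcongr; exact hb i u hu'.le
        _ = c i * Real.exp (-(1/2) * u) := by
            rw [mul_left_comm, ← Real.exp_add]; ring_nf

lemma Lap.unique {g : ℝ → ℂ} (h : Lap g (fun _ => 0)) (h0 : g 0 = 0) {u : ℝ} (hu : 0 ≤ u) :
    g u = 0 := by
  let f : ℝ → ℂ := fun v => Complex.exp (-1 * (max v 0 : ℝ)) * g (max v 0)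
  have hfc : Continuous f := by
    refine Continuous.mul (by fun_prop) ?_
    exact h.cont.comp_continuous (by fun_prop) (fun v => mem_Ici.mpr (le_max_right v 0))
  have hneg : ∀ v, v ≤ 0 → f v = 0 := fun v hv => by simp [f, max_eq_right hv, h0]
  have hpos : ∀ v, 0 < v → f v = Complex.exp (-1 * v) * g v := fun v hv => by
    simp [f, max_eq_left hv.le]
  have hsupp : Function.support f ⊆ Ioi 0 := fun v hv => by
    by_contra hh; exact hv (hneg v (not_lt.mp hh))
  have hint : Integrable f := by
    rw [← integrableOn_iff_integrable_of_support_subset hsupp]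
    refine (h.integrable (s := 1) (by simp)).congr_fun (fun v hv => (hpos v hv).symm) measurableSet_Ioi
  have hF : 𝓕 f = 0 := by
    ext w
    rw [Real.fourier_real_eq_integral_exp_smul]
    have hs2 : Function.support (fun v : ℝ => Complex.exp (↑(-2 * π * v * w) * I) • f v) ⊆ Ioi 0 :=
      fun v hv => hsupp (fun hh => hv (by simp [hh]))
    rw [← setIntegral_eq_integral_of_forall_compl_eq_zero (s := Ioi 0)
      (fun v hv => by_contra fun hh => hv (hs2 hh))]
    rw [Pi.zero_apply, ← h.int (1 + 2 * π * w * I) (by simp)]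
    refine setIntegral_congr_fun measurableSet_Ioi fun v hv => ?_
    simp only [hpos v hv, smul_eq_mul]
    rw [← mul_assoc, ← Complex.exp_add]
    congr 2; push_cast; ring
  have h3 := hfc.fourierInv_fourier_eq hint (by rw [hF]; exact integrable_zero _ _ _)
  have h4 : f = 0 := by
    rw [← h3, hF]; ext v; simp [Real.fourierInv_eq]
  have h5 := congrFun h4 u
  simp only [f, max_eq_left hu, Pi.zero_apply, mul_eq_zero, Complex.exp_ne_zero, false_or] at h5
  exact h5
end MRH
end

section
open Complex Set Filter MeasureTheory Metric
open scoped Real Topology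

namespace MRH

lemma le_exp_half (t : ℝ) : t ≤ Real.exp (t/2) := by
  have h1 := Real.add_one_le_exp (t/4)
  have h2 : Real.exp (t/2) = Real.exp (t/4) ^ 2 := by
    rw [← Real.exp_nat_mul]; congr 1; push_cast; ring
  rcases le_or_gt 0 t with ht | ht
  · rw [h2]; nlinarith [sq_nonneg (t/4 - 1)]
  · linarith [Real.exp_pos (t/2)]

lemma Lap_exp {a : ℂ} (ha : a.re ≤ 0) : Lap (fun u => Complex.exp (a * u)) (fun s => 1/(s - a)) where
  cont := (by fun_prop : Continuous _).continuousOn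
  bdd := ⟨1, fun u hu => by
    rw [Complex.norm_exp, one_mul, Real.exp_le_exp]
    simp; nlinarith⟩
  int := fun s hs => by
    have h : (a - s).re < 0 := by simp [hs]; linarith
    have := integral_exp_mul_complex_Ioi h 0
    simp only [← Complex.exp_add, ← add_mul]
    rw [show -s + a = a - s by ring, this]
    have h1 : a - s ≠ 0 := fun h' => by rw [h'] at h; simp at h
    have h2 : s - a ≠ 0 := fun h' => h1 (by linear_combination -h')
    simp
    rw [neg_div, ← one_div, ← div_neg]; congr 1; ring

lemma Lap_one : Lap (fun _ => 1) (fun s => 1/s) := by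
  have := Lap_exp (a := 0) (by simp)
  simpa using this

lemma tendsto_pow_cexp {s : ℂ} (hs : s.re = 1) (n : ℕ) :
    Tendsto (fun u : ℝ => (u:ℂ)^n * Complex.exp (-s * u)) atTop (𝓝 0) := by
  rw [tendsto_zero_iff_norm_tendsto_zero]
  refine (Real.tendsto_pow_mul_exp_neg_atTop_nhds_zero n).congr' ?_
  filter_upwards [eventually_ge_atTop 0] with u hu
  rw [norm_mul, Complex.norm_exp, norm_pow, Complex.norm_real, Real.norm_of_nonneg hu]
  simp [hs]

lemma max_bound {l u : ℝ} : max (u - l) 0 ≤ Real.exp (-l/2) * Real.exp (u/2) := by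
  rw [← Real.exp_add, show -l/2 + u/2 = (u-l)/2 by ring]
  exact max_le (le_exp_half _) (Real.exp_pos _).le

lemma Lap_ramp {l : ℝ} (hl : 0 ≤ l) :
    Lap (fun u => ((max (u - l) 0 : ℝ):ℂ)) (fun s => Complex.exp (-s * l)/s^2) := by
  have hc : ContinuousOn (fun u:ℝ => ((max (u - l) 0 : ℝ):ℂ)) (Ici 0) :=
    (by fun_prop : Continuous _).continuousOn
  have hb : ∀ u : ℝ, 0 ≤ u → ‖((max (u - l) 0 : ℝ):ℂ)‖ ≤ Real.exp (-l/2) * Real.exp (u/2) := by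
    intro u hu
    rw [Complex.norm_real, Real.norm_of_nonneg (le_max_right _ _)]
    exact max_bound
  refine ⟨hc, ⟨_, hb⟩, fun s hs => ?_⟩
  have hs0 : s ≠ 0 := fun h => by rw [h] at hs; simp at hs
  have hI := lap_integrable hc hb hs
  have hu : Ioi (0:ℝ) = Ioc 0 l ∪ Ioi l := (Ioc_union_Ioi_eq_Ioi hl).symm
  rw [hu, setIntegral_union (Set.Ioc_disjoint_Ioi le_rfl) measurableSet_Ioi
    (hI.mono_set Ioc_subset_Ioi_self) (hI.mono_set (Ioi_subset_Ioi hl))]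
  rw [setIntegral_congr_fun (g := fun _ => 0) measurableSet_Ioc (fun u hu => by
    simp [max_eq_right (sub_nonpos.mpr hu.2)])]
  rw [integral_zero, zero_add]
  have hE : EqOn (fun u:ℝ => Complex.exp (-s * u) * ((max (u - l) 0 : ℝ):ℂ))
      (fun u => Complex.exp (-s * u) * ((u:ℂ) - l)) (Ioi l) := fun u hu => by
    simp only
    rw [max_eq_left (sub_nonneg.mpr (le_of_lt hu))]; push_cast; rfl
  rw [setIntegral_congr_fun measurableSet_Ioi hE]
  have hI2 := (hI.mono_set (Ioi_subset_Ioi hl)).congr_fun hE measurableSet_Ioi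
  have hd : ∀ u ∈ Ici l, HasDerivAt (fun u : ℝ => -(((u:ℂ) - l)/s + 1/s^2) * Complex.exp (-s * u))
      (Complex.exp (-s * u) * ((u:ℂ) - l)) u := by
    intro u _
    have h1 : HasDerivAt (fun u : ℝ => (u:ℂ)) 1 u := by simpa using (hasDerivAt_id u).ofReal_comp
    have h2 := ((((h1.sub_const (l:ℂ)).div_const s).add_const (1/s^2)).neg).mul ((h1.const_mul (-s)).cexp)
    refine h2.congr_deriv ?_
    simp; field_simp; ring
  have ht : Tendsto (fun u : ℝ => -(((u:ℂ) - l)/s + 1/s^2) * Complex.exp (-s * u)) atTop (𝓝 0) := by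
    have h0 := tendsto_pow_cexp hs 0
    have h1 := tendsto_pow_cexp hs 1
    have := (h1.const_mul (-1/s)).add (h0.const_mul (l/s - 1/s^2))
    simp only [mul_zero, add_zero] at this
    refine this.congr fun u => ?_
    ring
  rw [integral_Ioi_of_hasDerivAt_of_tendsto' hd hI2 ht]
  simp; ring

lemma Lap_id : Lap (fun u => (u:ℂ)) (fun s => 1/s^2) := by
  have h := Lap_ramp le_rfl
  refine ⟨(by fun_prop : Continuous _).continuousOn, ?_, fun s hs => ?_⟩
  · obtain ⟨C, hC⟩ := h.bdd
    refine ⟨C, fun u hu => ?_⟩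
    have := hC u hu
    simpa [max_eq_left hu] using this
  · have := h.int s hs
    simp at this ⊢
    rw [← this]
    refine setIntegral_congr_fun measurableSet_Ioi fun u hu => ?_
    simp [max_eq_left (le_of_lt (mem_Ioi.mp hu))]

lemma Lap_sq : Lap (fun u => (u:ℂ)^2/2) (fun s => 1/s^3) := by
  have hc : ContinuousOn (fun u:ℝ => (u:ℂ)^2/2) (Ici 0) :=
    (by fun_prop : Continuous _).continuousOn
  have hb : ∀ u : ℝ, 0 ≤ u → ‖(u:ℂ)^2/2‖ ≤ 4 * Real.exp (u/2) := by
    intro u hu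
    have := Real.quadratic_le_exp_of_nonneg (x := u/2) (by positivity)
    have h2 : ‖(u:ℂ)^2/2‖ = u^2/2 := by
      rw [norm_div, norm_pow, Complex.norm_real, Real.norm_of_nonneg hu]; norm_num
    rw [h2]; nlinarith
  refine ⟨hc, ⟨_, hb⟩, fun s hs => ?_⟩
  have hs0 : s ≠ 0 := fun h => by rw [h] at hs; simp at hs
  have hI := lap_integrable hc hb hs
  have hd : ∀ u ∈ Ici (0:ℝ), HasDerivAt (fun u : ℝ => -((u:ℂ)^2/2/s + u/s^2 + 1/s^3) * Complex.exp (-s * u))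
      (Complex.exp (-s * u) * ((u:ℂ)^2/2)) u := by
    intro u _
    have h1 : HasDerivAt (fun u : ℝ => (u:ℂ)) 1 u := by simpa using (hasDerivAt_id u).ofReal_comp
    have h2 := (((((h1.pow 2).div_const 2).div_const s).add (h1.div_const (s^2))).add_const (1/s^3)).neg.mul ((h1.const_mul (-s)).cexp)
    refine h2.congr_deriv ?_
    simp; field_simp; ring
  have ht : Tendsto (fun u : ℝ => -((u:ℂ)^2/2/s + u/s^2 + 1/s^3) * Complex.exp (-s * u)) atTop (𝓝 0) := by
    have h0 := tendsto_pow_cexp hs 0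
    have h1 := tendsto_pow_cexp hs 1
    have h2 := tendsto_pow_cexp hs 2
    have := ((h2.const_mul (-1/2/s)).add (h1.const_mul (-1/s^2))).add (h0.const_mul (- 1/s^3))
    simp only [mul_zero, add_zero] at this
    refine this.congr fun u => ?_
    ring
  rw [integral_Ioi_of_hasDerivAt_of_tendsto' hd hI ht]
  simp

end MRH
end

section
open Complex Set Filter MeasureTheory Metric
open scoped Real Topology ArithmeticFunction.vonMangoldt

namespace MRH

noncomputable def rho (q : ℝ) : ℂ := -1/2 + I * (√(q - 1/4) : ℝ)
noncomputable def rho' (q : ℝ) : ℂ := -1/2 - I * (√(q - 1/4) : ℝ)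
lemma rho_re (q : ℝ) : (rho q).re = -1/2 := by simp [rho]
lemma rho'_re (q : ℝ) : (rho' q).re = -1/2 := by simp [rho']
lemma rho_ne (q : ℝ) : rho q ≠ 0 := fun h => by have := rho_re q; rw [h] at this; norm_num at this
lemma rho'_ne (q : ℝ) : rho' q ≠ 0 := fun h => by have := rho'_re q; rw [h] at this; norm_num at this
lemma rho_add (q : ℝ) : rho q + rho' q = -1 := by unfold rho rho'; ring
lemma rho_mul {q : ℝ} (hq : 1/4 ≤ q) : rho q * rho' q = q := by
  have h : ((√(q - 1/4) : ℝ):ℂ)^2 = q - 1/4 := by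
    rw [← ofReal_pow, Real.sq_sqrt (by linarith)]; push_cast; rfl
  unfold rho rho'
  linear_combination h - (√(q - 1/4) : ℝ)^2 * I_sq
lemma rho_normSq {q : ℝ} (hq : 1/4 ≤ q) : ‖rho q‖^2 = q := by
  rw [← Complex.normSq_eq_norm_sq]
  simp [rho, Complex.normSq_apply]
  rw [Real.mul_self_sqrt (by linarith)]; ring
lemma rho'_normSq {q : ℝ} (hq : 1/4 ≤ q) : ‖rho' q‖^2 = q := by
  rw [← Complex.normSq_eq_norm_sq]
  simp [rho', Complex.normSq_apply]
  rw [Real.mul_self_sqrt (by linarith)]; ring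

noncomputable def ker (r : ℂ) (u : ℝ) : ℂ := (Complex.exp (r * u) - 1) / r^2

lemma Lap_ker {r : ℂ} (h0 : r ≠ 0) (hr : r.re ≤ 0) :
    Lap (ker r) (fun s => (1/(s - r) + 1/r)/s^2) := by
  have h := ((Lap_exp hr).sub Lap_one).const_mul (1/r^2)
  have h2 : (fun u : ℝ => 1/r^2 * (Complex.exp (r*u) - 1)) = ker r := by
    ext u; simp only [ker]; ring
  rw [h2] at h
  refine h.congr fun s hs => ?_
  have hs0 : s ≠ 0 := fun h => by rw [h] at hs; simp at hs
  have hs1 : s - r ≠ 0 := fun h => by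
    have := congrArg Complex.re h; simp [hs] at this; linarith
  field_simp; ring

lemma ker_bound {r : ℂ} (hr : r.re ≤ 0) {u : ℝ} (hu : 0 ≤ u) : ‖ker r u‖ ≤ 2/‖r‖^2 := by
  unfold ker
  rw [norm_div, norm_pow]
  gcongr
  have h1 : ‖Complex.exp (r*u)‖ ≤ 1 := by
    rw [Complex.norm_exp]; apply Real.exp_le_one_iff.mpr; simp; nlinarith
  calc _ ≤ ‖Complex.exp (r*u)‖ + ‖(1:ℂ)‖ := norm_sub_le _ _
    _ ≤ 2 := by rw [norm_one]; linarith

noncomputable def kap (q u : ℝ) : ℂ := ker (rho q) u + ker (rho' q) u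

lemma Lap_kap {q : ℝ} (hq : 1/4 ≤ q) :
    Lap (kap q) (fun s => ((2*s+1)/(s*(s+1)+q) - 1/q)/s^2) := by
  have h := (Lap_ker (rho_ne q) (by rw [rho_re]; norm_num)).add
    (Lap_ker (rho'_ne q) (by rw [rho'_re]; norm_num))
  refine Lap.congr h fun s hs => ?_
  have hs0 : s ≠ 0 := fun h => by rw [h] at hs; simp at hs
  have hs1 : s - rho q ≠ 0 := fun h => by
    have := congrArg Complex.re h; simp [hs, rho_re] at this; linarith
  have hs2 : s - rho' q ≠ 0 := fun h => by
    have := congrArg Complex.re h; simp [hs, rho'_re] at this; linarith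
  have hm := rho_mul hq
  have ha := rho_add q
  have e1 : (s - rho q) * (s - rho' q) = s*(s+1)+q := by linear_combination hm - s * ha
  rw [← e1, ← hm, ← add_div]
  have e2 : (2*s+1) = (s - rho q) + (s - rho' q) := by linear_combination ha
  rw [e2]
  congr 1
  have h1 := rho_ne q
  have h2 := rho'_ne q
  have e3 : (1:ℂ)/(rho q * rho' q) = -(1/rho q + 1/rho' q) := by
    field_simp; linear_combination ha
  rw [e3]
  field_simp
  ring

lemma kap_bound {q : ℝ} (hq : 1/4 ≤ q) {u : ℝ} (hu : 0 ≤ u) : ‖kap q u‖ ≤ 4/q := by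
  have h1 := ker_bound (r := rho q) (by rw [rho_re]; norm_num) hu
  have h2 := ker_bound (r := rho' q) (by rw [rho'_re]; norm_num) hu
  rw [rho_normSq hq] at h1
  rw [rho'_normSq hq] at h2
  calc _ ≤ _ := norm_add_le _ _
    _ ≤ 2/q + 2/q := add_le_add h1 h2
    _ = 4/q := by ring

instance : Countable Zr := by
  have h : (univ : Set Zr) = ⋃ n, (ZZ n : Set Zr) := by
    symm; rw [eq_univ_iff_forall]; intro u
    have := (ZZ_tendsto.eventually_ge_atTop {u}).exists
    obtain ⟨n, hn⟩ := this
    exact mem_iUnion.mpr ⟨n, Finset.mem_coe.mpr (hn (Finset.mem_singleton_self u))⟩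
  rw [← countable_univ_iff, h]
  exact countable_iUnion fun n => (ZZ n).finite_toSet.countable

lemma one_le_exp_half {u : ℝ} (hu : 0 ≤ u) : 1 ≤ Real.exp (u/2) := Real.one_le_exp (by positivity)

lemma Lap_zeros (hRH : RiemannHypothesis) :
    Lap (fun u => ∑' z : Zr, (mm z : ℂ) * kap (qq z) u)
      (fun s => (1/s - Real.eulerMascheroniConstant + ∑' n:ℕ, s/((2*n+3)*(2*n+3+s)) + logDeriv riemannZeta (1+s))/s^2) := by
  have h := Lap.tsum (c := fun z => 4 * (mm z / qq z))
    (fun z : Zr => (Lap_kap (qq_ge hRH z)).const_mul (mm z : ℂ)) ((summable_mq hRH).mul_left 4) ?_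
  · refine h.congr fun s hs => ?_
    rw [← (zeta_identity hRH (s := s) (by rw [hs]; norm_num)).tsum_eq, ← tsum_div_const]
    exact tsum_congr fun z => by rw [mul_div_assoc]
  · intro z u hu
    rw [norm_mul, Complex.norm_real, Real.norm_of_nonneg (mm_nonneg z)]
    have h1 := kap_bound (qq_ge hRH z) hu
    have h2 : 0 < qq z := by linarith [qq_ge hRH z]
    have h3 := one_le_exp_half hu
    have h4 := mm_nonneg z
    calc mm z * ‖kap (qq z) u‖ ≤ mm z * (4 / qq z) := by gcongr
      _ = 4 * (mm z / qq z) * 1 := by ring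
      _ ≤ _ := by gcongr

lemma Lap_dig : Lap (fun u => ∑' n:ℕ, (1/(2*n+3:ℂ)^2) * (1 - Complex.exp (-(2*n+3:ℂ) * u)))
      (fun s => (∑' n:ℕ, s/((2*n+3)*(2*n+3+s)))/s^2) := by
  have hk : ∀ n : ℕ, (2*n+3:ℂ) ≠ 0 := fun n => by
    have : ((2*n+3:ℝ):ℂ) ≠ 0 := ofReal_ne_zero.mpr (by positivity)
    simpa using this
  have h := Lap.tsum (c := fun n:ℕ => 2 * (1/(2*(n:ℝ)+3)^2))
    (fun n : ℕ => ((Lap_one).sub (Lap_exp (a := -(2*n+3:ℂ)) (by simp; linarith [n.cast_nonneg (α := ℝ)]))).const_mul (1/(2*n+3:ℂ)^2))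
    (summable_odd.mul_left 2) ?_
  · refine h.congr fun s hs => ?_
    rw [← tsum_div_const]
    refine tsum_congr fun n => ?_
    have hs0 : s ≠ 0 := fun h => by rw [h] at hs; simp at hs
    have hs1 : (2*n+3:ℂ) + s ≠ 0 := fun h => by
      have := congrArg Complex.re h; simp [hs] at this
      have h3 : (0:ℝ) ≤ n := by positivity
      linarith
    have hs2 : s - (-(2*n+3:ℂ)) ≠ 0 := fun h => hs1 (by linear_combination h)
    have := hk n
    field_simp; ring
  · intro n u hu
    have h3 := one_le_exp_half hu
    have h1 : ‖Complex.exp (-(2*n+3:ℂ) * u)‖ ≤ 1 := by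
      rw [Complex.norm_exp]; apply Real.exp_le_one_iff.mpr; simp
      have : (0:ℝ) ≤ n := by positivity
      nlinarith [mul_nonneg this hu]
    have h2 : ‖(2*n+3:ℂ)‖ = 2*n+3 := by
      have : (2*n+3:ℂ) = ((2*n+3:ℝ):ℂ) := by push_cast; rfl
      rw [this, Complex.norm_real, Real.norm_of_nonneg (by positivity)]
    rw [norm_mul, norm_div, norm_pow, h2, norm_one]
    calc _ ≤ 1/(2*(n:ℝ)+3)^2 * 2 := by
          gcongr
          calc _ ≤ ‖(1:ℂ)‖ + ‖Complex.exp (-(2*n+3:ℂ) * u)‖ := norm_sub_le _ _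
            _ ≤ 2 := by rw [norm_one]; linarith
      _ = 2 * (1/(2*(n:ℝ)+3)^2) * 1 := by ring
      _ ≤ _ := by gcongr

lemma cexp_log {n : ℕ} (hn : n ≠ 0) (s : ℂ) : Complex.exp (-s * Real.log n) = ((n:ℂ)^s)⁻¹ := by
  rw [Complex.cpow_def_of_ne_zero (by exact_mod_cast hn), ← Complex.exp_neg, ofReal_log (by positivity)]
  congr 1; push_cast; ring

lemma summable_Lambda : Summable (fun n : ℕ => Λ n / n * Real.exp (-Real.log n / 2)) := by
  have h := (ArithmeticFunction.LSeriesSummable_vonMangoldt (s := (3/2:ℂ)) (by norm_num)).norm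
  refine h.congr fun n => ?_
  rcases eq_or_ne n 0 with rfl | hn
  · simp
  rw [LSeries.term_of_ne_zero hn, norm_div, Complex.norm_real, Real.norm_of_nonneg ArithmeticFunction.vonMangoldt_nonneg]
  have hn' : (0:ℝ) < n := by positivity
  rw [Complex.norm_natCast_cpow_of_pos (by positivity)]
  rw [show (3/2:ℂ).re = 1 + 1/2 by norm_num, Real.rpow_add hn', Real.rpow_one, Real.rpow_def_of_pos hn',
    neg_div, Real.exp_neg]
  field_simp

noncomputable def bb (u : ℝ) : ℝ := ∑' n : ℕ, Λ n / n * max (u - Real.log n) 0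

lemma Lap_bb : Lap (fun u => (bb u : ℂ)) (fun s => -logDeriv riemannZeta (1+s)/s^2) := by
  have h := Lap.tsum (c := fun n:ℕ => Λ n / n * Real.exp (-Real.log n / 2))
    (fun n : ℕ => (Lap_ramp (l := Real.log n) (Real.log_natCast_nonneg n)).const_mul ((Λ n / n : ℝ):ℂ)) summable_Lambda ?_
  · have e : (fun u : ℝ => ∑' n : ℕ, ((Λ n / n : ℝ):ℂ) * ((max (u - Real.log n) 0 : ℝ):ℂ)) = fun u => (bb u : ℂ) := by
      ext u; unfold bb; rw [ofReal_tsum]; exact tsum_congr fun n => by push_cast; rfl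
    rw [e] at h
    refine h.congr fun s hs => ?_
    have h1 := ArithmeticFunction.LSeries_vonMangoldt_eq_deriv_riemannZeta_div (s := 1 + s) (by simp [hs])
    have h2 : -logDeriv riemannZeta (1+s) = LSeries (fun n => (Λ n : ℂ)) (1+s) := by
      rw [h1, logDeriv_apply, neg_div]
    rw [h2, LSeries, ← tsum_div_const]
    refine tsum_congr fun n => ?_
    rcases eq_or_ne n 0 with rfl | hn
    · simp
    rw [LSeries.term_of_ne_zero hn, cexp_log hn, Complex.cpow_add _ _ (by exact_mod_cast hn), Complex.cpow_one]
    push_cast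
    have : (n:ℂ) ≠ 0 := by exact_mod_cast hn
    field_simp
  · intro n u hu
    rw [norm_mul, Complex.norm_real, Complex.norm_real, Real.norm_of_nonneg (le_max_right _ _),
      Real.norm_of_nonneg (div_nonneg ArithmeticFunction.vonMangoldt_nonneg (by positivity)), mul_assoc]
    exact mul_le_mul_of_nonneg_left max_bound (div_nonneg ArithmeticFunction.vonMangoldt_nonneg (by positivity))

theorem explicit_formula (hRH : RiemannHypothesis) {u : ℝ} (hu : 0 ≤ u) :
    (bb u : ℂ) = (u:ℂ)^2/2 - Real.eulerMascheroniConstant * u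
      + ∑' n:ℕ, (1/(2*n+3:ℂ)^2) * (1 - Complex.exp (-(2*n+3:ℂ) * u))
      - ∑' z : Zr, (mm z : ℂ) * kap (qq z) u := by
  have h := ((((Lap_bb.add (Lap_zeros hRH)).sub Lap_sq).add (Lap_id.const_mul Real.eulerMascheroniConstant)).sub Lap_dig)
  have h2 := h.congr (M := fun _ => 0) fun s hs => by
    have hs0 : s ≠ 0 := fun h => by rw [h] at hs; simp at hs
    field_simp; ring
  have h3 := h2.unique ?_ hu
  · linear_combination h3
  · have hb : bb 0 = 0 := by
      unfold bb
      convert tsum_zero with n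
      rw [zero_sub, max_eq_right (by simpa using Real.log_natCast_nonneg n), mul_zero]
    simp [hb, kap, ker]
end MRH
end

section
open Complex Set Filter MeasureTheory Metric
open scoped Real Topology ArithmeticFunction.vonMangoldt

namespace MRH

lemma qq_pos (hRH : RiemannHypothesis) (z : Zr) : 0 < qq z := by linarith [qq_ge hRH z]

lemma part_le_Phi0 (hRH : RiemannHypothesis) (S : Finset Zr) (a : ℝ) :
    ∑ z ∈ S, mm z / (a^2 + qq z) ≤ Phi0 := by
  have h := Phi0_hasSum hRH
  rw [← h.tsum_eq]
  refine le_trans (Finset.sum_le_sum fun z _ => ?_)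
    (h.summable.sum_le_tsum S fun z _ => div_nonneg (mm_nonneg z) (qq_pos hRH z).le)
  have := qq_pos hRH z
  have := mm_nonneg z
  gcongr
  nlinarith [sq_nonneg a]

lemma logDeriv_zeta_re {s : ℝ} (hs : 0 < s) : (logDeriv riemannZeta (1 + (s:ℂ))).re ≤ 0 := by
  have h1 := ArithmeticFunction.LSeries_vonMangoldt_eq_deriv_riemannZeta_div (s := 1 + (s:ℂ)) (by simp [hs])
  have hsum := ArithmeticFunction.LSeriesSummable_vonMangoldt (s := 1 + (s:ℂ)) (by simp [hs])
  have h2 : logDeriv riemannZeta (1+(s:ℂ)) = -LSeries (fun n => (Λ n : ℂ)) (1+s) := by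
    rw [h1, logDeriv_apply]; ring
  rw [h2, neg_re, neg_nonpos, LSeries, re_tsum hsum]
  refine tsum_nonneg fun n => ?_
  rcases eq_or_ne n 0 with rfl | hn
  · simp
  rw [LSeries.term_of_ne_zero hn]
  have : (n:ℂ)^(1+(s:ℂ)) = (((n:ℝ)^(1+s) : ℝ):ℂ) := by
    rw [ofReal_cpow (by positivity)]; push_cast; rfl
  rw [this, ← ofReal_div, ofReal_re]
  exact div_nonneg ArithmeticFunction.vonMangoldt_nonneg (by positivity)

lemma part_le_log (hRH : RiemannHypothesis) (S : Finset Zr) {a : ℝ} (ha : 2 * π ≤ a) :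
    ∑ z ∈ S, mm z / (a^2 + qq z) ≤ Real.log (a/(2*π))/(4*a) + 1.18/a^2 := by
  have hpi := Real.pi_gt_three
  have ha6 : 6 < a := by linarith
  have hs : 0 < a - 1/2 := by linarith
  have hs' : 0 < ((a - 1/2 : ℝ):ℂ).re := by simpa using hs
  have hF := hadamard hRH (F_ne hs')
  have hid := zeta_identity0 hs'
  have e1 : ((a - 1/2 : ℝ):ℂ) * (((a - 1/2 : ℝ):ℂ) + 1) = ((a^2 - 1/4 : ℝ):ℂ) := by push_cast; ring
  rw [e1] at hF hid
  set X := logDeriv F ((a^2 - 1/4 : ℝ):ℂ) with hX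
  have hre := (Complex.reCLM.hasSum hF)
  have e2 : (fun u : Zr => Complex.reCLM ((mm u:ℂ)/(((a^2 - 1/4 : ℝ):ℂ) + qq u))) = fun u => mm u / (a^2 - 1/4 + qq u) := by
    ext u
    rw [← ofReal_add, ← ofReal_div]; exact ofReal_re _
  have hre2 : HasSum (fun u => mm u / (a^2 - 1/4 + qq u)) X.re := by
    rw [← e2]; exact hre
  have hXle : X.re * (2 * a) ≤ 1/(a - 1/2) + Real.log ((a + 5/2)/(2*π)) / 2 := by
    have h3 := congrArg Complex.re hid
    have e3 : (2 * ((a - 1/2 : ℝ):ℂ) + 1) = ((2*a : ℝ):ℂ) := by push_cast; ring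
    have e4 : (3 + ((a - 1/2 : ℝ):ℂ))/2 = (((a + 5/2)/2 : ℝ):ℂ) := by push_cast; ring
    rw [e3, e4, digamma_ofReal (by linarith), re_ofReal_mul, ← ofReal_one, ← ofReal_div] at h3
    have e5 : (-((Real.log π : ℝ):ℂ)/2 + (psi ((a+5/2)/2) : ℂ)/2) = ((-Real.log π/2 + psi ((a+5/2)/2)/2 : ℝ):ℂ) := by
      push_cast; ring
    rw [e5, add_re, add_re, ofReal_re, ofReal_re, ofReal_one] at h3
    have h4 := logDeriv_zeta_re hs
    have h5 := psi_le_log (x := (a+5/2)/2) (by linarith)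
    have h6 : Real.log ((a + 5/2)/(2*π)) = Real.log ((a+5/2)/2) - Real.log π := by
      rw [← Real.log_div (by positivity) (by positivity)]; congr 1; field_simp
    rw [h6]
    linarith
  have hlog : Real.log ((a + 5/2)/(2*π)) ≤ Real.log (a/(2*π)) + 5/(2*a) := by
    have : (a + 5/2)/(2*π) = a/(2*π) * (1 + 5/(2*a)) := by field_simp
    rw [this, Real.log_mul (by positivity) (by positivity)]
    have := Real.log_le_sub_one_of_pos (x := 1 + 5/(2*a)) (by positivity)
    linarith
  have h7 : 1/(a - 1/2) ≤ (12/11)/a := by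
    rw [div_le_div_iff₀ hs (by linarith)]; linarith
  have hfin : X.re ≤ Real.log (a/(2*π))/(4*a) + 1.18/a^2 := by
    have : X.re * (2*a) ≤ Real.log (a/(2*π))/2 + 2.36/a := by
      have e : 5/(2*a) / 2 + (12/11)/a ≤ 2.36/a := by
        rw [show 5/(2*a)/2 + (12/11)/a = (5/4+12/11)/a by field_simp; norm_num]
        gcongr; norm_num
      linarith
    have e : Real.log (a/(2*π))/(4*a) + 1.18/a^2 = (Real.log (a/(2*π))/2 + 2.36/a)/(2*a) := by
      field_simp; norm_num
    rw [e, le_div_iff₀ (by linarith)]; exact this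
  refine le_trans ?_ hfin
  rw [← hre2.tsum_eq]
  refine le_trans (Finset.sum_le_sum fun z _ => ?_)
    (hre2.summable.sum_le_tsum S fun z _ => div_nonneg (mm_nonneg z) ?_)
  · have := qq_ge hRH z
    have := mm_nonneg z
    have : 0 < a^2 - 1/4 + qq z := by nlinarith
    gcongr
    linarith
  · have := qq_ge hRH z
    nlinarith

lemma min_le_arctan {y : ℝ} (hy : 0 ≤ y) : min 1 y ≤ 3/π * Real.arctan (√3 * y) := by
  have hconc : ConcaveOn ℝ (Ici 0) Real.arctan := by
    refine AntitoneOn.concaveOn_of_deriv (convex_Ici 0) Real.continuous_arctan.continuousOn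
      Real.differentiable_arctan.differentiableOn ?_
    intro x hx y hy hxy
    simp only [interior_Ici, mem_Ioi] at hx hy
    simp only [Real.deriv_arctan]
    gcongr
  have h3 : Real.arctan √3 = π/3 := by
    rw [← Real.tan_pi_div_three, Real.arctan_tan] <;> linarith [Real.pi_pos]
  have hpi := Real.pi_pos
  rcases le_total 1 y with h | h
  · rw [min_eq_left h]
    have : Real.arctan √3 ≤ Real.arctan (√3 * y) := by
      apply Real.arctan_strictMono.monotone
      nlinarith [Real.sqrt_nonneg 3]
    rw [h3] at this
    calc (1:ℝ) = 3/π * (π/3) := by field_simp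
      _ ≤ _ := by gcongr
  · rw [min_eq_right h]
    have := hconc.2 (x := √3) (by simp) (y := 0) (by simp) hy (by linarith : 0 ≤ 1 - y) (by ring)
    simp only [smul_eq_mul, Real.arctan_zero, mul_zero, add_zero, h3] at this
    calc y = 3/π * (y * (π/3)) := by field_simp
      _ ≤ 3/π * Real.arctan (y * √3) := by gcongr
      _ = _ := by rw [mul_comm y]

lemma arctan_part_hasDeriv (hRH : RiemannHypothesis) (S : Finset Zr) (a : ℝ) :
    HasDerivAt (fun a => ∑ z ∈ S, mm z / √(qq z) * Real.arctan (a / √(qq z)))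
      (∑ z ∈ S, mm z / (a^2 + qq z)) a := by
  refine HasDerivAt.fun_sum fun z _ => ?_
  have hq := qq_pos hRH z
  have hsq := Real.sq_sqrt hq.le
  have hp := Real.sqrt_pos.mpr hq
  have h := (((hasDerivAt_id a).div_const (√(qq z))).arctan).const_mul (mm z / √(qq z))
  refine h.congr_deriv ?_
  simp only [id]
  rw [← hsq]
  rw [Real.sqrt_sq hp.le]
  field_simp
  ring

lemma arctan_part_bound (hRH : RiemannHypothesis) (S : Finset Zr) {A : ℝ} (hA : 2*π ≤ A) :
    ∑ z ∈ S, mm z / √(qq z) * Real.arctan (A / √(qq z)) ≤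
      2*π*Phi0 + (Real.log (A/(2*π)))^2/8 + 1.18/(2*π) := by
  set f := (fun a => ∑ z ∈ S, mm z / √(qq z) * Real.arctan (a / √(qq z))) with hf
  have hd := arctan_part_hasDeriv hRH S
  have hpi := Real.pi_pos
  have h1 : f (2*π) ≤ 2*π*Phi0 := by
    have hanti : Antitone (fun a => f a - a * Phi0) := by
      refine antitone_of_hasDerivAt_nonpos (fun a => (hd a).sub ((hasDerivAt_id a).mul_const Phi0)) fun a => ?_
      have := part_le_Phi0 hRH S a
      show _ ≤ (0:ℝ); simp only [one_mul]; linarith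
    have := hanti (by positivity : (0:ℝ) ≤ 2*π)
    have h0 : f 0 = 0 := by simp [hf]
    simp only [h0] at this
    linarith
  have hG : ∀ a, 2*π ≤ a → HasDerivAt (fun a => (Real.log (a/(2*π)))^2/8 - 1.18/a)
      (Real.log (a/(2*π))/(4*a) + 1.18/a^2) a := by
    intro a ha
    have ha0 : 0 < a := by linarith
    have e1 := (((((hasDerivAt_id a).div_const (2*π)).log (by simp; positivity)).pow 2).div_const 8).sub
      ((hasDerivAt_const a (1.18:ℝ)).div (hasDerivAt_id a) ha0.ne')
    refine e1.congr_deriv ?_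
    simp; field_simp; ring
  have hanti : AntitoneOn (fun a => f a - ((Real.log (a/(2*π)))^2/8 - 1.18/a)) (Ici (2*π)) := by
    have hdd : ∀ a ∈ Ici (2*π), HasDerivAt (fun a => f a - ((Real.log (a/(2*π)))^2/8 - 1.18/a)) _ a :=
      fun a ha => (hd a).sub (hG a ha)
    refine antitoneOn_of_deriv_nonpos (convex_Ici _) (fun a ha => (hdd a ha).continuousAt.continuousWithinAt) ?_ ?_
    · intro a ha; exact (hdd a (interior_subset ha)).differentiableAt.differentiableWithinAt
    · intro a ha
      rw [(hdd a (interior_subset ha)).deriv]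
      have := part_le_log hRH S (interior_subset ha)
      linarith
  have h2 := hanti (self_mem_Ici) hA hA
  simp only at h2
  rw [div_self (by positivity), Real.log_one] at h2
  have h3 : 0 ≤ 1.18/A := by have : 0 < A := by linarith
                             positivity
  change f A ≤ _
  linarith

lemma S_bound (hRH : RiemannHypothesis) {T : ℝ} (hT : 2*π ≤ √3 * T) :
    ∑' z : Zr, mm z * min (1/√(qq z)) (T/qq z) ≤
      3/π * (2*π*Phi0 + (Real.log (√3 * T/(2*π)))^2/8 + 1.18/(2*π)) := by
  have hT0 : 0 < T := by
    by_contra h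
    nlinarith [Real.sqrt_nonneg 3, Real.pi_pos]
  have hpi := Real.pi_pos
  refine Real.tsum_le_of_sum_le (fun z => mul_nonneg (mm_nonneg z) (le_min (by positivity)
    (div_nonneg hT0.le (qq_pos hRH z).le))) fun S => ?_
  refine le_trans (Finset.sum_le_sum (g := fun z => 3/π * (mm z / √(qq z) * Real.arctan (√3*T / √(qq z)))) fun z _ => ?_) ?_
  · have hq := qq_pos hRH z
    have hsq := Real.sq_sqrt hq.le
    have hp := Real.sqrt_pos.mpr hq
    have h := min_le_arctan (y := T/√(qq z)) (by positivity)
    have e : min (1/√(qq z)) (T/qq z) = (1/√(qq z)) * min 1 (T/√(qq z)) := by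
      rw [mul_min_of_nonneg _ _ (by positivity), mul_one]
      congr 1
      conv_lhs => rw [← hsq]
      field_simp
    rw [e]
    have hm := mm_nonneg z
    calc _ = mm z / √(qq z) * min 1 (T/√(qq z)) := by ring
      _ ≤ mm z / √(qq z) * (3/π * Real.arctan (√3 * (T/√(qq z)))) := by gcongr
      _ = _ := by rw [mul_div_assoc]; ring
  · rw [← Finset.mul_sum]
    gcongr
    exact arctan_part_bound hRH S hT
end MRH
end

section
open Complex Set Filter MeasureTheory Metric
open scoped Real Topology ArithmeticFunction.vonMangoldt

namespace MRH

noncomputable def AA (u : ℝ) : ℝ := ∑ n ∈ Finset.range (⌊Real.exp u⌋₊ + 1), Λ n / n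

lemma mem_range_exp {n : ℕ} {u : ℝ} (hn : n ≠ 0) : n ∈ Finset.range (⌊Real.exp u⌋₊ + 1) ↔ Real.log n ≤ u := by
  rw [Finset.mem_range, Nat.lt_succ_iff, Nat.le_floor_iff (Real.exp_pos u).le,
    Real.log_le_iff_le_exp (by positivity)]

lemma bb_eq {u U : ℝ} (h : u ≤ U) :
    bb u = ∑ n ∈ Finset.range (⌊Real.exp U⌋₊ + 1), Λ n / n * max (u - Real.log n) 0 := by
  unfold bb
  refine tsum_eq_sum fun n hn => ?_
  rcases eq_or_ne n 0 with rfl | h0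
  · simp
  rw [mem_range_exp h0, not_le] at hn
  rw [max_eq_right (by linarith), mul_zero]

lemma Lam_nonneg (n : ℕ) : 0 ≤ Λ n / n := div_nonneg ArithmeticFunction.vonMangoldt_nonneg (by positivity)

lemma AA_upper {u h : ℝ} (hh : 0 ≤ h) : h * AA u ≤ bb (u + h) - bb u := by
  rw [bb_eq (le_refl (u+h)), bb_eq (show u ≤ u + h by linarith), ← Finset.sum_sub_distrib, AA, Finset.mul_sum]
  have hsub : Finset.range (⌊Real.exp u⌋₊ + 1) ⊆ Finset.range (⌊Real.exp (u+h)⌋₊ + 1) := by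
    apply Finset.range_subset_range.mpr
    have := Nat.floor_mono (Real.exp_le_exp.mpr (show u ≤ u + h by linarith))
    omega
  refine le_trans (Finset.sum_le_sum fun n hn => ?_) (Finset.sum_le_sum_of_subset_of_nonneg hsub fun n _ _ => ?_)
  · rcases eq_or_ne n 0 with rfl | h0
    · simp
    rw [mem_range_exp h0] at hn
    rw [max_eq_left (by linarith), max_eq_left (by linarith)]
    linarith
  · rw [← mul_sub]
    refine mul_nonneg (Lam_nonneg n) (sub_nonneg.mpr ?_)
    exact max_le_max (by linarith) le_rfl

lemma AA_lower {u h : ℝ} (hh : 0 ≤ h) : bb u - bb (u - h) ≤ h * AA u := by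
  rw [bb_eq (le_refl u), bb_eq (show u - h ≤ u by linarith), ← Finset.sum_sub_distrib, AA, Finset.mul_sum]
  refine Finset.sum_le_sum fun n hn => ?_
  rw [← mul_sub, mul_comm h]
  refine mul_le_mul_of_nonneg_left ?_ (Lam_nonneg n)
  have : max (u - Real.log n) 0 ≤ max (u - h - Real.log n) 0 + h :=
    max_le (by linarith [le_max_left (u - h - Real.log n) 0]) (by linarith [le_max_right (u - h - Real.log n) 0])
  linarith

lemma norm_exp_sub_one_le' {r : ℂ} (hr : r.re ≤ 0) {h : ℝ} (hh : 0 ≤ h) :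
    ‖Complex.exp (r * h) - 1‖ ≤ ‖r‖ * h := by
  have h1 : ∀ x : ℝ, HasDerivAt (fun t : ℝ => Complex.exp (r * t)) (Complex.exp (r * x) * r) x := by
    intro x
    have h1 : HasDerivAt (fun u : ℝ => (u:ℂ)) 1 x := by simpa using (hasDerivAt_id x).ofReal_comp
    simpa using (h1.const_mul r).cexp
  have := norm_image_sub_le_of_norm_deriv_le_segment' (f := fun t : ℝ => Complex.exp (r * t)) (a := 0) (b := h) (C := ‖r‖)
    (fun x _ => (h1 x).hasDerivWithinAt) (fun x hx => by
      rw [norm_mul]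
      have : ‖Complex.exp (r * x)‖ ≤ 1 := by
        rw [Complex.norm_exp]; apply Real.exp_le_one_iff.mpr; simp; nlinarith [hx.1]
      nlinarith [norm_nonneg r]) h (right_mem_Icc.mpr hh)
  simpa using this

lemma ker_diff {r : ℂ} (hr : r.re = -1/2) {u h : ℝ} (hh : 0 ≤ h) :
    ‖ker r (u+h) - ker r u‖ ≤ Real.exp (-u/2) * min (2/‖r‖^2) (h/‖r‖) := by
  have h0 : r ≠ 0 := fun h => by rw [h] at hr; norm_num at hr
  have hn : 0 < ‖r‖ := norm_pos_iff.mpr h0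
  have e : ker r (u+h) - ker r u = Complex.exp (r*u) * ((Complex.exp (r*h) - 1)/r^2) := by
    unfold ker; push_cast; rw [mul_add, Complex.exp_add]; field_simp; ring
  rw [e, norm_mul, Complex.norm_exp, norm_div, norm_pow]
  have e2 : (r * (u:ℂ)).re = -u/2 := by simp [hr]; ring
  rw [e2]
  refine mul_le_mul_of_nonneg_left (le_min ?_ ?_) (Real.exp_pos _).le
  · gcongr
    have h1 : ‖Complex.exp (r*h)‖ ≤ 1 := by
      rw [Complex.norm_exp]; apply Real.exp_le_one_iff.mpr; simp [hr]; nlinarith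
    calc _ ≤ ‖Complex.exp (r*h)‖ + ‖(1:ℂ)‖ := norm_sub_le _ _
      _ ≤ 2 := by rw [norm_one]; linarith
  · rw [div_le_div_iff₀ (by positivity) hn]
    have := norm_exp_sub_one_le' (r := r) (by rw [hr]; norm_num) hh
    nlinarith

lemma kap_diff {q : ℝ} (hq : 1/4 ≤ q) {u h : ℝ} (hh : 0 < h) :
    ‖kap q (u+h) - kap q u‖ ≤ 2 * h * Real.exp (-u/2) * min (1/√q) ((2/h)/q) := by
  have h1 := ker_diff (rho_re q) (u := u) hh.le
  have h2 := ker_diff (rho'_re q) (u := u) hh.le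
  have e1 : ‖rho q‖ = √q := by rw [← Real.sqrt_sq (norm_nonneg (rho q)), rho_normSq hq]
  have e2 : ‖rho' q‖ = √q := by rw [← Real.sqrt_sq (norm_nonneg (rho' q)), rho'_normSq hq]
  rw [e1] at h1
  rw [e2] at h2
  have hs : √q^2 = q := Real.sq_sqrt (by linarith)
  have hq0 : 0 < q := by linarith
  have hsq := Real.sqrt_pos.mpr hq0
  have e3 : min (2/√q^2) (h/√q) = h * min (1/√q) ((2/h)/q) := by
    rw [mul_min_of_nonneg _ _ hh.le, min_comm, hs]
    congr 1
    · ring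
    · field_simp
  rw [e3] at h1 h2
  have e4 : kap q (u+h) - kap q u = (ker (rho q) (u+h) - ker (rho q) u) + (ker (rho' q) (u+h) - ker (rho' q) u) := by
    unfold kap; ring
  rw [e4]
  calc _ ≤ _ := norm_add_le _ _
    _ ≤ _ := add_le_add h1 h2
    _ = _ := by ring

noncomputable def dig (u : ℝ) : ℝ := ∑' n:ℕ, (1/(2*(n:ℝ)+3)^2) * Real.exp (-(2*n+3) * u)

lemma odd_sum_le : ∑' n:ℕ, 1/(2*(n:ℝ)+3)^2 ≤ 1/4 := by
  refine Real.tsum_le_of_sum_range_le (fun n => by positivity) fun N => ?_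
  have : ∀ N : ℕ, ∑ n ∈ Finset.range N, 1/(2*(n:ℝ)+3)^2 ≤ 1/4 - 1/(4*((N:ℝ)+1)) := by
    intro N
    induction N with
    | zero => norm_num
    | succ k ih =>
      rw [Finset.sum_range_succ]
      have : 1/(2*(k:ℝ)+3)^2 ≤ 1/(4*((k:ℝ)+1)) - 1/(4*((k:ℝ)+1+1)) := by
        rw [div_sub_div _ _ (by positivity) (by positivity), div_le_div_iff₀ (by positivity) (by positivity)]
        have : (0:ℝ) ≤ k := by positivity
        nlinarith
      push_cast
      linarith
  have h2 : 0 ≤ 1/(4*((N:ℝ)+1)) := by positivity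
  linarith [this N]

lemma dig_term_le (n : ℕ) {u : ℝ} (hu : 0 ≤ u) :
    (1/(2*(n:ℝ)+3)^2) * Real.exp (-(2*n+3) * u) ≤ 1/(2*(n:ℝ)+3)^2 * Real.exp (-3*u) := by
  gcongr
  have : (0:ℝ) ≤ n := by positivity
  nlinarith [mul_nonneg this hu]

lemma dig_summable {u : ℝ} (hu : 0 ≤ u) :
    Summable (fun n:ℕ => (1/(2*(n:ℝ)+3)^2) * Real.exp (-(2*n+3) * u)) :=
  Summable.of_nonneg_of_le (fun n => by positivity) (fun n => dig_term_le n hu) (summable_odd.mul_right _)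

lemma dig_nonneg (u : ℝ) : 0 ≤ dig u := tsum_nonneg fun n => by positivity
lemma dig_le {u : ℝ} (hu : 0 ≤ u) : dig u ≤ Real.exp (-3*u)/4 := by
  calc dig u ≤ ∑' n:ℕ, 1/(2*(n:ℝ)+3)^2 * Real.exp (-3*u) :=
        (dig_summable hu).tsum_le_tsum (fun n => dig_term_le n hu) (summable_odd.mul_right _)
    _ = (∑' n:ℕ, 1/(2*(n:ℝ)+3)^2) * Real.exp (-3*u) := tsum_mul_right
    _ ≤ 1/4 * Real.exp (-3*u) := by gcongr; exact odd_sum_le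
    _ = _ := by ring
lemma dig_anti {u v : ℝ} (hu : 0 ≤ u) (huv : u ≤ v) : dig v ≤ dig u := by
  refine (dig_summable (hu.trans huv)).tsum_le_tsum (fun n => ?_) (dig_summable hu)
  gcongr ?_ * ?_
  rw [Real.exp_le_exp]
  have : (0:ℝ) ≤ 2 * n + 3 := by positivity
  nlinarith

lemma dig_complex {u : ℝ} (hu : 0 ≤ u) :
    ∑' n:ℕ, (1/(2*n+3:ℂ)^2) * (1 - Complex.exp (-(2*n+3:ℂ) * u)) = ((dig 0 - dig u : ℝ) : ℂ) := by
  unfold dig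
  rw [← (dig_summable le_rfl).tsum_sub (dig_summable hu), ofReal_tsum]
  refine tsum_congr fun n => ?_
  push_cast
  simp; ring

lemma summable_kap (hRH : RiemannHypothesis) {u : ℝ} (hu : 0 ≤ u) :
    Summable (fun z : Zr => (mm z : ℂ) * kap (qq z) u) := by
  refine Summable.of_norm_bounded ((summable_mq hRH).mul_left 4) fun z => ?_
  rw [norm_mul, Complex.norm_real, Real.norm_of_nonneg (mm_nonneg z)]
  have h1 := kap_bound (qq_ge hRH z) hu
  have h4 := mm_nonneg z
  calc mm z * ‖kap (qq z) u‖ ≤ mm z * (4 / qq z) := by gcongr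
      _ = 4 * (mm z / qq z) := by ring

noncomputable def SS' (T : ℝ) : ℝ := ∑' z : Zr, mm z * min (1/√(qq z)) (T/qq z)

lemma bb_diff (hRH : RiemannHypothesis) {u h : ℝ} (hu : 0 ≤ u) (hh : 0 < h) :
    |bb (u+h) - bb u - (u*h + h^2/2 - Real.eulerMascheroniConstant * h) - (dig u - dig (u+h))| ≤
      2 * h * Real.exp (-u/2) * SS' (2/h) := by
  have h1 := explicit_formula hRH hu
  have h2 := explicit_formula hRH (show 0 ≤ u + h by linarith)
  rw [dig_complex hu] at h1
  rw [dig_complex (show 0 ≤ u + h by linarith)] at h2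
  have e : ((bb (u+h) - bb u - (u*h + h^2/2 - Real.eulerMascheroniConstant * h) - (dig u - dig (u+h)) : ℝ):ℂ)
      = - ∑' z : Zr, (mm z : ℂ) * (kap (qq z) (u+h) - kap (qq z) u) := by
    simp only [mul_sub]
    rw [(summable_kap hRH (show 0 ≤ u + h by linarith)).tsum_sub (summable_kap hRH hu)]
    push_cast at h1 h2 ⊢
    rw [h1, h2]; ring
  rw [← Real.norm_eq_abs, ← Complex.norm_real, e, norm_neg]
  unfold SS'
  rw [← tsum_mul_left]
  refine tsum_of_norm_bounded (Summable.hasSum ?_) fun z => ?_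
  · refine Summable.mul_left _ ?_
    refine Summable.of_nonneg_of_le (fun z => mul_nonneg (mm_nonneg z) (le_min (by positivity)
      (div_nonneg (by positivity) (qq_pos hRH z).le))) (fun z => ?_) ((summable_mq hRH).mul_left (2/h))
    have := mul_le_mul_of_nonneg_left (min_le_right (1/√(qq z)) ((2/h)/qq z)) (mm_nonneg z)
    calc _ ≤ _ := this
      _ = _ := by ring
  · rw [norm_mul, Complex.norm_real, Real.norm_of_nonneg (mm_nonneg z)]
    have h1 := kap_diff (qq_ge hRH z) (u := u) hh
    calc _ ≤ mm z * _ := mul_le_mul_of_nonneg_left h1 (mm_nonneg z)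
      _ = _ := by ring

lemma E_upper (hRH : RiemannHypothesis) {u h : ℝ} (hu : 0 ≤ u) (hh : 0 < h) :
    AA u - u + Real.eulerMascheroniConstant ≤ h/2 + Real.exp (-3*u)/(4*h) + 2 * Real.exp (-u/2) * SS' (2/h) := by
  have h1 := (abs_le.mp (bb_diff hRH hu hh)).2
  have h2 := AA_upper (u := u) hh.le
  have h3 := dig_le hu
  have h4 := dig_nonneg (u+h)
  have : h * (AA u - u + Real.eulerMascheroniConstant) ≤ h * (h/2 + Real.exp (-3*u)/(4*h) + 2 * Real.exp (-u/2) * SS' (2/h)) := by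
    have e : h * (h/2 + Real.exp (-3*u)/(4*h) + 2 * Real.exp (-u/2) * SS' (2/h)) =
      h^2/2 + Real.exp (-3*u)/4 + 2 * h * Real.exp (-u/2) * SS' (2/h) := by field_simp
    rw [e]; linarith
  exact le_of_mul_le_mul_left this hh

lemma E_lower (hRH : RiemannHypothesis) {u h : ℝ} (hu : h ≤ u) (hh : 0 < h) :
    -(h/2 + 2 * Real.exp (-(u-h)/2) * SS' (2/h)) ≤ AA u - u + Real.eulerMascheroniConstant := by
  have h1 := (abs_le.mp (bb_diff hRH (show 0 ≤ u - h by linarith) hh)).1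
  rw [sub_add_cancel] at h1
  have h2 := AA_lower (u := u) hh.le
  have h3 := dig_anti (show 0 ≤ u - h by linarith) (show u - h ≤ u by linarith)
  have : h * -(h/2 + 2 * Real.exp (-(u-h)/2) * SS' (2/h)) ≤ h * (AA u - u + Real.eulerMascheroniConstant) := by
    linarith
  exact le_of_mul_le_mul_left this hh
end MRH
end

section
open Complex Set Filter MeasureTheory Metric
open scoped Real Topology ArithmeticFunction.vonMangoldt

namespace MRH

noncomputable def Kc : ℝ := dig 0 + (∑' z : Zr, (mm z : ℂ) * (1/(rho (qq z))^2 + 1/(rho' (qq z))^2)).re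
noncomputable def RR (v : ℝ) : ℝ := bb v - v^2/2 + Real.eulerMascheroniConstant * v - Kc

lemma bb_cont : ContinuousOn bb (Ici 0) := by
  have := Complex.continuous_re.comp_continuousOn Lap_bb.cont
  exact this

lemma RR_cont : ContinuousOn RR (Ici 0) := by
  unfold RR
  exact ((bb_cont.sub (by fun_prop)).add (by fun_prop)).sub continuousOn_const

lemma exp_over_bound {r : ℂ} (hr : r.re = -1/2) (v : ℝ) : ‖Complex.exp (r * v) / r^2‖ = Real.exp (-v/2) / ‖r‖^2 := by
  rw [norm_div, norm_pow, Complex.norm_exp]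
  congr 2; simp [hr]; ring

lemma pair_bound (hRH : RiemannHypothesis) (z : Zr) (v : ℝ) :
    ‖(mm z : ℂ) * (Complex.exp (rho (qq z) * v)/(rho (qq z))^2 + Complex.exp (rho' (qq z) * v)/(rho' (qq z))^2)‖ ≤
      2 * Real.exp (-v/2) * (mm z / qq z) := by
  rw [norm_mul, Complex.norm_real, Real.norm_of_nonneg (mm_nonneg z)]
  have h1 := exp_over_bound (rho_re (qq z)) v
  have h2 := exp_over_bound (rho'_re (qq z)) v
  rw [rho_normSq (qq_ge hRH z)] at h1
  rw [rho'_normSq (qq_ge hRH z)] at h2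
  calc _ ≤ mm z * (Real.exp (-v/2)/qq z + Real.exp (-v/2)/qq z) := by
        refine mul_le_mul_of_nonneg_left ((norm_add_le _ _).trans ?_) (mm_nonneg z)
        rw [h1, h2]
    _ = _ := by ring

lemma RR_bound (hRH : RiemannHypothesis) {v : ℝ} (hv : 0 ≤ v) :
    |RR v| ≤ (1/4 + 2 * Phi0) * Real.exp (-v/2) := by
  have hs : ∀ v : ℝ, Summable (fun z : Zr => (mm z : ℂ) * (Complex.exp (rho (qq z) * v)/(rho (qq z))^2 + Complex.exp (rho' (qq z) * v)/(rho' (qq z))^2)) :=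
    fun v => Summable.of_norm_bounded ((summable_mq hRH).mul_left _) (fun z => pair_bound hRH z v)
  have hs0 := hs 0
  simp only [ofReal_zero, mul_zero, Complex.exp_zero] at hs0
  have h1 := explicit_formula hRH hv
  rw [dig_complex hv] at h1
  have h2 : ∑' z : Zr, (mm z : ℂ) * kap (qq z) v =
      ∑' z : Zr, (mm z : ℂ) * (Complex.exp (rho (qq z) * v)/(rho (qq z))^2 + Complex.exp (rho' (qq z) * v)/(rho' (qq z))^2)
      - ∑' z : Zr, (mm z : ℂ) * (1/(rho (qq z))^2 + 1/(rho' (qq z))^2) := by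
    rw [← (hs v).tsum_sub hs0]
    refine tsum_congr fun z => ?_
    unfold kap ker; ring
  rw [h2] at h1
  have h3 := congrArg Complex.re h1
  set W := ∑' z : Zr, (mm z : ℂ) * (Complex.exp (rho (qq z) * v)/(rho (qq z))^2 + Complex.exp (rho' (qq z) * v)/(rho' (qq z))^2) with hW
  have e : ((v:ℂ)^2/2 - Real.eulerMascheroniConstant * v + ((dig 0 - dig v : ℝ):ℂ)).re = v^2/2 - Real.eulerMascheroniConstant * v + (dig 0 - dig v) := by
    have : ((v:ℂ)^2/2 - Real.eulerMascheroniConstant * v + ((dig 0 - dig v : ℝ):ℂ)) = ((v^2/2 - Real.eulerMascheroniConstant * v + (dig 0 - dig v) : ℝ):ℂ) := by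
      push_cast; ring
    rw [this, ofReal_re]
  rw [sub_re, e, sub_re, ofReal_re] at h3
  have hR : RR v = -dig v - W.re := by
    unfold RR Kc; linarith
  have hWn : ‖W‖ ≤ 2 * Real.exp (-v/2) * Phi0 :=
    tsum_of_norm_bounded ((Phi0_hasSum hRH).mul_left _) (fun z => pair_bound hRH z v)
  have h4 := (abs_re_le_norm W).trans hWn
  have h5 := dig_le hv
  have h6 := dig_nonneg v
  have h7 : Real.exp (-3*v) ≤ Real.exp (-v/2) := Real.exp_le_exp.mpr (by linarith)
  have h8 := abs_le.mp h4
  rw [hR, abs_le]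
  constructor <;> linarith [h8.1, h8.2]

noncomputable def MM (u : ℝ) : ℝ := ∑ n ∈ Finset.range (⌊Real.exp u⌋₊ + 1), Λ n / (n * Real.log n)

lemma log2_pos : 0 < Real.log 2 := Real.log_pos (by norm_num)

lemma term_integral {l u : ℝ} (hl : Real.log 2 ≤ l) (hu : l ≤ u) :
    ∫ v in (Real.log 2)..u, 2 * max (v - l) 0 / v^3 = 1/l - 2/u + l/u^2 := by
  have h2 := log2_pos
  have hc : ∀ a b : ℝ, Real.log 2 ≤ a → Real.log 2 ≤ b → IntervalIntegrable (fun v => 2 * max (v - l) 0 / v^3) volume a b := by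
    intro a b ha hb
    refine ContinuousOn.intervalIntegrable ?_
    refine ContinuousOn.div (by fun_prop) (by fun_prop) fun v hv => ?_
    have : Real.log 2 ≤ v := le_trans (le_min ha hb) hv.1
    have : 0 < v := by linarith
    positivity
  rw [← intervalIntegral.integral_add_adjacent_intervals (hc _ l le_rfl hl) (hc l u hl (hl.trans hu))]
  have e1 : ∫ v in (Real.log 2)..l, 2 * max (v - l) 0 / v^3 = 0 := by
    rw [intervalIntegral.integral_congr (g := fun _ => 0), intervalIntegral.integral_zero]
    intro v hv
    rw [uIcc_of_le hl] at hv
    simp [max_eq_right (sub_nonpos.mpr hv.2)]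
  rw [e1, zero_add]
  have e2 : ∫ v in l..u, 2 * max (v - l) 0 / v^3 = ∫ v in l..u, 2 * (v - l) / v^3 := by
    refine intervalIntegral.integral_congr fun v hv => ?_
    rw [uIcc_of_le hu] at hv
    simp [max_eq_left (sub_nonneg.mpr hv.1)]
  rw [e2, intervalIntegral.integral_eq_sub_of_hasDerivAt (f := fun v => -2/v + l/v^2)]
  · have : l ≠ 0 := by linarith
    have : u ≠ 0 := by linarith
    field_simp; ring
  · intro v hv
    rw [uIcc_of_le hu] at hv
    have hv0 : v ≠ 0 := by linarith [hv.1]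
    have h := ((hasDerivAt_const v (-2:ℝ)).div (hasDerivAt_id v) hv0).add
      ((hasDerivAt_const v l).div ((hasDerivAt_id v).pow 2) (by simpa using hv0))
    refine h.congr_deriv ?_
    simp; field_simp; ring
  · refine ContinuousOn.intervalIntegrable ?_
    refine ContinuousOn.div (by fun_prop) (by fun_prop) fun v hv => ?_
    rw [uIcc_of_le hu] at hv
    have : 0 < v := by linarith [hv.1]
    positivity

lemma MM_eq {u : ℝ} (hu : Real.log 2 ≤ u) :
    MM u = AA u / u + bb u / u^2 + ∫ v in (Real.log 2)..u, 2 * bb v / v^3 := by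
  have h2 := log2_pos
  have hu0 : u ≠ 0 := by linarith
  have e : ∫ v in (Real.log 2)..u, 2 * bb v / v^3 =
      ∑ n ∈ Finset.range (⌊Real.exp u⌋₊ + 1), Λ n / n * ∫ v in (Real.log 2)..u, 2 * max (v - Real.log n) 0 / v^3 := by
    simp_rw [← intervalIntegral.integral_const_mul]
    rw [← intervalIntegral.integral_finsetSum]
    · refine intervalIntegral.integral_congr fun v hv => ?_
      rw [uIcc_of_le hu] at hv
      show 2 * bb v / v ^ 3 = _
      rw [bb_eq hv.2, Finset.mul_sum, Finset.sum_div]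
      exact Finset.sum_congr rfl fun n _ => by ring
    · intro n _
      refine ContinuousOn.intervalIntegrable ?_
      refine ContinuousOn.mul (by fun_prop) (ContinuousOn.div (by fun_prop) (by fun_prop) fun v hv => ?_)
      rw [uIcc_of_le hu] at hv
      have : 0 < v := by linarith [hv.1]
      positivity
  rw [e, bb_eq le_rfl, AA, MM, Finset.sum_div, Finset.sum_div, ← Finset.sum_add_distrib, ← Finset.sum_add_distrib]
  refine Finset.sum_congr rfl fun n hn => ?_
  rcases Nat.lt_or_ge n 2 with h | h
  · interval_cases n <;> simp
  rw [mem_range_exp (by omega)] at hn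
  have hl : Real.log 2 ≤ Real.log n := Real.log_le_log (by norm_num) (by exact_mod_cast h)
  rw [term_integral hl hn, max_eq_left (by linarith)]
  have : Real.log n ≠ 0 := by linarith
  have : (n:ℝ) ≠ 0 := by positivity
  field_simp; ring

noncomputable def Jt (u : ℝ) : ℝ := ∫ v in Ioi u, 2 * RR v / v^3

lemma RRv3_bound (hRH : RiemannHypothesis) {u v : ℝ} (hu : 0 < u) (hv : u ≤ v) :
    ‖2 * RR v / v^3‖ ≤ 2*(1/4 + 2 * Phi0)/u^3 * Real.exp (-(1/2)*v) := by
  have h := RR_bound hRH (hu.le.trans hv)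
  have hv0 : 0 < v := by linarith
  rw [Real.norm_eq_abs, abs_div, abs_mul, abs_of_pos (show (0:ℝ) < 2 by norm_num), abs_of_pos (by positivity : 0 < v^3)]
  have e : -v/2 = -(1/2)*v := by ring
  rw [e] at h
  have h0 : 0 ≤ (1/4 + 2 * Phi0) * Real.exp (-(1/2)*v) := (abs_nonneg _).trans h
  calc _ ≤ 2 * ((1/4 + 2 * Phi0) * Real.exp (-(1/2)*v))/u^3 := by gcongr
    _ = _ := by ring

lemma RRv3_int (hRH : RiemannHypothesis) {u : ℝ} (hu : 0 < u) : IntegrableOn (fun v => 2 * RR v / v^3) (Ioi u) := by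
  have h1 : IntegrableOn (fun v : ℝ => 2*(1/4 + 2 * Phi0)/u^3 * Real.exp (-(1/2) * v)) (Ioi u) :=
    (integrableOn_exp_mul_Ioi (by norm_num) u).const_mul _
  refine Integrable.mono' h1 ?_ ?_
  · refine ContinuousOn.aestronglyMeasurable ?_ measurableSet_Ioi
    refine ContinuousOn.div (continuousOn_const.mul (RR_cont.mono fun v hv => ?_)) (by fun_prop) fun v hv => ?_
    · exact hu.le.trans (le_of_lt hv)
    · have : 0 < v := hu.trans hv
      positivity
  · exact (ae_restrict_mem measurableSet_Ioi).mono fun v hv => RRv3_bound hRH hu (le_of_lt hv)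

lemma Jt_bound (hRH : RiemannHypothesis) {u : ℝ} (hu : 0 < u) :
    |Jt u| ≤ 4*(1/4 + 2 * Phi0)/u^3 * Real.exp (-u/2) := by
  have h1 : IntegrableOn (fun v : ℝ => 2*(1/4 + 2 * Phi0)/u^3 * Real.exp (-(1/2) * v)) (Ioi u) :=
    (integrableOn_exp_mul_Ioi (by norm_num) u).const_mul _
  rw [← Real.norm_eq_abs]
  refine (norm_integral_le_of_norm_le h1 ((ae_restrict_mem measurableSet_Ioi).mono fun v hv => RRv3_bound hRH hu (le_of_lt hv))).trans ?_
  rw [integral_const_mul, integral_exp_mul_Ioi (by norm_num)]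
  apply le_of_eq
  rw [show -(1/2)*u = -u/2 by ring]
  ring

noncomputable def c0 : ℝ := 3/2 - (Real.log (Real.log 2) + 2 * Real.eulerMascheroniConstant / Real.log 2 - Kc / (Real.log 2)^2) + Jt (Real.log 2)

lemma MM_asymp (hRH : RiemannHypothesis) {u : ℝ} (hu : Real.log 2 ≤ u) :
    MM u = Real.log u + c0 + (AA u - u + Real.eulerMascheroniConstant)/u + RR u/u^2 - Jt u := by
  have h2 := log2_pos
  have hu0 : u ≠ 0 := by linarith
  have hcR : IntervalIntegrable (fun v => 2 * RR v / v^3) volume (Real.log 2) u := by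
    rw [intervalIntegrable_iff_integrableOn_Ioc_of_le hu]
    exact (RRv3_int hRH h2).mono_set Ioc_subset_Ioi_self
  have hJ : ∫ v in (Real.log 2)..u, 2 * RR v / v^3 = Jt (Real.log 2) - Jt u := by
    rw [intervalIntegral.integral_of_le hu]
    unfold Jt
    rw [← Ioc_union_Ioi_eq_Ioi hu, setIntegral_union (Set.Ioc_disjoint_Ioi le_rfl) measurableSet_Ioi
      ((RRv3_int hRH h2).mono_set Ioc_subset_Ioi_self) (RRv3_int hRH (h2.trans_le hu))]
    ring
  have hd : ∀ v ∈ uIcc (Real.log 2) u, HasDerivAt (fun v => Real.log v + 2*Real.eulerMascheroniConstant/v - Kc/v^2)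
      (1/v - 2*Real.eulerMascheroniConstant/v^2 + 2*Kc/v^3) v := by
    intro v hv
    rw [uIcc_of_le hu] at hv
    have hv0 : v ≠ 0 := by linarith [hv.1]
    have h := ((Real.hasDerivAt_log hv0).add ((hasDerivAt_const v (2*Real.eulerMascheroniConstant)).div (hasDerivAt_id v) hv0)).sub
      ((hasDerivAt_const v Kc).div ((hasDerivAt_id v).pow 2) (by simpa using hv0))
    refine h.congr_deriv ?_
    simp; field_simp; ring
  have hci : IntervalIntegrable (fun v => 1/v - 2*Real.eulerMascheroniConstant/v^2 + 2*Kc/v^3) volume (Real.log 2) u := by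
    refine ContinuousOn.intervalIntegrable ?_
    have hne : ∀ v ∈ uIcc (Real.log 2) u, v ≠ 0 := fun v hv => by
      rw [uIcc_of_le hu] at hv; linarith [hv.1]
    refine ContinuousOn.add (ContinuousOn.sub ?_ ?_) ?_
    · exact ContinuousOn.div (by fun_prop) (by fun_prop) hne
    · exact ContinuousOn.div (by fun_prop) (by fun_prop) fun v hv => pow_ne_zero _ (hne v hv)
    · exact ContinuousOn.div (by fun_prop) (by fun_prop) fun v hv => pow_ne_zero _ (hne v hv)
  have hI : ∫ v in (Real.log 2)..u, 2 * bb v / v^3 =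
      (Real.log u + 2*Real.eulerMascheroniConstant/u - Kc/u^2) -
      (Real.log (Real.log 2) + 2*Real.eulerMascheroniConstant/Real.log 2 - Kc/(Real.log 2)^2) + (Jt (Real.log 2) - Jt u) := by
    rw [← hJ, ← intervalIntegral.integral_eq_sub_of_hasDerivAt hd hci, ← intervalIntegral.integral_add hci hcR]
    refine intervalIntegral.integral_congr fun v hv => ?_
    rw [uIcc_of_le hu] at hv
    have hv0 : v ≠ 0 := by linarith [hv.1]
    simp only [RR]
    field_simp; ring
  rw [MM_eq hu, hI]
  have hb : bb u = u^2/2 - Real.eulerMascheroniConstant * u + Kc + RR u := by unfold RR; ring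
  rw [hb, c0]
  field_simp; ring
end MRH
end

section
open Complex Set Filter MeasureTheory Metric
open scoped Real Topology ArithmeticFunction.vonMangoldt

namespace MRH

lemma SS'_nonneg (hRH : RiemannHypothesis) {T : ℝ} (hT : 0 ≤ T) : 0 ≤ SS' T := by
  unfold SS'
  refine tsum_nonneg fun z => mul_nonneg (mm_nonneg z) ?_
  have := qq_ge hRH z
  exact le_min (by positivity) (div_nonneg hT (by linarith))

lemma E_crude (hRH : RiemannHypothesis) : ∃ K, 0 ≤ K ∧ ∀ u, Real.log 2 ≤ u → |AA u - u + Real.eulerMascheroniConstant| ≤ K := by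
  have h2 := log2_pos
  set h := Real.log 2
  have hS := SS'_nonneg hRH (T := 2/h) (by positivity)
  refine ⟨h/2 + 1/(4*h) + 2 * SS' (2/h), by positivity, fun u hu => ?_⟩
  have h0 : 0 < 1/(4*h) := by positivity
  have a1 := E_upper hRH (h2.le.trans hu) h2
  have a2 := E_lower hRH hu h2
  have e1 : Real.exp (-3*u)/(4*h) ≤ 1/(4*h) := by
    gcongr; exact Real.exp_le_one_iff.mpr (by linarith)
  have e2 : 2*Real.exp (-u/2)*SS' (2/h) ≤ 2 * SS' (2/h) := by
    have : Real.exp (-u/2) ≤ 1 := Real.exp_le_one_iff.mpr (by linarith)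
    nlinarith
  have e3 : 2*Real.exp (-(u-h)/2)*SS' (2/h) ≤ 2 * SS' (2/h) := by
    have : Real.exp (-(u-h)/2) ≤ 1 := Real.exp_le_one_iff.mpr (by linarith)
    nlinarith
  rw [abs_le]; constructor <;> linarith

lemma D_crude (hRH : RiemannHypothesis) : ∃ K, 0 ≤ K ∧ ∀ u, Real.log 2 ≤ u → |MM u - Real.log u - c0| ≤ K / u := by
  obtain ⟨K, hK, hE⟩ := E_crude hRH
  have h2 := log2_pos
  have hphi : 0 ≤ 1/4 + 2 * Phi0 := by
    have := (abs_nonneg _).trans (RR_bound hRH (le_refl (0:ℝ)))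
    simpa using this
  set c := 1/4 + 2 * Phi0
  refine ⟨K + c / Real.log 2 + 4 * c / (Real.log 2)^2, by positivity, fun u hu => ?_⟩
  have hu0 : 0 < u := by linarith
  have he : Real.exp (-u/2) ≤ 1 := Real.exp_le_one_iff.mpr (by linarith)
  have b1 := hE u hu
  have b2 := (RR_bound hRH hu0.le).trans (mul_le_of_le_one_right hphi he)
  have b3 := (Jt_bound hRH hu0).trans (mul_le_of_le_one_right (by positivity) he)
  have : MM u - Real.log u - c0 = (AA u - u + Real.eulerMascheroniConstant)/u + RR u/u^2 - Jt u := by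
    rw [MM_asymp hRH hu]; ring
  rw [this]
  calc _ ≤ |(AA u - u + Real.eulerMascheroniConstant)/u| + |RR u/u^2| + |Jt u| :=
        (abs_sub _ _).trans (by gcongr; exact abs_add_le _ _)
    _ ≤ K/u + c/u^2 + 4 * c/u^3 := by
        rw [abs_div, abs_div, abs_of_pos hu0, abs_of_pos (pow_pos hu0 2)]
        gcongr
    _ = (K + c/u + 4*c/u^2)/u := by field_simp
    _ ≤ _ := by gcongr

lemma MM_zero {u : ℝ} (hu : u < Real.log 2) : MM u = 0 := by
  unfold MM
  refine Finset.sum_eq_zero fun n hn => ?_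
  rcases lt_or_ge n 2 with h | h
  · interval_cases n <;> simp
  · exfalso
    rw [mem_range_exp (by omega)] at hn
    have : Real.log 2 ≤ Real.log n := Real.log_le_log (by norm_num) (by exact_mod_cast h)
    linarith

lemma log_exp_int : IntegrableOn (fun t : ℝ => Real.log t * Real.exp (-t)) (Ioi 0) ∧
    ∫ t in Ioi 0, Real.log t * Real.exp (-t) = -Real.eulerMascheroniConstant := by
  have key : MellinConvergent (fun t : ℝ => Real.log t • ((Real.exp (-t) : ℝ) : ℂ)) 1 := by
    refine (mellin_hasDerivAt_of_isBigO_rpow (E := ℂ) (a := (1:ℂ).re + 1) (b := 0) ?_ ?_ (lt_add_one _) ?_ (by simp)).1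
    · refine (Continuous.continuousOn ?_).locallyIntegrableOn measurableSet_Ioi
      exact continuous_ofReal.comp (Real.continuous_exp.comp continuous_neg)
    · rw [← Asymptotics.isBigO_norm_left]
      simp_rw [norm_real, Asymptotics.isBigO_norm_left]
      simpa only [neg_one_mul] using (isLittleO_exp_neg_mul_rpow_atTop zero_lt_one _).isBigO
    · simp_rw [neg_zero, Real.rpow_zero]
      refine Asymptotics.isBigO_const_of_tendsto (?_ : Tendsto _ _ (𝓝 (1 : ℂ))) one_ne_zero
      rw [(by simp : (1 : ℂ) = Real.exp (-0))]
      exact (continuous_ofReal.comp (Real.continuous_exp.comp continuous_neg)).continuousWithinAt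
  unfold MellinConvergent at key
  have hI : IntegrableOn (fun t : ℝ => ((Real.log t * Real.exp (-t) : ℝ) : ℂ)) (Ioi 0) := by
    refine key.congr_fun (fun t ht => ?_) measurableSet_Ioi
    simp
  refine ⟨by unfold IntegrableOn; simpa only [RCLike.re_to_complex, ofReal_re] using hI.re, ?_⟩
  have d1 := Complex.hasDerivAt_GammaIntegral (s := 1) (by simp)
  have d2 : HasDerivAt Complex.GammaIntegral (-Real.eulerMascheroniConstant : ℂ) 1 := by
    refine Complex.hasDerivAt_Gamma_one.congr_of_eventuallyEq ?_
    have : IsOpen {s : ℂ | 0 < s.re} := continuous_re.isOpen_preimage _ isOpen_Ioi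
    filter_upwards [this.mem_nhds (show (0:ℝ) < (1:ℂ).re by simp)] with a ha using (Complex.Gamma_eq_integral ha).symm
  have h := d1.unique d2
  have h' : ∫ t : ℝ in Ioi 0, ((Real.log t * Real.exp (-t) : ℝ) : ℂ) = ((-Real.eulerMascheroniConstant : ℝ):ℂ) := by
    push_cast
    rw [← h]
    refine setIntegral_congr_fun measurableSet_Ioi (fun t ht => ?_)
    simp
  rw [integral_complex_ofReal] at h'
  exact_mod_cast h'

lemma MM_mono : Monotone MM := by
  intro a b hab
  unfold MM
  refine Finset.sum_le_sum_of_subset_of_nonneg ?_ fun n _ _ => ?_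
  · refine Finset.range_mono ?_
    have := Nat.floor_mono (Real.exp_le_exp.mpr hab)
    omega
  · exact div_nonneg ArithmeticFunction.vonMangoldt_nonneg (mul_nonneg (by positivity) (Real.log_natCast_nonneg n))

noncomputable def an (n : ℕ) : ℝ := Λ n / (n * Real.log n)
lemma an_nonneg (n : ℕ) : 0 ≤ an n :=
  div_nonneg ArithmeticFunction.vonMangoldt_nonneg (mul_nonneg (by positivity) (Real.log_natCast_nonneg n))

lemma an_summable {s : ℝ} (hs : 0 < s) : Summable fun n : ℕ => an n * Real.exp (-(s * Real.log n)) := by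
  have h := (ArithmeticFunction.LSeriesSummable_vonMangoldt (s := (1 + s : ℝ)) (by simpa using hs)).norm
  refine Summable.of_nonneg_of_le (fun n => mul_nonneg (an_nonneg n) (Real.exp_pos _).le) (fun n => ?_) (h.mul_left (1/Real.log 2))
  rcases lt_or_ge n 2 with h2 | h2
  · have : an n = 0 := by unfold an; interval_cases n <;> simp
    rw [this, zero_mul]
    have := log2_pos
    positivity
  · have hn : (0:ℝ) < n := by positivity
    rw [LSeries.norm_term_eq, if_neg (by omega)]
    have hl : Real.log 2 ≤ Real.log n := Real.log_le_log (by norm_num) (by exact_mod_cast h2)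
    have := log2_pos
    have e : (n:ℝ)^(((1+s:ℝ):ℂ).re) = n * Real.exp (s * Real.log n) := by
      rw [ofReal_re, Real.rpow_add hn, Real.rpow_one, Real.rpow_def_of_pos hn, mul_comm s]
    rw [e, Complex.norm_real, Real.norm_of_nonneg ArithmeticFunction.vonMangoldt_nonneg]
    unfold an
    rw [Real.exp_neg]
    have hΛ : 0 ≤ Λ n := ArithmeticFunction.vonMangoldt_nonneg
    calc _ = 1/Real.log n * (Λ n / (n * Real.exp (s * Real.log n))) := by field_simp
      _ ≤ _ := by gcongr

lemma exp_ind {c : ℝ} (hc : 0 ≤ c) : IntegrableOn ((Ioi c).indicator fun w => Real.exp (-w)) (Ioi 0) ∧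
    ∫ w in Ioi 0, (Ioi c).indicator (fun w => Real.exp (-w)) w = Real.exp (-c) := by
  constructor
  · rw [IntegrableOn, integrable_indicator_iff measurableSet_Ioi]
    exact (integrableOn_exp_neg_Ioi c).mono_measure Measure.restrict_le_self
  · rw [setIntegral_indicator measurableSet_Ioi, Ioi_inter_Ioi, sup_of_le_right hc]
    exact integral_exp_neg_Ioi c

lemma zeta_int {s : ℝ} (hs : 0 < s) :
    Real.log (riemannZeta ((1+s : ℝ) : ℂ)).re = ∫ w in Ioi 0, Real.exp (-w) * MM (w/s) := by
  rw [log_riemannZeta_eq (by linarith)]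
  have h0 : ∀ n : ℕ, Λ n / (n ^ (1+s) * Real.log n) = an n * Real.exp (-(s * Real.log n)) := by
    intro n
    unfold an
    rcases Nat.eq_zero_or_pos n with h | h
    · simp [h]
    have hn : (0:ℝ) < n := by positivity
    rw [Real.rpow_add hn, Real.rpow_one, Real.rpow_def_of_pos hn, mul_comm s, Real.exp_neg]
    rcases eq_or_ne (Real.log n) 0 with hl | hl
    · simp [hl]
    field_simp
  rw [tsum_congr h0]
  have hln : ∀ n : ℕ, 0 ≤ s * Real.log n := fun n => mul_nonneg hs.le (Real.log_natCast_nonneg n)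
  have hi : ∀ n : ℕ, ∫ w in Ioi 0, an n * (Ioi (s * Real.log n)).indicator (fun w => Real.exp (-w)) w = an n * Real.exp (-(s * Real.log n)) := by
    intro n
    rw [integral_const_mul, (exp_ind (hln n)).2]
  have := hasSum_integral_of_summable_integral_norm (μ := volume.restrict (Ioi (0:ℝ))) (F := fun (n:ℕ) (w:ℝ) => an n * (Ioi (s * Real.log n)).indicator (fun w => Real.exp (-w)) w)
    (fun n => (exp_ind (hln n)).1.const_mul _) (by
      refine (an_summable hs).congr fun n => ?_
      rw [← hi n]
      refine integral_congr_ae (Eventually.of_forall fun w => ?_)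
      refine (Real.norm_of_nonneg (mul_nonneg (an_nonneg n) ?_)).symm
      exact indicator_nonneg (fun _ _ => (Real.exp_pos _).le) _)
  rw [← tsum_congr hi, this.tsum_eq]
  refine integral_congr_ae ?_
  -- exclude countably many w
  have hcount : ∀ᵐ w : ℝ ∂(volume.restrict (Ioi (0:ℝ))), w ∉ Set.range (fun n : ℕ => s * Real.log n) :=
    ae_restrict_of_ae ((Set.countable_range _).ae_notMem volume)
  filter_upwards [hcount] with w hw
  rw [tsum_eq_sum (s := Finset.range (⌊Real.exp (w/s)⌋₊ + 1))]
  · unfold MM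
    rw [Finset.mul_sum]
    refine Finset.sum_congr rfl fun n hn => ?_
    rcases Nat.eq_zero_or_pos n with h | h
    · simp [h, an]
    rw [mem_range_exp h.ne', le_div_iff₀ hs] at hn
    have hlt : s * Real.log n < w := lt_of_le_of_ne (by linarith) (fun e => hw ⟨n, e⟩)
    rw [indicator_of_mem (mem_Ioi.mpr hlt)]
    unfold an; ring
  · intro n hn
    rcases Nat.eq_zero_or_pos n with h | h
    · simp [h, an]
    rw [mem_range_exp h.ne', le_div_iff₀ hs] at hn
    rw [indicator_of_notMem, mul_zero]
    simp only [mem_Ioi]; linarith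

lemma c0_eq (hRH : RiemannHypothesis) : c0 = Real.eulerMascheroniConstant := by
  obtain ⟨K, hK, hD⟩ := D_crude hRH
  have h2 := log2_pos
  have hl1 : Real.log 2 < 1 := by linarith [Real.log_two_lt_d9]
  set D : ℝ → ℝ := fun u => MM u - Real.log u - c0 with hDdef
  have hmeas : Measurable D := (MM_mono.measurable.sub Real.measurable_log).sub_const _
  have hlim : Tendsto (fun s : ℝ => ∫ w in Ioi 0, Real.exp (-w) * D (w/s)) (𝓝[>] 0) (𝓝 (∫ w in Ioi (0:ℝ), (0:ℝ))) := by
    refine tendsto_integral_filter_of_dominated_convergence (fun w => (K/Real.log 2 + |c0|) * Real.exp (-w) + |Real.log w * Real.exp (-w)|) ?_ ?_ ?_ ?_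
    · refine Eventually.of_forall fun s => ?_
      exact ((by fun_prop : Measurable fun w : ℝ => Real.exp (-w)).mul (hmeas.comp (measurable_id.div_const s))).aestronglyMeasurable
    · have : ∀ᶠ s : ℝ in 𝓝[>] 0, s ∈ Ioo (0:ℝ) 1 := Ioo_mem_nhdsGT one_pos
      filter_upwards [this] with s hs
      refine (ae_restrict_iff' measurableSet_Ioi).mpr (Eventually.of_forall fun w hw => ?_)
      have hw : 0 < w := hw
      rw [norm_mul, Real.norm_of_nonneg (Real.exp_pos _).le, Real.norm_eq_abs, abs_mul, abs_of_pos (Real.exp_pos (-w)), mul_comm, ← add_mul]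
      refine mul_le_mul_of_nonneg_right ?_ (Real.exp_pos _).le
      have hws : 0 < w / s := div_pos hw hs.1
      rcases lt_or_ge (w/s) (Real.log 2) with h | h
      · simp only [hDdef, MM_zero h]
        have hw1 : w < 1 := by
          have := (div_lt_iff₀ hs.1).mp h
          nlinarith [hs.1, hs.2]
        have l1 : Real.log (w/s) ≤ 0 := Real.log_nonpos hws.le (by linarith)
        have l2 : Real.log w ≤ 0 := Real.log_nonpos hw.le hw1.le
        have l3 : Real.log (w/s) = Real.log w - Real.log s := Real.log_div hw.ne' hs.1.ne'
        have l4 : Real.log s ≤ 0 := Real.log_nonpos hs.1.le hs.2.le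
        have l5 : 0 ≤ K / Real.log 2 := by positivity
        rw [abs_of_nonpos l2]
        have := abs_sub (0 - Real.log (w/s)) c0
        rw [abs_of_nonneg (a := 0 - Real.log (w/s)) (by linarith)] at this
        linarith
      · have h1 := hD _ h
        have h3 : K/(w/s) ≤ K/Real.log 2 := by gcongr
        have := abs_nonneg (Real.log w)
        have := abs_nonneg c0
        simp only [hDdef]
        linarith
    · exact ((integrableOn_exp_neg_Ioi 0).const_mul _).add log_exp_int.1.abs
    · refine (ae_restrict_iff' measurableSet_Ioi).mpr (Eventually.of_forall fun w hw => ?_)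
      have hw : 0 < w := hw
      have hDt : Tendsto D atTop (𝓝 0) := by
        refine squeeze_zero_norm' (a := fun u => K/u) ?_ (tendsto_const_nhds.div_atTop tendsto_id)
        filter_upwards [eventually_ge_atTop (Real.log 2)] with u hu using hD u hu
      have hq : Tendsto (fun s : ℝ => w / s) (𝓝[>] 0) atTop := by
        simp_rw [div_eq_mul_inv]
        exact tendsto_inv_nhdsGT_zero.const_mul_atTop hw
      simpa using (hDt.comp hq).const_mul (Real.exp (-w))
  rw [integral_zero] at hlim
  have heq : ∀ s : ℝ, 0 < s → ∫ w in Ioi 0, Real.exp (-w) * D (w/s) =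
      Real.log (riemannZeta ((1+s : ℝ) : ℂ)).re + Real.log s + Real.eulerMascheroniConstant - c0 := by
    intro s hs
    have i1 : IntegrableOn (fun w : ℝ => Real.log w * Real.exp (-w)) (Ioi 0) := log_exp_int.1
    have i2 : IntegrableOn (fun w : ℝ => Real.exp (-w)) (Ioi 0) := integrableOn_exp_neg_Ioi 0
    have i3 : IntegrableOn (fun w : ℝ => Real.exp (-w) * MM (w/s)) (Ioi 0) := by
      have hg : IntegrableOn (fun w : ℝ => |Real.log w * Real.exp (-w)| + (|Real.log s| + |c0| + K/Real.log 2) * Real.exp (-w)) (Ioi 0) :=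
        i1.abs.add (i2.const_mul _)
      refine hg.mono' ?_ ?_
      · exact ((by fun_prop : Measurable fun w : ℝ => Real.exp (-w)).mul (MM_mono.measurable.comp (measurable_id.div_const s))).aestronglyMeasurable
      refine (ae_restrict_iff' measurableSet_Ioi).mpr (Eventually.of_forall fun w hw => ?_)
      have hw : 0 < w := hw
      have hws : 0 < w / s := div_pos hw hs
      rw [norm_mul, Real.norm_of_nonneg (Real.exp_pos _).le, Real.norm_eq_abs, abs_mul, abs_of_pos (Real.exp_pos (-w)), mul_comm, ← add_mul]
      refine mul_le_mul_of_nonneg_right ?_ (Real.exp_pos _).le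
      rcases lt_or_ge (w/s) (Real.log 2) with h | h
      · rw [MM_zero h, abs_zero]; positivity
      · have h1 := hD _ h
        have h3 : K/(w/s) ≤ K/Real.log 2 := by gcongr
        have l3 : Real.log (w/s) = Real.log w - Real.log s := Real.log_div hw.ne' hs.ne'
        rw [l3] at h1
        have e : MM (w/s) = (MM (w/s) - (Real.log w - Real.log s) - c0) + Real.log w - Real.log s + c0 := by ring
        rw [e]
        have := abs_add_le ((MM (w/s) - (Real.log w - Real.log s) - c0) + Real.log w - Real.log s) c0
        have := abs_sub ((MM (w/s) - (Real.log w - Real.log s) - c0) + Real.log w) (Real.log s)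
        have := abs_add_le ((MM (w/s) - (Real.log w - Real.log s) - c0)) (Real.log w)
        linarith
    have e1 : ∫ w in Ioi (0:ℝ), Real.exp (-w) = 1 := by simpa using integral_exp_neg_Ioi 0
    rw [zeta_int hs]
    have : ∫ w in Ioi 0, Real.exp (-w) * D (w/s) = ∫ w in Ioi 0, (Real.exp (-w) * MM (w/s) - Real.log w * Real.exp (-w) + (Real.log s - c0) * Real.exp (-w)) := by
      refine setIntegral_congr_fun measurableSet_Ioi (fun w hw => ?_)
      have hw : 0 < w := hw
      simp only [hDdef]
      rw [Real.log_div hw.ne' hs.ne']; ring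
    have e2 := log_exp_int.2
    rw [this, integral_add (f := fun w => Real.exp (-w) * MM (w/s) - Real.log w * Real.exp (-w)) (i3.sub i1) (i2.const_mul _), integral_sub i3 i1, integral_const_mul, e1, e2]
    ring
  have hz : Tendsto (fun s : ℝ => Real.log (riemannZeta ((1+s : ℝ) : ℂ)).re + Real.log s) (𝓝[>] 0) (𝓝 0) := by
    have := (Asymptotics.isLittleO_one_iff ℝ).mp log_riemannZeta_add_log_sub_isLittleO_ofReal
    have ht : Tendsto (fun s : ℝ => 1 + s) (𝓝[>] 0) (𝓝[>] 1) := by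
      refine tendsto_nhdsWithin_of_tendsto_nhds_of_eventually_within _ ?_ ?_
      · have : Tendsto (fun s : ℝ => 1 + s) (𝓝 0) (𝓝 (1+0)) := (continuous_const.add continuous_id).tendsto 0
        rw [add_zero] at this
        exact this.mono_left nhdsWithin_le_nhds
      · filter_upwards [self_mem_nhdsWithin] with s hs
        simpa using hs
    refine (this.comp ht).congr fun s => ?_
    simp
  have h3 : Tendsto (fun s : ℝ => ∫ w in Ioi 0, Real.exp (-w) * D (w/s)) (𝓝[>] 0) (𝓝 (0 + Real.eulerMascheroniConstant - c0)) := by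
    refine ((hz.add_const _).sub_const _).congr' ?_
    filter_upwards [self_mem_nhdsWithin] with s hs
    exact (heq s hs).symm
  have := tendsto_nhds_unique hlim h3
  linarith

end MRH
end

section
open Complex Set Filter MeasureTheory Metric
open scoped Real Topology ArithmeticFunction.vonMangoldt

namespace MRH

lemma log_tail {p : ℝ} (hp : 2 ≤ p) (K : ℕ) :
    0 ≤ Real.log ((1 - 1/p)⁻¹) - ∑ k ∈ Finset.Icc 1 K, 1/(k * p^k) ∧
    Real.log ((1 - 1/p)⁻¹) - ∑ k ∈ Finset.Icc 1 K, 1/(k * p^k) ≤ 1/((K+1) * p^K * (p-1)) := by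
  have hp0 : 0 < p := by linarith
  have hx : |1/p| < 1 := by
    rw [abs_of_pos (by positivity), div_lt_one hp0]; linarith
  have hs := Real.hasSum_pow_div_log_of_abs_lt_one hx
  have e0 : ∑ k ∈ Finset.Icc 1 K, 1/(k * p^k) = ∑ k ∈ Finset.range K, (1/p)^(k+1)/((k:ℝ)+1) := by
    induction K with
    | zero => simp
    | succ K ih =>
      rw [Finset.sum_Icc_succ_top (by omega), ih, Finset.sum_range_succ]
      push_cast
      rw [one_div_pow]
      field_simp
  have hs2 := (hasSum_nat_add_iff' K).mpr hs
  rw [Real.log_inv, e0]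
  have hg : HasSum (fun n : ℕ => (1/p)^(K+1)/((K:ℝ)+1) * (1/p)^n) ((1/p)^(K+1)/((K:ℝ)+1) * (1 - 1/p)⁻¹) :=
    (hasSum_geometric_of_abs_lt_one hx).mul_left _
  constructor
  · exact hs2.nonneg fun n => by positivity
  · refine (hasSum_le (fun n => ?_) hs2 hg).trans_eq ?_
    · push_cast
      rw [show (1/p)^(n+K+1) / ((n:ℝ)+K+1) = ((1/p)^(K+1) * (1/p)^n) / ((n:ℝ)+K+1) by ring_nf, div_mul_eq_mul_div]
      gcongr
      linarith [(Nat.cast_nonneg n : (0:ℝ) ≤ n)]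
    · have : p - 1 ≠ 0 := by linarith
      have : (1 - 1/p)⁻¹ = p/(p-1) := by rw [show 1 - 1/p = (p-1)/p by field_simp, inv_div]
      rw [this, one_div_pow]
      field_simp
      ring

lemma MM_primes {u : ℝ} : MM u = ∑ p ∈ (Finset.range (⌊Real.exp u⌋₊ + 1)).filter Nat.Prime,
    ∑ k ∈ Finset.Icc 1 (Nat.log p ⌊Real.exp u⌋₊), 1/(k * (p:ℝ)^k) := by
  unfold MM
  set N := ⌊Real.exp u⌋₊
  rw [Finset.sum_sigma']
  symm
  have : ∑ n ∈ Finset.range (N+1), Λ n / (n * Real.log n) = ∑ n ∈ (Finset.range (N+1)).filter IsPrimePow, Λ n / (n * Real.log n) := by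
    rw [Finset.sum_filter]
    refine Finset.sum_congr rfl fun n hn => ?_
    split_ifs with h
    · rfl
    · rw [ArithmeticFunction.vonMangoldt_eq_zero_iff.mpr h, zero_div]
  rw [this]
  refine Finset.sum_bij (fun a _ => a.1 ^ a.2) ?_ ?_ ?_ ?_
  · rintro ⟨p, k⟩ h
    simp only [Finset.mem_sigma, Finset.mem_filter, Finset.mem_range, Finset.mem_Icc] at h ⊢
    obtain ⟨⟨h1, h2⟩, h3, h4⟩ := h
    refine ⟨?_, h2.isPrimePow.pow (by omega)⟩
    have hN : N ≠ 0 := by have := h2.two_le; omega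
    have := Nat.pow_le_of_le_log hN h4
    omega
  · rintro ⟨p, k⟩ h ⟨p', k'⟩ h' e
    simp only [Finset.mem_sigma, Finset.mem_filter, Finset.mem_range, Finset.mem_Icc] at h h' e
    obtain ⟨e1, e2⟩ := h.1.2.pow_inj' h'.1.2 (by omega) (by omega) e
    subst e1; subst e2; rfl
  · intro n hn
    simp only [Finset.mem_filter, Finset.mem_range] at hn
    obtain ⟨p, k, hp, hk, rfl⟩ := (isPrimePow_nat_iff _).mp hn.2
    refine ⟨⟨p, k⟩, ?_, rfl⟩
    simp only [Finset.mem_sigma, Finset.mem_filter, Finset.mem_range, Finset.mem_Icc]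
    have h1 : p ≤ p^k := Nat.le_self_pow hk.ne' p
    have hN : N ≠ 0 := by have := hp.two_le; omega
    exact ⟨⟨by omega, hp⟩, hk, Nat.le_log_of_pow_le hp.one_lt (by omega)⟩
  · rintro ⟨p, k⟩ h
    simp only [Finset.mem_sigma, Finset.mem_filter, Finset.mem_range, Finset.mem_Icc] at h
    simp only
    rw [ArithmeticFunction.vonMangoldt_apply_pow (by omega), ArithmeticFunction.vonMangoldt_apply_prime h.1.2]
    push_cast
    rw [Real.log_pow]
    have : 0 < Real.log p := Real.log_pos (by exact_mod_cast h.1.2.one_lt)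
    have : (0:ℝ) < k := by exact_mod_cast h.2.1
    have : (0:ℝ) < p := by exact_mod_cast h.1.2.pos
    field_simp

lemma tele (j0 J : ℕ) (h0 : 1 ≤ j0) : ∑ j ∈ Finset.Ico j0 J, 1/(2*(2*(j:ℝ)+1)*(2*j)) ≤ 1/4 * (1/(2*j0 - 1/2)) := by
  rcases le_or_gt j0 J with hJ | hJ
  · have : ∑ j ∈ Finset.Ico j0 J, 1/(2*(2*(j:ℝ)+1)*(2*j)) ≤ 1/4 * (1/(2*j0 - 1/2) - 1/(2*J-1/2)) := by
      induction J, hJ using Nat.le_induction with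
      | base => simp
      | succ J hJ ih =>
        rw [Finset.sum_Ico_succ_top hJ]
        have hj : (1:ℝ) ≤ J := by exact_mod_cast h0.trans hJ
        have : 1/(2*(2*(J:ℝ)+1)*(2*J)) ≤ 1/4 * (1/(2*J-1/2) - 1/(2*((J+1:ℕ):ℝ)-1/2)) := by
          push_cast
          have a1 : (0:ℝ) < 2*J - 1/2 := by linarith
          have a2 : (0:ℝ) < 2*(J+1) - 1/2 := by linarith
          rw [div_sub_div _ _ a1.ne' a2.ne', ← mul_div_mul_comm, div_le_div_iff₀ (by positivity) (by positivity)]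
          nlinarith
        linarith
    refine this.trans ?_
    have : (1:ℝ) ≤ J := by exact_mod_cast h0.trans hJ
    have : (0:ℝ) ≤ 1/(2*J-1/2) := by apply div_nonneg <;> linarith
    linarith
  · rw [Finset.Ico_eq_empty (by omega), Finset.sum_empty]
    have : (1:ℝ) ≤ j0 := by exact_mod_cast h0
    have : (0:ℝ) ≤ 1/(2*j0-1/2) := by apply div_nonneg <;> linarith
    linarith

lemma count_small (s : ℕ) (hs : 2 ≤ s) : (((Finset.range (s+1)).filter Nat.Prime).card : ℝ) ≤ (s+1)/2 := by
  have : (Finset.range (s+1)).filter Nat.Prime ⊆ insert 2 ((Finset.Ico 1 ((s+1)/2)).image (fun j => 2*j+1)) := by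
    intro p hp
    simp only [Finset.mem_filter, Finset.mem_range] at hp
    rw [Finset.mem_insert, Finset.mem_image]
    rcases hp.2.eq_two_or_odd with h | h
    · exact Or.inl h
    · refine Or.inr ⟨p/2, ?_, by omega⟩
      have := hp.2.two_le
      rw [Finset.mem_Ico]; omega
  have h1 := (Finset.card_le_card this).trans ((Finset.card_insert_le _ _).trans (Nat.add_le_add_right Finset.card_image_le 1))
  rw [Nat.card_Ico] at h1
  have h2 : 2 * ((Finset.range (s+1)).filter Nat.Prime).card ≤ s+1 := by omega
  have : (2:ℝ) * (((Finset.range (s+1)).filter Nat.Prime).card : ℝ) ≤ s+1 := by exact_mod_cast h2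
  linarith

lemma P_tail {u : ℝ} (hu : 5 ≤ u) :
    0 ≤ Real.log (∏ p ∈ (Finset.range (⌊Real.exp u⌋₊ + 1)).filter Nat.Prime, (1 - 1/(p:ℝ))⁻¹) - MM u ∧
    Real.log (∏ p ∈ (Finset.range (⌊Real.exp u⌋₊ + 1)).filter Nat.Prime, (1 - 1/(p:ℝ))⁻¹) - MM u ≤
      1/4 * (1/(Real.exp (u/2) - 3/2)) + (3/4 * Real.exp (u/2) + 5/4)/(3 * Real.exp u) := by
  have hpp : ∀ p ∈ (Finset.range (⌊Real.exp u⌋₊ + 1)).filter Nat.Prime, (2:ℝ) ≤ p := by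
    intro p hp
    simp only [Finset.mem_filter] at hp
    exact_mod_cast hp.2.two_le
  rw [Real.log_prod (fun p hp => by
    have := hpp p hp
    have : 1/(p:ℝ) < 1 := by rw [div_lt_one (by linarith)]; linarith
    exact inv_ne_zero (by linarith)), MM_primes, ← Finset.sum_sub_distrib]
  refine ⟨Finset.sum_nonneg fun p hp => (log_tail (hpp p hp) _).1, ?_⟩
  set N := ⌊Real.exp u⌋₊ with hN
  set s := Nat.sqrt N with hs
  have hE : Real.exp (u/2)^2 = Real.exp u := by rw [← Real.exp_nat_mul]; congr 1; push_cast; ring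
  have hxN : Real.exp u < N + 1 := Nat.lt_floor_add_one _
  have hNx : (N:ℝ) ≤ Real.exp u := Nat.floor_le (Real.exp_pos _).le
  have he3 : (6:ℝ) ≤ Real.exp u := by linarith [Real.add_one_le_exp u]
  have he4 : (3.5:ℝ) ≤ Real.exp (u/2) := by linarith [Real.add_one_le_exp (u/2)]
  have hsl : Real.exp (u/2) < s + 1 := by
    have h1 : N + 1 ≤ (s+1)*(s+1) := Nat.succ_le_of_lt (Nat.lt_succ_sqrt N)
    have h2 : ((N:ℝ)+1) ≤ (s+1)*(s+1) := by exact_mod_cast h1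
    have hs0 : (0:ℝ) ≤ s := by positivity
    nlinarith
  have hsu : (s:ℝ) ≤ Real.exp (u/2) := by
    have h1 : s * s ≤ N := Nat.sqrt_le N
    have h2 : (s:ℝ)*s ≤ N := by exact_mod_cast h1
    by_contra h
    push Not at h
    nlinarith
  have hs2 : 2 ≤ s := by
    have : (2:ℝ) < s + 1 := by linarith
    have : 2 < s + 1 := by exact_mod_cast this
    omega
  have hsN : s ≤ N := Nat.sqrt_le_self N
  have hsplit : (Finset.range (N+1)).filter Nat.Prime = (Finset.range (s+1)).filter Nat.Prime ∪ (Finset.Ico (s+1) (N+1)).filter Nat.Prime := by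
    rw [← Finset.filter_union, Finset.range_eq_Ico, Finset.range_eq_Ico, Finset.Ico_union_Ico_eq_Ico (by omega) (by omega)]
  rw [hsplit, Finset.sum_union, add_comm]
  swap
  · refine Finset.disjoint_filter_filter ?_
    rw [Finset.range_eq_Ico]
    exact Finset.Ico_disjoint_Ico_consecutive _ _ _
  refine add_le_add ?_ ?_
  · have hb : ∀ p ∈ (Finset.Ico (s+1) (N+1)).filter Nat.Prime, Real.log ((1 - 1/(p:ℝ))⁻¹) - ∑ k ∈ Finset.Icc 1 (Nat.log p N), 1/(k * (p:ℝ)^k) ≤ 1/(2*(p:ℝ)*(p-1)) := by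
      intro p hp
      simp only [Finset.mem_filter, Finset.mem_Ico] at hp
      have h2 : (2:ℝ) ≤ p := by exact_mod_cast hp.2.two_le
      have hk : Nat.log p N = 1 := by
        rw [Nat.log_eq_one_iff]
        refine ⟨?_, hp.2.one_lt, by omega⟩
        exact Nat.sqrt_lt.mp (by omega)
      refine (log_tail h2 _).2.trans_eq ?_
      rw [hk]; norm_num
    refine (Finset.sum_le_sum hb).trans ?_
    have hsub : (Finset.Ico (s+1) (N+1)).filter Nat.Prime ⊆ (Finset.Ico ((s+1)/2) (N+1)).image (fun j => 2*j+1) := by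
      intro p hp
      simp only [Finset.mem_filter, Finset.mem_Ico] at hp
      rw [Finset.mem_image]
      have := hp.2.eq_two_or_odd
      refine ⟨p/2, ?_, by omega⟩
      rw [Finset.mem_Ico]; omega
    have hj0 : 1 ≤ (s+1)/2 := by omega
    calc _ ≤ ∑ p ∈ (Finset.Ico ((s+1)/2) (N+1)).image (fun j : ℕ => (2*j+1 : ℕ)), 1/(2*((p:ℕ):ℝ)*((p:ℕ)-1)) := by
          refine Finset.sum_le_sum_of_subset_of_nonneg hsub fun p hp _ => ?_
          rw [Finset.mem_image] at hp
          obtain ⟨j, hj, rfl⟩ := hp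
          push_cast
          rw [add_sub_cancel_right]
          positivity
      _ = ∑ j ∈ Finset.Ico ((s+1)/2) (N+1), 1/(2*(2*(j:ℝ)+1)*(2*j)) := by
          rw [Finset.sum_image (by intro a _ b _ h; simp only at h; omega)]
          refine Finset.sum_congr rfl fun j _ => ?_
          push_cast
          rw [add_sub_cancel_right]
      _ ≤ _ := tele _ _ hj0
      _ ≤ _ := by
          have : s ≤ 2 * ((s+1)/2) := by omega
          have : (s:ℝ) ≤ 2 * (((s+1)/2 : ℕ):ℝ) := by exact_mod_cast this
          refine mul_le_mul_of_nonneg_left ?_ (by norm_num)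
          exact one_div_le_one_div_of_le (by linarith) (by linarith)
  · have hb : ∀ p ∈ (Finset.range (s+1)).filter Nat.Prime, Real.log ((1 - 1/(p:ℝ))⁻¹) - ∑ k ∈ Finset.Icc 1 (Nat.log p N), 1/(k * (p:ℝ)^k) ≤ (3/2 + (if p = 2 then 1/2 else 0))/(3*Real.exp u) := by
      intro p hp
      simp only [Finset.mem_filter, Finset.mem_range] at hp
      have h2 : (2:ℝ) ≤ p := by exact_mod_cast hp.2.two_le
      have hpp : p ^ 2 ≤ N := by
        have := Nat.sqrt_le N
        rw [← hs] at this
        nlinarith [hp.1]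
      have hk : 2 ≤ Nat.log p N := Nat.le_log_of_pow_le hp.2.one_lt hpp
      have hk2 : (2:ℝ) ≤ (Nat.log p N : ℕ) := by exact_mod_cast hk
      refine (log_tail h2 _).2.trans ?_
      have h3 : N + 1 ≤ p^(Nat.log p N + 1) := Nat.lt_pow_succ_log_self hp.2.one_lt N
      have h4 : (N:ℝ)+1 ≤ (p:ℝ)^(Nat.log p N + 1) := by exact_mod_cast h3
      have h5 : (p:ℝ)/(p-1) ≤ 3/2 + (if p = 2 then 1/2 else 0) := by
        rw [div_le_iff₀ (by linarith)]
        split_ifs with h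
        · rw [h]; norm_num
        · have : 3 ≤ p := by have := hp.2.two_le; omega
          have : (3:ℝ) ≤ p := by exact_mod_cast this
          linarith
      have h6 : 0 < (p:ℝ) - 1 := by linarith
      calc _ = ((p:ℝ)/(p-1)) / ((((Nat.log p N : ℕ):ℝ)+1) * (p:ℝ)^(Nat.log p N + 1)) := by
            rw [pow_succ]; field_simp
        _ ≤ _ := by
            have h7 : 3 * Real.exp u ≤ (((Nat.log p N : ℕ):ℝ)+1) * (p:ℝ)^(Nat.log p N + 1) :=
              mul_le_mul (by linarith) (by linarith) (Real.exp_pos _).le (by linarith)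
            have h8 : 0 ≤ (p:ℝ)/(p-1) := by positivity
            exact div_le_div₀ (h8.trans h5) h5 (by positivity) h7
    refine (Finset.sum_le_sum hb).trans ?_
    rw [← Finset.sum_div, Finset.sum_add_distrib, Finset.sum_const, nsmul_eq_mul, Finset.sum_ite_eq' ]
    have := count_small s hs2
    refine div_le_div_of_nonneg_right ?_ (by positivity)
    split_ifs <;> linarith

end MRH
end

section
open Filter
open scoped Real Topology
namespace MRH

lemma log_le_sinh {r : ℝ} (hr : 1 ≤ r) : Real.log r ≤ (r - r⁻¹)/2 := by
  rw [← Real.sinh_log (by linarith)]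
  exact Real.self_le_sinh_iff.mpr (Real.log_nonneg hr)

lemma log_ge_frac {r : ℝ} (hr : 1 ≤ r) : 2*(r-1)/(r+1) ≤ Real.log r := by
  have := Real.le_log_one_add_of_nonneg (x := r - 1) (by linarith)
  rw [show 1 + (r-1) = r by ring, show r - 1 + 2 = r + 1 by ring] at this
  exact this

lemma gamma_ge (n : ℕ) (hn : 1 ≤ n) : (harmonic n : ℝ) - Real.log n - 1/(2*n) ≤ Real.eulerMascheroniConstant := by
  have hm : Monotone (fun k : ℕ => (harmonic (n+k) : ℝ) - Real.log ((n+k:ℕ):ℝ) - 1/(2*((n+k:ℕ):ℝ))) := by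
    refine monotone_nat_of_le_succ fun k => ?_
    have hk : (1:ℝ) ≤ ((n+k:ℕ):ℝ) := by exact_mod_cast (by omega : 1 ≤ n+k)
    rw [← add_assoc, harmonic_succ]
    push_cast at *
    set m : ℝ := (n:ℝ) + k
    have := log_le_sinh (r := (m+1)/m) (by rw [le_div_iff₀ (by linarith)]; linarith)
    rw [Real.log_div (by linarith) (by linarith), inv_div] at this
    have e : ((m+1)/m - m/(m+1))/2 = 1/(2*m) - 1/(2*(m+1)) + (m+1)⁻¹ := by field_simp; ring
    rw [e] at this
    linarith
  have ht : Tendsto (fun k : ℕ => (harmonic (n+k) : ℝ) - Real.log ((n+k:ℕ):ℝ) - 1/(2*((n+k:ℕ):ℝ))) atTop (𝓝 (Real.eulerMascheroniConstant - 0)) := by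
    have h1 : Tendsto (fun k : ℕ => (harmonic k : ℝ) - Real.log k - 1/(2*(k:ℝ))) atTop (𝓝 (Real.eulerMascheroniConstant - 0)) := by
      refine Real.tendsto_harmonic_sub_log.sub ?_
      exact tendsto_const_nhds.div_atTop (tendsto_natCast_atTop_atTop.const_mul_atTop (by norm_num))
    exact h1.comp (tendsto_add_atTop_nat n |>.congr fun k => by ring)
  have := hm.ge_of_tendsto ht 0
  simpa using this

lemma gamma_le (n : ℕ) : Real.eulerMascheroniConstant ≤ (harmonic n : ℝ) - Real.log (n + 1/2) := by
  have hm : Antitone (fun k : ℕ => (harmonic (n+k) : ℝ) - Real.log ((n+k:ℕ) + 1/2)) := by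
    refine antitone_nat_of_succ_le fun k => ?_
    rw [← add_assoc, harmonic_succ]
    have hk : (0:ℝ) ≤ ((n+k:ℕ):ℝ) := by positivity
    push_cast at *
    set m : ℝ := (n:ℝ) + k
    have := log_ge_frac (r := (m+1+1/2)/(m+1/2)) (by rw [le_div_iff₀ (by linarith)]; linarith)
    rw [Real.log_div (by linarith) (by linarith)] at this
    have e : 2*((m+1+1/2)/(m+1/2) - 1)/((m+1+1/2)/(m+1/2) + 1) = (m+1)⁻¹ := by field_simp; ring
    rw [e] at this
    linarith
  have ht : Tendsto (fun k : ℕ => (harmonic (n+k) : ℝ) - Real.log ((n+k:ℕ) + 1/2)) atTop (𝓝 (Real.eulerMascheroniConstant - 0)) := by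
    have h1 : Tendsto (fun k : ℕ => ((harmonic k : ℝ) - Real.log k) - (Real.log (k + 1/2) - Real.log k)) atTop (𝓝 (Real.eulerMascheroniConstant - 0)) := by
      refine Real.tendsto_harmonic_sub_log.sub ?_
      have h2 : Tendsto (fun k : ℕ => Real.log (1 + (1/2)/(k:ℝ))) atTop (𝓝 (Real.log (1 + 0))) := by
        refine (Real.continuousAt_log (by norm_num)).tendsto.comp (tendsto_const_nhds.add ?_)
        exact tendsto_const_nhds.div_atTop tendsto_natCast_atTop_atTop
      rw [add_zero, Real.log_one] at h2
      refine h2.congr' ?_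
      filter_upwards [eventually_ge_atTop 1] with k hk
      have : (1:ℝ) ≤ k := by exact_mod_cast hk
      rw [← Real.log_div (by linarith) (by linarith)]
      congr 1; field_simp
    have h3 := h1.comp (tendsto_add_atTop_nat n |>.congr fun k => (by ring : k + n = n + k))
    refine h3.congr fun k => ?_
    simp only [Function.comp]; ring
  have := hm.le_of_tendsto ht 0
  simpa using this

lemma harm_bd : (543314/100000 : ℚ) ≤ harmonic 128 ∧ harmonic 128 ≤ 543315/100000 := by
  decide +kernel

lemma gamma_lo : 0.5772 ≤ Real.eulerMascheroniConstant := by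
  have h := gamma_ge 128 (by norm_num)
  have h1 : (543314/100000:ℝ) ≤ (harmonic 128 : ℝ) := by
    have := (Rat.cast_le (K := ℝ)).mpr harm_bd.1
    rwa [show ((543314/100000 : ℚ):ℝ) = 543314/100000 by norm_num] at this
  have h2 : Real.log ((128:ℕ):ℝ) = 7 * Real.log 2 := by
    rw [show ((128:ℕ):ℝ) = 2^7 by norm_num, Real.log_pow]; norm_num
  rw [h2] at h
  have := Real.log_two_lt_d9
  norm_num at h ⊢
  linarith

lemma gamma_hi : Real.eulerMascheroniConstant ≤ 0.57724 := by
  have h := gamma_le 128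
  have h1 : (harmonic 128 : ℝ) ≤ 543315/100000 := by
    have := (Rat.cast_le (K := ℝ)).mpr harm_bd.2
    rwa [show ((543315/100000 : ℚ):ℝ) = 543315/100000 by norm_num] at this
  have h2 : Real.log ((128:ℕ) + 1/2 : ℝ) = 7 * Real.log 2 + Real.log (1 + 1/256) := by
    rw [show ((128:ℕ) + 1/2 : ℝ) = 2^7 * (1 + 1/256) by norm_num, Real.log_mul (by norm_num) (by norm_num), Real.log_pow]; norm_num
  have h3 := log_ge_frac (r := 1 + 1/256) (by norm_num)
  rw [h2] at h
  have := Real.log_two_gt_d9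
  norm_num at h h3 ⊢
  linarith

lemma exp_lo {x : ℝ} (hx : 0 ≤ x) (n : ℕ) : ∑ i ∈ Finset.range n, x^i/(i.factorial) ≤ Real.exp x :=
  Real.sum_le_exp_of_nonneg hx n

lemma exp_hi {x : ℝ} (hx : 0 ≤ x) (h1 : x ≤ 1) : Real.exp x ≤ ∑ m ∈ Finset.range 9, x^m/(m.factorial) + x^9 * (9+1)/(362880 * 9) := by
  have := Real.exp_bound' hx h1 (n := 9) (by norm_num)
  norm_num [Nat.factorial] at this ⊢
  linarith

lemma g_hi : Real.exp (-Real.eulerMascheroniConstant) ≤ 0.5614764 := by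
  have h := exp_lo (x := 0.5772) (by norm_num) 9
  have h2 : Real.exp 0.5772 ≤ Real.exp Real.eulerMascheroniConstant := Real.exp_le_exp.mpr gamma_lo
  rw [Real.exp_neg, inv_le_comm₀ (Real.exp_pos _) (by norm_num)]
  refine le_trans ?_ (h.trans h2)
  norm_num [Finset.sum_range_succ, Nat.factorial]

lemma g_lo : 0.561437 ≤ Real.exp (-Real.eulerMascheroniConstant) := by
  have h := exp_hi (x := 0.57724) (by norm_num) (by norm_num)
  have h2 : Real.exp Real.eulerMascheroniConstant ≤ Real.exp 0.57724 := Real.exp_le_exp.mpr gamma_hi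
  rw [Real.exp_neg, le_inv_comm₀ (by norm_num) (Real.exp_pos _)]
  refine (h2.trans h).trans ?_
  norm_num [Finset.sum_range_succ, Nat.factorial]

lemma log25_lo : 3.2188748 ≤ Real.log 25 := by
  rw [Real.le_log_iff_exp_le (by norm_num)]
  have h := exp_hi (x := 0.2188748) (by norm_num) (by norm_num)
  have e : Real.exp 3.2188748 = (Real.exp 1)^3 * Real.exp 0.2188748 := by
    rw [← Real.exp_nat_mul, ← Real.exp_add]; norm_num
  rw [e]
  have h1 := Real.exp_one_lt_d9
  calc _ ≤ (2.7182818286:ℝ)^3 * (∑ m ∈ Finset.range 9, (0.2188748:ℝ)^m/(m.factorial) + (0.2188748:ℝ)^9 * (9+1)/(362880 * 9)) := by gcongr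
    _ ≤ _ := by norm_num [Finset.sum_range_succ, Nat.factorial]

lemma log25_hi : Real.log 25 ≤ 3.2188768 := by
  rw [Real.log_le_iff_le_exp (by norm_num)]
  have h := exp_lo (x := 0.2188768) (by norm_num) 9
  have e : Real.exp 3.2188768 = (Real.exp 1)^3 * Real.exp 0.2188768 := by
    rw [← Real.exp_nat_mul, ← Real.exp_add]; norm_num
  rw [e]
  have h1 := Real.exp_one_gt_d9
  calc _ ≤ (2.7182818283:ℝ)^3 * ∑ i ∈ Finset.range 9, (0.2188768:ℝ)^i/(i.factorial) := by norm_num [Finset.sum_range_succ, Nat.factorial]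
    _ ≤ _ := by gcongr

lemma log242_lo : 3.186351 ≤ Real.log 24.2 := by
  rw [Real.le_log_iff_exp_le (by norm_num)]
  have h := exp_hi (x := 0.186351) (by norm_num) (by norm_num)
  have e : Real.exp 3.186351 = (Real.exp 1)^3 * Real.exp 0.186351 := by
    rw [← Real.exp_nat_mul, ← Real.exp_add]; norm_num
  rw [e]
  have h1 := Real.exp_one_lt_d9
  calc _ ≤ (2.7182818286:ℝ)^3 * (∑ m ∈ Finset.range 9, (0.186351:ℝ)^m/(m.factorial) + (0.186351:ℝ)^9 * (9+1)/(362880 * 9)) := by gcongr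
    _ ≤ _ := by norm_num [Finset.sum_range_succ, Nat.factorial]

end MRH
end

section
open scoped Real
namespace MRH

noncomputable def PP (a : ℕ) : ℝ := ∏ p ∈ (Finset.range a).filter Nat.Prime, (1 - 1/(p:ℝ))⁻¹

def GG (x : ℝ) : Prop := |Real.exp (-Real.eulerMascheroniConstant) / Real.log x * PP (⌊x⌋₊ + 1) - 1| ≤ 3 * Real.log x / (8 * π * Real.sqrt x)

lemma GG_of {x : ℝ} (hx : 1 < x)
    (hU : Real.exp (-Real.eulerMascheroniConstant) * PP (⌊x⌋₊ + 1) ≤ Real.log x + 0.11936 * (Real.log x)^2/√x)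
    (hW : Real.log x - 0.11936 * (Real.log x)^2/√x ≤ Real.exp (-Real.eulerMascheroniConstant) * PP (⌊x⌋₊ + 1)) : GG x := by
  have hL : 0 < Real.log x := Real.log_pos hx
  have hs : 0 < √x := Real.sqrt_pos.mpr (by linarith)
  unfold GG
  set y := Real.exp (-Real.eulerMascheroniConstant) * PP (⌊x⌋₊ + 1) with hy
  have e : Real.exp (-Real.eulerMascheroniConstant) / Real.log x * PP (⌊x⌋₊ + 1) - 1 = (y - Real.log x)/Real.log x := by
    rw [hy]; field_simp
  rw [e, abs_div, abs_of_pos hL, div_le_iff₀ hL]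
  have h1 : |y - Real.log x| ≤ 0.11936 * (Real.log x)^2/√x := abs_le.mpr ⟨by linarith, by linarith⟩
  refine h1.trans ?_
  have hc : 0.11936 ≤ 3/(8*π) := by
    rw [le_div_iff₀ (by positivity)]
    have := Real.pi_lt_d6
    linarith
  calc _ ≤ 3/(8*π) * (Real.log x)^2/√x := by gcongr
    _ = _ := by field_simp

lemma PP_mono {a b : ℕ} (h : a ≤ b) : PP a ≤ PP b := by
  unfold PP
  refine Finset.prod_le_prod_of_subset_of_one_le (Finset.filter_subset_filter _ (Finset.range_mono h)) (fun p hp => ?_) (fun p hp _ => ?_)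
  all_goals
    simp only [Finset.mem_filter] at hp
    have h2 : (2:ℝ) ≤ p := by exact_mod_cast hp.2.two_le
    have h3 : 1/(p:ℝ) < 1 := by rw [div_lt_one (by linarith)]; linarith
    have h4 : 0 < 1/(p:ℝ) := by positivity
  · exact inv_nonneg.mpr (by linarith)
  · exact (one_le_inv₀ (by linarith)).mpr (by linarith)

lemma blk {x La Lh r q : ℝ} (hx : 1 < x) (hr : √x ≤ r) (hLa : La ≤ Real.log x) (hLa0 : 0 ≤ La) (hLh : Real.log x ≤ Lh)
    (hq : q ≤ 0.11936 * La^2/r)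
    (hU : Real.exp (-Real.eulerMascheroniConstant) * PP (⌊x⌋₊ + 1) ≤ La + q)
    (hW : Lh ≤ Real.exp (-Real.eulerMascheroniConstant) * PP (⌊x⌋₊ + 1) + q) : GG x := by
  have hs : 0 < √x := Real.sqrt_pos.mpr (by linarith)
  have : 0.11936 * La^2/r ≤ 0.11936 * (Real.log x)^2/√x := by gcongr
  exact GG_of hx (by linarith) (by linarith)

lemma PP25 : PP 25 = 676039/110592 := by
  unfold PP
  have : (Finset.range 25).filter Nat.Prime = {2,3,5,7,11,13,17,19,23} := by decide +kernel
  rw [this]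
  norm_num

lemma GG_first {x : ℝ} (h1 : 24.2 ≤ x) (h2 : x < 25) : GG x := by
  have hf : ⌊x⌋₊ = 24 := by
    rw [Nat.floor_eq_iff (by linarith)]
    norm_num; constructor <;> linarith
  have hP : PP (⌊x⌋₊ + 1) = 676039/110592 := by rw [hf]; exact PP25
  have hu := log25_hi
  have hxu : Real.log x ≤ 3.2188768 := (Real.log_le_log (by linarith) h2.le).trans hu
  have g1 := g_hi
  have g2 := g_lo
  have hl : ∀ a : ℝ, 24.2 ≤ a → a ≤ x → 3.186351 + 2*(a - 24.2)/(a+24.2) ≤ Real.log x := by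
    intro a ha hax
    have h3 := log_ge_frac (r := a/24.2) (by rw [le_div_iff₀ (by norm_num)]; linarith)
    rw [Real.log_div (by linarith) (by norm_num)] at h3
    have e : 2*(a/24.2 - 1)/(a/24.2+1) = 2*(a - 24.2)/(a+24.2) := by field_simp
    rw [e] at h3
    have := log242_lo
    have := Real.log_le_log (by linarith) hax
    linarith
  have key : ∀ a b r : ℝ, 24.2 ≤ a → a ≤ x → x ≤ b → 0 < r → b ≤ r^2 →
      0.5614764 * (676039/110592) ≤ 3.186351 + 2*(a - 24.2)/(a+24.2) + 0.11936 * (3.186351 + 2*(a - 24.2)/(a+24.2))^2/r → r ≤ 6 → GG x := by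
    intro a b r ha hax hxb hr hbr hc hr6
    have ht : 0 ≤ 2*(a - 24.2)/(a+24.2) := div_nonneg (by linarith) (by linarith)
    refine blk (La := 3.186351 + 2*(a - 24.2)/(a+24.2)) (Lh := 3.2188768) (r := r) (by linarith) (Real.sqrt_le_iff.mpr ⟨hr.le, by linarith⟩) (hl a ha hax) (by linarith) hxu le_rfl ?_ ?_
    · rw [hP]
      refine le_trans ?_ hc
      gcongr
    · rw [hP]
      have : 0 ≤ 0.11936 * (3.186351 + 2*(a - 24.2)/(a+24.2))^2/r := by positivity
      have : 0.561437 * (676039/110592) ≤ Real.exp (-Real.eulerMascheroniConstant) * (676039/110592) := by gcongr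
      norm_num at this ⊢
      linarith
  rcases le_total x 24.25 with h | h
  · exact key 24.2 24.25 4.9245 le_rfl h1 h (by norm_num) (by norm_num) (by norm_num) (by norm_num)
  rcases le_total x 24.5 with h' | h'
  · exact key 24.25 24.5 4.9498 (by norm_num) h h' (by norm_num) (by norm_num) (by norm_num) (by norm_num)
  · exact key 24.5 25 5 (by norm_num) h' h2.le (by norm_num) (by norm_num) (by norm_num) (by norm_num)

end MRH
end

section
open scoped Real
namespace MRH

def pn (D a : ℕ) : ℕ := bif Nat.beq (Nat.gcd D a) 1 then a else 1
def pd (D a : ℕ) : ℕ := bif Nat.beq (Nat.gcd D a) 1 then a - 1 else 1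
def tree (f : ℕ → ℕ) (d : ℕ) : ℕ → ℕ :=
  Nat.rec (fun a => f a) (fun k ih a => Nat.mul (ih a) (ih (Nat.add a (2^k)))) d

/-- One block: `Pl, Ph` bound the product over primes below `a`, `Ll, Lh` bound `log a` (scaled). -/
def chk (D M : ℕ) (l : List (ℕ × ℕ)) : ℕ → ℕ → ℕ → ℕ → ℕ → (ℕ → ℕ → ℕ → ℕ → ℕ → Bool) → Bool :=
  List.rec (fun a Pl Ph Ll Lh fin => fin a Pl Ph Ll Lh)
    (fun dk _ ih a Pl Ph Ll Lh fin =>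
      (fun b num den q =>
        (fun Ph' Lh' =>
          Nat.ble (10000 * b) (dk.2 * dk.2) && (Nat.ble b M &&
          (Nat.ble (5614764 * Ph') ((Ll + q) * 10000000) &&
          (Nat.ble (Lh' * 10000000) (5614370 * Pl + q * 10000000) &&
          ih b (Pl * num / den) Ph' (Ll + 2 * (b - a) * 10000000000 / (a + b)) Lh' fin))))
        (Ph * num / den + 1) (Lh + (b * b - a * a) * 10000000000 / (2 * a * b) + 1))
      (a + 2 ^ dk.1) (tree (pn D) dk.1 a) (tree (pd D) dk.1 a) (11936 * Ll * Ll / (10000000000 * dk.2 * 1000))) l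

lemma tree_eq (f : ℕ → ℕ) (d a : ℕ) : tree f d a = ∏ n ∈ Finset.Ico a (a + 2^d), f n := by
  induction d generalizing a with
  | zero => simp [tree]
  | succ d ih =>
    have : tree f (d+1) a = tree f d a * tree f d (a + 2^d) := rfl
    rw [this, ih, ih, Finset.prod_Ico_consecutive _ (Nat.le_add_right _ _) (Nat.le_add_right _ _)]
    have e : a + 2^d + 2^d = a + 2^(d+1) := by ring
    rw [e]

lemma coprime_iff {k n : ℕ} (h1 : k < n) (h1' : 2 ≤ n) (h2 : n < (k+1)^2) : Nat.gcd (k.factorial) n = 1 ↔ n.Prime := by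
  constructor
  · intro h
    by_contra hn
    have h3 := Nat.minFac_sq_le_self (by omega : 0 < n) hn
    have hp := Nat.minFac_prime (by omega : n ≠ 1)
    have h4 : n.minFac ≤ k := by
      by_contra hk
      push Not at hk
      have : (k+1)^2 ≤ n.minFac^2 := Nat.pow_le_pow_left hk 2
      omega
    have h5 := Nat.dvd_gcd ((hp.dvd_factorial).mpr h4) (Nat.minFac_dvd n)
    rw [h] at h5
    exact hp.one_lt.ne' (Nat.dvd_one.mp h5)
  · intro h
    exact ((h.coprime_iff_not_dvd.mpr (fun hd => by have := h.dvd_factorial.mp hd; omega)).symm)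

lemma PP_block {k a d : ℕ} (h1 : k < a) (h1' : 2 ≤ a) (h2 : a + 2^d ≤ (k+1)^2) :
    0 < tree (pd k.factorial) d a ∧ PP (a + 2^d) = PP a * (tree (pn k.factorial) d a : ℝ) / (tree (pd k.factorial) d a : ℝ) := by
  have hpos : 0 < tree (pd k.factorial) d a := by
    rw [tree_eq]
    refine Finset.prod_pos fun n hn => ?_
    rw [Finset.mem_Ico] at hn
    unfold pd
    cases Nat.beq (Nat.gcd k.factorial n) 1 <;> simp; omega
  refine ⟨hpos, ?_⟩
  rw [mul_div_assoc, tree_eq, tree_eq]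
  push_cast
  rw [← Finset.prod_div_distrib]
  unfold PP
  rw [Finset.prod_filter, Finset.prod_filter, ← Finset.prod_range_mul_prod_Ico _ (Nat.le_add_right _ _ : a ≤ a + 2^d)]
  congr 1
  refine Finset.prod_congr rfl fun n hn => ?_
  rw [Finset.mem_Ico] at hn
  have hc := coprime_iff (k := k) (n := n) (by omega) (by omega) (by omega)
  unfold pn pd
  split_ifs with h
  · have : Nat.beq (Nat.gcd k.factorial n) 1 = true := Nat.beq_eq.mpr (hc.mpr h) 
    rw [this]
    simp only [cond_true]
    have : (2:ℝ) ≤ n := by exact_mod_cast h.two_le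
    rw [Nat.cast_sub h.one_lt.le, Nat.cast_one, show 1 - 1/(n:ℝ) = (n-1)/n by field_simp, inv_div]
  · have : Nat.beq (Nat.gcd k.factorial n) 1 = false := by
      rw [Bool.eq_false_iff]; intro hb; exact h (hc.mp (Nat.beq_eq.mp hb))
    rw [this]
    simp

structure BInv (a Pl Ph Ll Lh : ℕ) : Prop where
  pl : (Pl:ℝ) ≤ 10000000000 * PP a
  ph : 10000000000 * PP a ≤ Ph
  ll : (Ll:ℝ) ≤ 10000000000 * Real.log a
  lh : 10000000000 * Real.log a ≤ Lh

lemma step {k a d r Pl Ph Ll Lh b num den q Ph' Lh' : ℕ} (h1 : k < a) (h1' : 2 ≤ a) (hI : BInv a Pl Ph Ll Lh)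
    (hb : b = a + 2^d) (hnum : num = tree (pn k.factorial) d a) (hden : den = tree (pd k.factorial) d a)
    (hq : q = 11936 * Ll * Ll / (10000000000 * r * 1000)) (hPh : Ph' = Ph * num / den + 1)
    (hLh : Lh' = Lh + (b * b - a * a) * 10000000000 / (2 * a * b) + 1)
    (c1 : 10000 * b ≤ r * r) (c2 : b ≤ (k+1)^2) (c3 : 5614764 * Ph' ≤ (Ll + q) * 10000000)
    (c4 : Lh' * 10000000 ≤ 5614370 * Pl + q * 10000000) :
    BInv b (Pl * num / den) Ph' (Ll + 2 * (b - a) * 10000000000 / (a + b)) Lh' ∧ ∀ x : ℝ, a ≤ x → x < b → GG x := by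
  have hab : a < b := by rw [hb]; have := Nat.pow_pos (n := d) (show 0 < 2 by norm_num); omega
  have haR : (2:ℝ) ≤ a := by exact_mod_cast h1'
  have habR : (a:ℝ) < b := by exact_mod_cast hab
  obtain ⟨hdp, hPP⟩ := PP_block (k := k) (d := d) h1 h1' (by omega)
  rw [← hb, ← hnum, ← hden] at hPP
  rw [← hden] at hdp
  have hdR : (0:ℝ) < den := by exact_mod_cast hdp
  have hnR : (0:ℝ) ≤ num := by positivity
  have up : ∀ m n : ℕ, (m:ℝ)/n ≤ ((m/n + 1 : ℕ):ℝ) := by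
    intro m n
    have := Nat.lt_floor_add_one ((m:ℝ)/n)
    rw [Nat.floor_div_eq_div] at this
    push_cast
    exact this.le
  have hlog : Real.log b = Real.log a + Real.log (b/a) := by
    rw [Real.log_div (by linarith) (by linarith)]; ring
  have hba : (1:ℝ) ≤ b/a := by rw [le_div_iff₀ (by linarith)]; linarith
  have J : BInv b (Pl * num / den) Ph' (Ll + 2 * (b - a) * 10000000000 / (a + b)) Lh' := by
    refine ⟨?_, ?_, ?_, ?_⟩
    · refine Nat.cast_div_le.trans ?_
      rw [hPP]; push_cast
      rw [← mul_div_assoc, ← mul_assoc]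
      gcongr
      exact hI.pl
    · rw [hPh]
      refine le_trans ?_ (up _ _)
      rw [hPP]; push_cast
      rw [← mul_div_assoc, ← mul_assoc]
      gcongr
      exact hI.ph
    · have h3 : ((2 * (b - a) * 10000000000 / (a + b) : ℕ):ℝ) ≤ 10000000000 * (2*((b:ℝ)/a-1)/(b/a+1)) := by
        refine Nat.cast_div_le.trans_eq ?_
        push_cast [Nat.cast_sub hab.le]
        field_simp
        ring
      have h4 := log_ge_frac hba
      push_cast at h3 ⊢
      rw [hlog]
      have := hI.ll
      linarith
    · have h3 : 10000000000 * (((b:ℝ)/a - ((b:ℝ)/a)⁻¹)/2) ≤ (((b * b - a * a) * 10000000000 / (2 * a * b) + 1 : ℕ):ℝ) := by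
        refine le_trans (le_of_eq ?_) (up _ _)
        have : a * a ≤ b * b := Nat.mul_le_mul hab.le hab.le
        push_cast [Nat.cast_sub this]
        field_simp
      have h4 := log_le_sinh hba
      rw [hLh, hlog]
      push_cast at h3 ⊢
      have := hI.lh
      linarith
  refine ⟨J, fun x hax hxb => ?_⟩
  have hr : (0:ℝ) < r := by
    have : 0 < r := by
      rcases Nat.eq_zero_or_pos r with h | h
      · subst h; omega
      · exact h
    exact_mod_cast this
  have c1R : 10000 * (b:ℝ) ≤ r * r := by exact_mod_cast c1
  have c3R : 5614764 * (Ph':ℝ) ≤ (Ll + q) * 10000000 := by exact_mod_cast c3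
  have c4R : (Lh':ℝ) * 10000000 ≤ 5614370 * Pl + q * 10000000 := by exact_mod_cast c4
  have hx0 : 0 < x := by linarith
  have fl : a ≤ ⌊x⌋₊ := Nat.le_floor hax
  have fu : ⌊x⌋₊ + 1 ≤ b := (Nat.floor_lt hx0.le).mpr hxb
  have hp1 := PP_mono (by omega : a ≤ ⌊x⌋₊ + 1)
  have hp2 := PP_mono fu
  have g1 := g_hi
  have g2 := g_lo
  have hlx1 : Real.log a ≤ Real.log x := Real.log_le_log (by linarith) hax
  have hlx2 : Real.log x ≤ Real.log b := Real.log_le_log hx0 hxb.le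
  have i1 := hI.pl
  have i2 := hI.ll
  have i3 := J.ph
  have i4 := J.lh
  have hPa : 0 ≤ PP a := by
    have : PP 0 = 1 := by simp [PP]
    linarith [PP_mono (Nat.zero_le a)]
  refine blk (La := Ll/10000000000) (Lh := Lh'/10000000000) (r := r/100) (q := q/10000000000) (by linarith) ?_ ?_ (by positivity) ?_ ?_ ?_ ?_
  · rw [Real.sqrt_le_iff]
    refine ⟨by positivity, ?_⟩
    rw [div_pow]; nlinarith
  · rw [div_le_iff₀ (by norm_num)]; linarith
  · rw [le_div_iff₀ (by norm_num)]; linarith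
  · rw [div_le_iff₀ (by norm_num), hq]
    refine Nat.cast_div_le.trans (le_of_eq ?_)
    push_cast
    field_simp
    norm_num
    try ring
  · calc _ ≤ 0.5614764 * PP b := by
          have : 0 ≤ PP (⌊x⌋₊ + 1) := hPa.trans hp1
          gcongr
      _ ≤ _ := by
        rw [← add_div, le_div_iff₀ (by norm_num)]
        norm_num
        linarith
  · calc (Lh':ℝ)/10000000000 ≤ 0.561437 * PP a + q/10000000000 := by
          rw [div_le_iff₀ (by norm_num)]
          have : (0.561437 * PP a + (q:ℝ)/10000000000) * 10000000000 = 0.561437 * PP a * 10000000000 + q := by field_simp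
          rw [this]
          linarith
      _ ≤ _ := by gcongr

lemma chk_sound {k : ℕ} (l : List (ℕ × ℕ)) {a Pl Ph Ll Lh : ℕ} {fin : ℕ → ℕ → ℕ → ℕ → ℕ → Bool} (h1 : k < a) (h1' : 2 ≤ a)
    (hI : BInv a Pl Ph Ll Lh) (h : chk k.factorial ((k+1)^2) l a Pl Ph Ll Lh fin = true) (x : ℝ) (hx : a ≤ x) :
    GG x ∨ ∃ a' Pl' Ph' Ll' Lh' : ℕ, BInv a' Pl' Ph' Ll' Lh' ∧ (a' : ℝ) ≤ x ∧ fin a' Pl' Ph' Ll' Lh' = true := by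
  induction l generalizing a Pl Ph Ll Lh with
  | nil => exact Or.inr ⟨a, Pl, Ph, Ll, Lh, hI, hx, h⟩
  | cons dk l ih =>
    have h' : (Nat.ble (10000 * (a + 2 ^ dk.1)) (dk.2 * dk.2) && (Nat.ble (a + 2 ^ dk.1) ((k+1)^2) &&
          (Nat.ble (5614764 * (Ph * tree (pn k.factorial) dk.1 a / tree (pd k.factorial) dk.1 a + 1)) ((Ll + 11936 * Ll * Ll / (10000000000 * dk.2 * 1000)) * 10000000) &&
          (Nat.ble ((Lh + ((a + 2 ^ dk.1) * (a + 2 ^ dk.1) - a * a) * 10000000000 / (2 * a * (a + 2 ^ dk.1)) + 1) * 10000000) (5614370 * Pl + 11936 * Ll * Ll / (10000000000 * dk.2 * 1000) * 10000000) &&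
          chk k.factorial ((k+1)^2) l (a + 2 ^ dk.1) (Pl * tree (pn k.factorial) dk.1 a / tree (pd k.factorial) dk.1 a) (Ph * tree (pn k.factorial) dk.1 a / tree (pd k.factorial) dk.1 a + 1) (Ll + 2 * (a + 2 ^ dk.1 - a) * 10000000000 / (a + (a + 2 ^ dk.1))) (Lh + ((a + 2 ^ dk.1) * (a + 2 ^ dk.1) - a * a) * 10000000000 / (2 * a * (a + 2 ^ dk.1)) + 1) fin)))) = true := h
    simp only [Bool.and_eq_true, Nat.ble_eq] at h'
    obtain ⟨c1, c2, c3, c4, h5⟩ := h'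
    obtain ⟨J, hG⟩ := step h1 h1' hI rfl rfl rfl rfl rfl rfl c1 c2 c3 c4
    rcases lt_or_ge x ((a + 2^dk.1 : ℕ) : ℝ) with hlt | hge
    · exact Or.inl (hG x hx hlt)
    · exact ih (h1.trans_le (Nat.le_add_right _ _)) (h1'.trans (Nat.le_add_right _ _)) J h5 hge

def l1 : List (ℕ × ℕ) := [(2, 539), (1, 557), (1, 575), (2, 609), (2, 641), (1, 656), (2, 686), (2, 715), (3, 769), (3, 819), (2, 843), (3, 889), (3, 933), (3, 975), (3, 1015), (3, 1054), (4, 1127), (4, 1196), (4, 1261), (4, 1323), (4, 1383), (5, 1494), (5, 1597), (5, 1695), (5, 1787), (2, 1798), (0, 1801)]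
def l2 : List (ℕ × ℕ) := [(5, 1887), (5, 1970), (5, 2050), (6, 2201), (6, 2341), (6, 2474), (6, 2601), (6, 2721), (6, 2836), (6, 2947), (7, 3156), (7, 3353), (7, 3539), (7, 3715), (7, 3884), (7, 4045), (7, 4201), (7, 4350), (7, 4495), (8, 4771), (8, 5032), (8, 5281), (8, 5518), (8, 5745), (8, 5964), (8, 6175), (8, 6379), (8, 6576), (8, 6768), (8, 6955), (9, 7314), (9, 7656), (9, 7983), (9, 8297), (9, 8601), (9, 8893), (9, 9177), (9, 9451), (9, 9719), (9, 9978), (9, 10232), (9, 10479), (9, 10721), (9, 10957), (9, 11188), (9, 11415), (10, 11855), (10, 12279), (10, 12689), (10, 13086), (10, 13472), (10, 13847), (10, 14212), (10, 14568), (10, 14915), (10, 15254), (10, 15586), (10, 15912), (10, 16230), (10, 16543), (10, 16849), (10, 17150), (10, 17446), (10, 17737), (10, 18024), (10, 18306), (10, 18583), (11, 19126), (11, 19655), (11, 20169), (11, 20670), (11, 21160), (11, 21638), (11, 22107), (11, 22565), (11, 23014), (11, 23455), (11, 23888), (11, 24313), (11, 24730), (11, 25141), (11, 25545), (11, 25943),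 (11, 26335), (11, 26721), (11, 27101), (11, 27476), (11, 27847), (11, 28212), (11, 28573), (11, 28929), (11, 29281), (11, 29628), (11, 29972), (11, 30312), (11, 30648), (11, 30980), (11, 31309), (11, 31634)]

theorem chk_ok : chk 355687428096000 324 l1 25 61129105179 61129105180 32188748000 32188768000 (fun a Pl Ph Ll Lh => Nat.beq a 324 &&
   chk 2056410584625275766114028688447474898050031704140968880610463735137473228595357640756197482760266023554168997586263919592886961249203349409557483536185374089092162349203260295131995580244836442680530520584901224764154954784360196586343451176126732634017946352199073308615878945685598982935022304287390316815402451985028639469728043315654079013700475646408464715509484032392283497998462422163717482998384498259564343998428185026720745307477933434532173854771549240804120160837896163757248489877840750268102837798901571619347642477742032446259650901942078749554461423850941631692800000000000000000000000000000000000000000000000000000000000000000000000000000 100489 l2 a Pl Ph Ll Lh (fun a _ _ _ _ => Nat.ble 100000 a)) = true := by decide +kernel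

lemma fac1 : Nat.factorial 17 = 355687428096000 := by decide +kernel
lemma fac2 : Nat.factorial 316 = 2056410584625275766114028688447474898050031704140968880610463735137473228595357640756197482760266023554168997586263919592886961249203349409557483536185374089092162349203260295131995580244836442680530520584901224764154954784360196586343451176126732634017946352199073308615878945685598982935022304287390316815402451985028639469728043315654079013700475646408464715509484032392283497998462422163717482998384498259564343998428185026720745307477933434532173854771549240804120160837896163757248489877840750268102837798901571619347642477742032446259650901942078749554461423850941631692800000000000000000000000000000000000000000000000000000000000000000000000000000 := by decide +kernel

theorem GG_small {x : ℝ} (h1 : 24.2 ≤ x) (h2 : x < 100000) : GG x := by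
  rcases lt_or_ge x 25 with h | h
  · exact GG_first h1 h
  have I0 : BInv 25 61129105179 61129105180 32188748000 32188768000 := by
    have a1 := log25_lo
    have a2 := log25_hi
    refine ⟨?_, ?_, ?_, ?_⟩
    · rw [PP25]; norm_num
    · rw [PP25]; norm_num
    · push_cast; linarith
    · push_cast; linarith
  have hc := chk_ok
  rw [← fac1] at hc
  rcases chk_sound (k := 17) l1 (by norm_num) (by norm_num) I0 hc x (by exact_mod_cast h) with hG | ⟨a, Pl, Ph, Ll, Lh, J, hax, hf⟩
  · exact hG
  rw [Bool.and_eq_true, Nat.beq_eq] at hf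
  obtain ⟨ha, hf⟩ := hf
  rw [← fac2] at hf
  rcases chk_sound (k := 316) l2 (by omega) (by omega) J hf x hax with hG | ⟨a', Pl', Ph', Ll', Lh', J', hax', hf'⟩
  · exact hG
  · exfalso
    rw [Nat.ble_eq] at hf'
    have : (100000:ℝ) ≤ a' := by exact_mod_cast hf'
    linarith

end MRH
end

section
open scoped Real
namespace MRH

lemma e_pow (n : ℕ) : Real.exp n = Real.exp 1 ^ n := by
  rw [← Real.exp_nat_mul, mul_one]

lemma exp23_hi : Real.exp 11.5 ≤ 100000 := by
  have h : Real.exp 11.5 ^ 2 = Real.exp 1 ^ 23 := by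
    rw [← Real.exp_nat_mul, ← e_pow]; norm_num
  have h2 : Real.exp 1 ^ 23 ≤ 2.7182818286 ^ 23 := by gcongr; exact Real.exp_one_lt_d9.le
  refine le_of_sq_le_sq ?_ (by norm_num)
  rw [h]
  refine h2.trans (by norm_num)

lemma exp575_lo : 300 ≤ Real.exp 5.75 := by
  have h : Real.exp 5.75 ^ 4 = Real.exp 1 ^ 23 := by
    rw [← Real.exp_nat_mul, ← e_pow]; norm_num
  have h2 : 2.7182818283 ^ 23 ≤ Real.exp 1 ^ 23 := by gcongr; exact Real.exp_one_gt_d9.le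
  refine le_of_pow_le_pow_left₀ (n := 4) (by norm_num) (Real.exp_pos _).le ?_
  rw [h]
  refine le_trans (by norm_num) h2

lemma Phi0_hi : Phi0 ≤ 0.02365 := by
  have hg := gamma_hi
  have : 2.53 ≤ Real.log (4*π) := by
    rw [Real.le_log_iff_exp_le (by positivity)]
    have h1 : Real.exp 2.53 = Real.exp 1 ^ 2 * Real.exp 0.53 := by
      rw [← Real.exp_nat_mul, ← Real.exp_add]; norm_num
    have h2 := exp_hi (x := 0.53) (by norm_num) (by norm_num)
    have h3 : Real.exp 1 ^ 2 ≤ 2.7182818286 ^ 2 := by gcongr; exact Real.exp_one_lt_d9.le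
    have hp := Real.pi_gt_d4
    rw [h1]
    have h4 : Real.exp 0.53 ≤ 1.69894 := by
      refine h2.trans ?_
      norm_num [Finset.sum_range_succ, Nat.factorial]
    calc _ ≤ (2.7182818286:ℝ)^2 * 1.69894 := by gcongr
      _ ≤ 4 * 3.1415 := by norm_num
      _ ≤ _ := by linarith
  unfold Phi0
  linarith

lemma SS_hi (hRH : RiemannHypothesis) {u : ℝ} (hu : 11.5 ≤ u) :
    2 * SS' (2/(√3/(π*Real.exp (u/2)))) ≤ 0.0597 * u^2 + 0.6428 := by
  have h3 : (0:ℝ) < √3 := by positivity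
  have he := Real.exp_pos (u/2)
  have hpi := Real.pi_pos
  have e : √3 * (2/(√3/(π*Real.exp (u/2)))) = 2*π*Real.exp (u/2) := by field_simp
  have h1 : (1:ℝ) ≤ Real.exp (u/2) := Real.one_le_exp (by linarith)
  have h := S_bound hRH (T := 2/(√3/(π*Real.exp (u/2)))) (by rw [e]; nlinarith)
  rw [e, show 2*π*Real.exp (u/2)/(2*π) = Real.exp (u/2) by field_simp, Real.log_exp] at h
  have h' : SS' (2/(√3/(π*Real.exp (u/2)))) ≤ 3 / π * (2 * π * Phi0 + (u / 2) ^ 2 / 8 + 1.18 / (2 * π)) := by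
    unfold SS'; exact h
  have hp := Real.pi_gt_d4
  have e2 : 2 * (3 / π * (2 * π * Phi0 + (u / 2) ^ 2 / 8 + 1.18 / (2 * π))) = 12 * Phi0 + 3/(16*π) * u^2 + 3.54/π^2 := by
    field_simp; ring
  have b1 : 3/(16*π) ≤ 0.0597 := by rw [div_le_iff₀ (by positivity)]; linarith
  have b2 : 3.54/π^2 ≤ 0.359 := by rw [div_le_iff₀ (by positivity)]; nlinarith
  have b3 := Phi0_hi
  have b4 : 3/(16*π) * u^2 ≤ 0.0597 * u^2 := by gcongr
  linarith

lemma E_bd (hRH : RiemannHypothesis) {u : ℝ} (hu : 11.5 ≤ u) (hs : 316 ≤ Real.exp (u/2)) :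
    |AA u - u + Real.eulerMascheroniConstant| ≤ (0.0598 * u^2 + 0.93) * Real.exp (-u/2) := by
  set s := Real.exp (u/2) with hsd
  set h := √3/(π*s) with hh
  have hp := Real.pi_gt_d4
  have hs0 : 0 < s := Real.exp_pos _
  have hh0 : 0 < h := by positivity
  have h3 : √3 ≤ 1.7321 := by rw [Real.sqrt_le_iff]; norm_num
  have h3' : 1.732 ≤ √3 := Real.le_sqrt_of_sq_le (by norm_num)
  have ei : Real.exp (-u/2) = 1/s := by
    rw [hsd, one_div, ← Real.exp_neg]; congr 1; ring
  have e3 : Real.exp (-3*u) = 1/s^6 := by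
    rw [hsd, one_div, ← Real.exp_nat_mul, ← Real.exp_neg]; congr 1; push_cast; ring
  have b1 : h ≤ 0.5514 / s := by
    rw [hh, div_le_div_iff₀ (by positivity) hs0]
    nlinarith
  have b2 : 0.55 / s ≤ h := by
    rw [hh, div_le_div_iff₀ hs0 (by positivity)]
    have := Real.pi_lt_d4
    nlinarith
  have hS := SS_hi hRH hu
  rw [← hsd, ← hh] at hS
  have hS0 := SS'_nonneg hRH (T := 2/h) (by positivity)
  have b3 : h ≤ 0.0018 := b1.trans (by rw [div_le_iff₀ hs0]; linarith)
  have U := E_upper hRH (u := u) (h := h) (by linarith) hh0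
  have W := E_lower hRH (u := u) (h := h) (by linarith) hh0
  rw [abs_le]
  constructor
  · have e4 : Real.exp (-(u-h)/2) = 1/s * Real.exp (h/2) := by
      rw [← ei, ← Real.exp_add]; congr 1; ring
    rw [e4] at W
    have e5 : Real.exp (h/2) ≤ 1.001 := by
      have := Real.exp_bound' (x := h/2) (n := 2) (by linarith) (by linarith) (by norm_num)
      norm_num [Finset.sum_range_succ, Nat.factorial] at this
      nlinarith
    rw [ei]
    have : 2 * (1/s * Real.exp (h/2)) * SS' (2/h) ≤ 1.001 * (0.0597 * u^2 + 0.6428) / s := by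
      calc _ = Real.exp (h/2) * (2 * SS' (2/h)) / s := by ring
        _ ≤ _ := by gcongr
    have e6 : 1.001 * (0.0597 * u^2 + 0.6428) / s + 0.2757 / s ≤ (0.0598 * u^2 + 0.93) * (1/s) := by
      rw [← add_div, mul_one_div]; refine div_le_div_of_nonneg_right ?_ hs0.le; nlinarith
    have e7 : h/2 ≤ 0.2757 / s := by
      have : 0.5514/s = 2 * (0.2757/s) := by ring
      linarith
    linarith
  · rw [e3, ei] at U
    rw [ei]
    have : 2 * (1/s) * SS' (2/h) ≤ (0.0597 * u^2 + 0.6428) / s := by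
      calc _ = (2 * SS' (2/h)) / s := by ring
        _ ≤ _ := by gcongr
    have e8 : 1/s^6/(4*h) ≤ 0.001 / s := by
      have : 0.55/s ≤ h := b2
      rw [div_le_iff₀ (by positivity)]
      calc 1/s^6 ≤ 0.001/s * (4*(0.55/s)) := by
            have : 0.001/s * (4*(0.55/s)) = 0.0022/s^2 := by field_simp; norm_num
            rw [this, div_le_div_iff₀ (by positivity) (by positivity)]
            have : (316:ℝ)^4 ≤ s^4 := by gcongr
            have h2 : 0 < s^2 := by positivity
            have : s^6 = s^4 * s^2 := by ring
            nlinarith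
        _ ≤ _ := by gcongr
    have e6 : (0.0597 * u^2 + 0.6428) / s + 0.2757 / s + 0.001/s ≤ (0.0598 * u^2 + 0.93) * (1/s) := by
      rw [← add_div, ← add_div, mul_one_div]; refine div_le_div_of_nonneg_right ?_ hs0.le; nlinarith
    have e7 : h/2 ≤ 0.2757 / s := by
      have : 0.5514/s = 2 * (0.2757/s) := by ring
      linarith
    linarith

lemma logP_bd (hRH : RiemannHypothesis) {u : ℝ} (hu : 11.5 ≤ u) (hs : 316 ≤ Real.exp (u/2)) :
    |Real.log (PP (⌊Real.exp u⌋₊ + 1)) - Real.log u - Real.eulerMascheroniConstant| ≤ (0.0598 * u + 0.6) * Real.exp (-u/2) := by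
  have hE := E_bd hRH hu hs
  have hM := MM_asymp hRH (u := u) (by have := Real.log_two_lt_d9; linarith)
  rw [c0_eq hRH] at hM
  have hR := RR_bound hRH (v := u) (by linarith)
  have hJ := Jt_bound hRH (u := u) (by linarith)
  obtain ⟨t1, t2⟩ := P_tail (u := u) (by linarith)
  change 0 ≤ Real.log (PP (⌊Real.exp u⌋₊ + 1)) - MM u at t1
  change Real.log (PP (⌊Real.exp u⌋₊ + 1)) - MM u ≤ _ at t2
  generalize Real.log (PP (⌊Real.exp u⌋₊ + 1)) = G at t1 t2 ⊢
  have hP := Phi0_hi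
  have hc : 1/4 + 2*Phi0 ≤ 0.3 := by linarith
  set s := Real.exp (u/2) with hsd
  have hs0 : 0 < s := Real.exp_pos _
  have ei : Real.exp (-u/2) = 1/s := by
    rw [hsd, one_div, ← Real.exp_neg]; congr 1; ring
  have eu : Real.exp u = s^2 := by
    rw [hsd, ← Real.exp_nat_mul]; congr 1; push_cast; ring
  set E := AA u - u + Real.eulerMascheroniConstant with hEd
  rw [eu] at t2
  rw [ei] at hE hR hJ ⊢
  set w := 1/s with hw
  have hw0 : 0 < w := by positivity
  have u0 : 0 < u := by linarith
  have c1 : |E/u| ≤ (0.0598 * u + 0.0809) * w := by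
    rw [abs_div, abs_of_pos u0, div_le_iff₀ u0]
    refine hE.trans ?_
    nlinarith
  have c2 : |RR u/u^2| ≤ 0.0024 * w := by
    rw [abs_div, abs_of_pos (by positivity : 0 < u^2), div_le_iff₀ (by positivity)]
    refine hR.trans ?_
    have : (132:ℝ) ≤ u^2 := by nlinarith
    calc _ ≤ 0.3 * w := by gcongr
      _ ≤ 0.0024 * w * 132 := by linarith
      _ ≤ _ := by gcongr
  have c3 : |Jt u| ≤ 0.0009 * w := by
    refine hJ.trans ?_
    gcongr
    rw [div_le_iff₀ (by positivity)]
    have : (1500:ℝ) ≤ u^3 := by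
      calc (1500:ℝ) ≤ 11.5^3 := by norm_num
        _ ≤ u^3 := by gcongr
    linarith
  have c4 : 1/4 * (1/(s - 3/2)) + (3/4 * s + 5/4)/(3 * s^2) ≤ 0.503 * w := by
    have a1 : 1/(s - 3/2) ≤ 1.005 * w := by
      rw [hw, mul_one_div, div_le_div_iff₀ (by linarith) hs0]; linarith
    have a2 : (3/4 * s + 5/4)/(3 * s^2) ≤ 0.2515 * w := by
      rw [hw, mul_one_div, div_le_div_iff₀ (by positivity) hs0]; nlinarith
    linarith
  rw [abs_le] at *
  constructor <;> nlinarith [c1.1, c1.2, c2.1, c2.2, c3.1, c3.2]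

theorem GG_large (hRH : RiemannHypothesis) {x : ℝ} (hx : 100000 ≤ x) : GG x := by
  have hx0 : 0 < x := by linarith
  set u := Real.log x with hud
  have hxu : x = Real.exp u := (Real.exp_log hx0).symm
  have hu : 11.5 ≤ u := by
    rw [hud, Real.le_log_iff_exp_le hx0]; exact exp23_hi.trans hx
  have hsq : Real.sqrt x = Real.exp (u/2) := by
    rw [hxu, Real.sqrt_eq_iff_mul_self_eq_of_pos (Real.exp_pos _), ← Real.exp_add]; congr 1; ring
  have hs : 316 ≤ Real.exp (u/2) := by
    rw [← hsq]; exact Real.le_sqrt_of_sq_le (by linarith)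
  have hB := logP_bd hRH hu hs
  rw [← hxu] at hB
  have hPpos : 0 < PP (⌊x⌋₊ + 1) := by
    have : PP 0 = 1 := by simp [PP]
    linarith [PP_mono (Nat.zero_le (⌊x⌋₊ + 1))]
  set s := Real.exp (u/2) with hsd
  have hs0 : 0 < s := Real.exp_pos _
  have ei : Real.exp (-u/2) = 1/s := by
    rw [hsd, one_div, ← Real.exp_neg]; congr 1; ring
  rw [ei] at hB
  set δ := Real.log (PP (⌊x⌋₊ + 1)) - Real.log u - Real.eulerMascheroniConstant with hδ
  have hy : Real.exp (-Real.eulerMascheroniConstant) * PP (⌊x⌋₊ + 1) = u * Real.exp δ := by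
    have : Real.exp δ = PP (⌊x⌋₊ + 1) / u * Real.exp (-Real.eulerMascheroniConstant) := by
      rw [hδ, sub_eq_add_neg, Real.exp_add, Real.exp_sub, Real.exp_log hPpos, Real.exp_log (by linarith)]
    rw [this]; field_simp
  have hs2 : 300 * (1 + (u/2 - 5.75)) ≤ s := by
    have : s = Real.exp 5.75 * Real.exp (u/2 - 5.75) := by rw [hsd, ← Real.exp_add]; congr 1; ring
    rw [this]
    have h1 := Real.add_one_le_exp (u/2 - 5.75)
    have h2 := exp575_lo
    apply mul_le_mul h2 (by linarith) (by linarith) (Real.exp_pos _).le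
  have hd1 : |δ| ≤ 0.02 := by
    refine hB.trans ?_
    rw [mul_one_div, div_le_iff₀ hs0]; linarith
  have hd2 : |Real.exp δ - 1| ≤ 0.11936 * u / s := by
    have h1 := Real.abs_exp_sub_one_sub_id_le (x := δ) (by linarith)
    have h2 : |Real.exp δ - 1| ≤ |δ| + δ^2 := by
      calc _ = |(Real.exp δ - 1 - δ) + δ| := by ring_nf
        _ ≤ _ := abs_add_le _ _
        _ ≤ _ := by linarith
    have h3 : δ^2 ≤ 0.02 * |δ| := by
      rw [← sq_abs]; nlinarith [abs_nonneg δ]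
    calc _ ≤ 1.02 * |δ| := by linarith
      _ ≤ 1.02 * ((0.0598 * u + 0.6) * (1/s)) := by gcongr
      _ = 1.02 * (0.0598 * u + 0.6) / s := by ring
      _ ≤ _ := div_le_div_of_nonneg_right (by linarith) hs0.le
  have hd3 := abs_le.mp hd2
  have e : 0.11936 * u^2/s = u * (0.11936 * u/s) := by ring
  have u0 : 0 < u := by linarith
  refine GG_of (by linarith) ?_ ?_
  · rw [hy, ← hud, hsq, e]; nlinarith
  · rw [hy, ← hud, hsq, e]; nlinarith

theorem final (hRH : RiemannHypothesis) {x : ℝ} (hx : 24.2 ≤ x) : GG x := by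
  rcases lt_or_ge x 100000 with h | h
  · exact GG_small hx h
  · exact GG_large hRH h

end MRH
end


open Real Finset

theorem mertens_third_inv_RH (hRH : RiemannHypothesis) :
    ∀ x : ℝ, 24.2 ≤ x →
      |Real.exp (-Real.eulerMascheroniConstant) / Real.log x *
          (∏ p ∈ (Finset.range (⌊x⌋₊ + 1)).filter Nat.Prime, (1 - 1 / (p : ℝ))⁻¹) - 1|
        ≤ 3 * Real.log x / (8 * π * Real.sqrt x) := by
  
  intro x hx
  exact MRH.final hRH hx
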